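/- arXiv:1306.3676 — 4 statements merged into one kernel-verified Lean document; each statement's English description precedes it below -/
import Mathlib

section
/- Let v ∈ C^1(ℝ) with v(ξ) > 0 for all ξ. For locally absolutely continuous g : ℝ → ℂ set ‖g‖_v^2 = ∫_ℝ (v(ξ)^2 |g'(ξ)|^2 + v(ξ)^{-2} |g(ξ)|^2) dξ. Then the following are equivalent: (i) ∫_0^∞ v(ξ)^{-2} dξ = ∞ and ∫_{-∞}^0 v(ξ)^{-2} dξ = ∞; (ii) for every locally absolutely continuous g with ‖g‖_v < ∞ and every ε > 0 there exists φ ∈ C_c^1(ℝ) with ‖g − φ‖_v < ε. -/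
open MeasureTheory Real Set
open scoped ENNReal

/-- `g` is locally absolutely continuous with (a.e.) derivative `g'`: `g'` is locally
integrable and `g(x) = g(0) + ∫_0^x g'(t) dt` for all `x`. -/
def IsLocAC (g g' : ℝ → ℂ) : Prop :=
  MeasureTheory.LocallyIntegrable g' (volume : Measure ℝ)
    ∧ ∀ x : ℝ, g x = g 0 + ∫ t in (0 : ℝ)..x, g' t

/-- The squared weighted norm `‖g‖_v² = ∫ (v² |g'|² + v⁻² |g|²)`, as a value in `[0,∞]`. -/
noncomputable def vNormSq (v : ℝ → ℝ) (g g' : ℝ → ℂ) : ℝ≥0∞ :=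
  ∫⁻ ξ, ENNReal.ofReal ((v ξ) ^ 2 * ‖g' ξ‖ ^ 2)
    + ENNReal.ofReal (((v ξ) ^ 2)⁻¹ * ‖g ξ‖ ^ 2)

open Filter Topology

lemma aux_integral_bound (v : ℝ → ℝ) (hv : Continuous v) (hvpos : ∀ ξ, 0 < v ξ)
    (f : ℝ → ℂ) (l : ℝ) (hl : 0 < l) (a b : ℝ) :
    ‖∫ x in a..b, f x‖ₑ ≤ ENNReal.ofReal l * (∫⁻ x, ENNReal.ofReal ((v x) ^ 2 * ‖f x‖ ^ 2))
      + ENNReal.ofReal (1 / (4 * l)) * ∫⁻ x in uIoc a b, ENNReal.ofReal (((v x) ^ 2)⁻¹) := by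
  have h1 : ‖∫ x in a..b, f x‖ₑ = ‖∫ x in uIoc a b, f x‖ₑ := by
    rw [← ofReal_norm, ← ofReal_norm, intervalIntegral.norm_integral_eq_norm_integral_uIoc]
  have hc : Continuous fun x => ((v x) ^ 2)⁻¹ :=
    (hv.pow 2).inv₀ (fun x => (pow_pos (hvpos x) 2).ne')
  have hm : Measurable fun x => ENNReal.ofReal (((v x) ^ 2)⁻¹) := hc.measurable.ennreal_ofReal
  rw [h1]
  calc ‖∫ x in uIoc a b, f x‖ₑ ≤ ∫⁻ x in uIoc a b, ‖f x‖ₑ := enorm_integral_le_lintegral_enorm _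
    _ ≤ ∫⁻ x in uIoc a b, (ENNReal.ofReal l * ENNReal.ofReal ((v x) ^ 2 * ‖f x‖ ^ 2)
          + ENNReal.ofReal (1 / (4 * l)) * ENNReal.ofReal (((v x) ^ 2)⁻¹)) := by
        apply lintegral_mono
        intro x
        have hx := hvpos x
        dsimp only
        rw [← ofReal_norm, ← ENNReal.ofReal_mul hl.le, ← ENNReal.ofReal_mul (by positivity),
          ← ENNReal.ofReal_add (by positivity) (by positivity)]
        apply ENNReal.ofReal_le_ofReal
        have : l * (v x ^ 2 * ‖f x‖ ^ 2) + 1 / (4 * l) * (v x ^ 2)⁻¹ - ‖f x‖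
            = (2 * l * v x ^ 2 * ‖f x‖ - 1) ^ 2 / (4 * l * v x ^ 2) := by
          field_simp
          ring
        have h2 : 0 ≤ (2 * l * v x ^ 2 * ‖f x‖ - 1) ^ 2 / (4 * l * v x ^ 2) := by positivity
        linarith
    _ = ENNReal.ofReal l * (∫⁻ x in uIoc a b, ENNReal.ofReal ((v x) ^ 2 * ‖f x‖ ^ 2))
      + ENNReal.ofReal (1 / (4 * l)) * ∫⁻ x in uIoc a b, ENNReal.ofReal (((v x) ^ 2)⁻¹) := by
        rw [lintegral_add_right _ (hm.const_mul _), lintegral_const_mul' _ _ ENNReal.ofReal_ne_top,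
          lintegral_const_mul' _ _ ENNReal.ofReal_ne_top]
    _ ≤ _ := by
        gcongr
        exact Measure.restrict_le_self

lemma aux_isLocAC (g : ℝ → ℂ) (hg : ContDiff ℝ 1 g) : IsLocAC g (deriv g) := by
  refine ⟨hg.continuous_deriv_one.locallyIntegrable, fun x => ?_⟩
  rw [intervalIntegral.integral_deriv_eq_sub (fun y _ => hg.differentiable one_ne_zero y)
    (hg.continuous_deriv_one.intervalIntegrable _ _)]
  ring

lemma aux_vNormSq_neg (v : ℝ → ℝ) (h : ℝ → ℂ) :
    vNormSq (fun x => v (-x)) (fun x => h (-x)) (deriv (fun x => h (-x)))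
      = vNormSq v h (deriv h) := by
  unfold vNormSq
  have : deriv (fun x => h (-x)) = fun x => - deriv h (-x) := by
    ext x
    exact deriv_comp_neg h x
  rw [this]
  simp only [norm_neg]
  exact lintegral_neg_eq_self (μ := volume) (fun ξ => ENNReal.ofReal ((v ξ) ^ 2 * ‖deriv h ξ‖ ^ 2)
    + ENNReal.ofReal (((v ξ) ^ 2)⁻¹ * ‖h ξ‖ ^ 2))

lemma aux_compact_fin (w : ℝ → ℝ) (hw : Continuous w) (a b : ℝ) :
    ∫⁻ x in Icc a b, ENNReal.ofReal (w x) < ⊤ := by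
  exact setLIntegral_lt_top_of_isCompact (f := fun x => (w x).toNNReal)
    (by simp) isCompact_Icc (by fun_prop)

/-- Trace-type lower bound. -/
lemma aux_lower (v : ℝ → ℝ) (hv : Continuous v) (hvpos : ∀ ξ, 0 < v ξ)
    (hfin : ∫⁻ ξ in Ioi (0 : ℝ), ENNReal.ofReal (((v ξ) ^ 2)⁻¹) ≠ ⊤) :
    ∃ ε : ℝ, 0 < ε ∧ ∀ h : ℝ → ℂ, ContDiff ℝ 1 h → (∃ M, ∀ x, M ≤ x → h x = 1) →
      ENNReal.ofReal (ε ^ 2) ≤ vNormSq v h (deriv h) := by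
  have hc : Continuous fun x => ((v x) ^ 2)⁻¹ :=
    (hv.pow 2).inv₀ (fun x => (pow_pos (hvpos x) 2).ne')
  have hm : Measurable fun x => ENNReal.ofReal (((v x) ^ 2)⁻¹) := hc.measurable.ennreal_ofReal
  set A := (∫⁻ ξ in Ioi (0 : ℝ), ENNReal.ofReal (((v ξ) ^ 2)⁻¹)).toReal + 1 with hA
  have hA0 : 0 < A := by positivity
  have hAle : ∫⁻ ξ in Ioi (0 : ℝ), ENNReal.ofReal (((v ξ) ^ 2)⁻¹) ≤ ENNReal.ofReal A := by
    rw [← ENNReal.ofReal_toReal hfin]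
    exact ENNReal.ofReal_le_ofReal (by linarith)
  clear_value A
  obtain ⟨z, hz, hzmax⟩ := (isCompact_Icc (a := (0:ℝ)) (b := 1)).exists_isMinOn
    (nonempty_Icc.2 zero_le_one) hc.continuousOn
  set c := ((v z) ^ 2)⁻¹ with hcdef
  have hcpos : 0 < c := inv_pos.2 (pow_pos (hvpos z) 2)
  have hcmin : ∀ x ∈ Icc (0:ℝ) 1, c ≤ ((v x) ^ 2)⁻¹ := fun x hx => hzmax hx
  set e := min (1 / (4 * A)) (c / 4) with he
  have hepos : 0 < e := by positivity
  refine ⟨√e, Real.sqrt_pos.2 hepos, ?_⟩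
  rw [Real.sq_sqrt hepos.le]
  rintro h hh ⟨M, hM⟩
  by_contra! hlt
  have hD : ∫⁻ x, ENNReal.ofReal ((v x) ^ 2 * ‖deriv h x‖ ^ 2) ≤ ENNReal.ofReal e := by
    refine le_trans ?_ hlt.le
    exact lintegral_mono fun x => le_self_add
  have hF : ∫⁻ x, ENNReal.ofReal (((v x) ^ 2)⁻¹ * ‖h x‖ ^ 2) < ENNReal.ofReal e := by
    refine lt_of_le_of_lt ?_ hlt
    exact lintegral_mono fun x => le_add_self
  have hhalf : ∀ y ∈ Icc (0:ℝ) 1, 1 / 2 ≤ ‖h y‖ := by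
    intro y hy
    set N := max M 1
    have hyN : y ≤ N := hy.2.trans (le_max_right _ _)
    have h1 := intervalIntegral.integral_deriv_eq_sub (a := y) (b := N)
      (fun y _ => hh.differentiable one_ne_zero y)
      (hh.continuous_deriv_one.intervalIntegrable _ _)
    rw [hM N (le_max_left _ _)] at h1
    have h2 := aux_integral_bound v hv hvpos (deriv h) A hA0 y N
    rw [h1] at h2
    have h3 : ∫⁻ x in uIoc y N, ENNReal.ofReal (((v x) ^ 2)⁻¹) ≤ ENNReal.ofReal A := by
      refine le_trans (lintegral_mono_set ?_) hAle
      rw [uIoc_of_le hyN]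
      intro x hx
      exact lt_of_le_of_lt hy.1 hx.1
    have h4 : ‖1 - h y‖ₑ ≤ ENNReal.ofReal (1 / 2) := by
      refine h2.trans ?_
      calc _ ≤ ENNReal.ofReal A * ENNReal.ofReal e
            + ENNReal.ofReal (1 / (4 * A)) * ENNReal.ofReal A := by gcongr
        _ = ENNReal.ofReal (A * e + 1 / (4 * A) * A) := by
            rw [ENNReal.ofReal_add (by positivity) (by positivity), ENNReal.ofReal_mul hA0.le,
              ENNReal.ofReal_mul (by positivity)]
        _ ≤ _ := by
            apply ENNReal.ofReal_le_ofReal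
            have : A * e ≤ A * (1 / (4 * A)) := by gcongr; exact min_le_left _ _
            have h5 : A * (1 / (4 * A)) = 1 / 4 := by field_simp
            have h6 : (1 / (4 * A)) * A = 1 / 4 := by field_simp
            linarith
    rw [← ofReal_norm, ENNReal.ofReal_le_ofReal_iff (by norm_num)] at h4
    have h5 := norm_sub_norm_le (1:ℂ) (h y)
    rw [norm_one] at h5
    linarith
  have : ENNReal.ofReal e ≤ ∫⁻ x, ENNReal.ofReal (((v x) ^ 2)⁻¹ * ‖h x‖ ^ 2) := by
    calc ENNReal.ofReal e = ∫⁻ x in Icc (0:ℝ) 1, ENNReal.ofReal e := by simp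
      _ ≤ ∫⁻ x in Icc (0:ℝ) 1, ENNReal.ofReal (((v x) ^ 2)⁻¹ * ‖h x‖ ^ 2) := by
          apply setLIntegral_mono' measurableSet_Icc
          intro x hx
          apply ENNReal.ofReal_le_ofReal
          have h1 := hhalf x hx
          have h2 := hcmin x hx
          calc e ≤ c / 4 := min_le_right _ _
            _ = c * (1 / 2) ^ 2 := by ring
            _ ≤ _ := by gcongr
      _ ≤ _ := lintegral_mono' Measure.restrict_le_self le_rfl
  exact absurd hF (not_lt.2 this)

/-- The test function. -/
noncomputable def auxStep (x : ℝ) : ℂ := ((Real.smoothTransition (x + 1) : ℝ) : ℂ)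

lemma auxStep_contDiff : ContDiff ℝ 1 auxStep := by
  unfold auxStep
  have h : ContDiff ℝ 1 fun x : ℝ => Real.smoothTransition (x + 1) :=
    (Real.smoothTransition.contDiff (n := 1)).comp (contDiff_id.add contDiff_const)
  exact Complex.ofRealCLM.contDiff.comp h

lemma auxStep_one (x : ℝ) (hx : 0 ≤ x) : auxStep x = 1 := by
  unfold auxStep
  rw [Real.smoothTransition.one_of_one_le (by linarith)]; simp

lemma auxStep_zero (x : ℝ) (hx : x ≤ -1) : auxStep x = 0 := by
  unfold auxStep
  rw [Real.smoothTransition.zero_of_nonpos (by linarith)]; simp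

lemma auxStep_norm (x : ℝ) : ‖auxStep x‖ ≤ 1 := by
  unfold auxStep
  rw [Complex.norm_real, Real.norm_of_nonneg (Real.smoothTransition.nonneg _)]
  exact Real.smoothTransition.le_one _

lemma auxStep_deriv (x : ℝ) (hx : x ∉ Icc (-1:ℝ) 0) : deriv auxStep x = 0 := by
  rw [mem_Icc, not_and_or, not_le, not_le] at hx
  rcases hx with hx | hx
  · have : auxStep =ᶠ[𝓝 x] fun _ => 0 := by
      filter_upwards [Iio_mem_nhds hx] with y hy using auxStep_zero y (le_of_lt hy)
    rw [this.deriv_eq]; simp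
  · have : auxStep =ᶠ[𝓝 x] fun _ => 1 := by
      filter_upwards [Ioi_mem_nhds hx] with y hy using auxStep_one y (le_of_lt hy)
    rw [this.deriv_eq]; simp

lemma auxStep_fin (v : ℝ → ℝ) (hv : Continuous v) (hvpos : ∀ ξ, 0 < v ξ)
    (hfin : ∫⁻ ξ in Ioi (0 : ℝ), ENNReal.ofReal (((v ξ) ^ 2)⁻¹) ≠ ⊤) :
    vNormSq v auxStep (deriv auxStep) < ⊤ := by
  have hc : Continuous fun x => ((v x) ^ 2)⁻¹ :=
    (hv.pow 2).inv₀ (fun x => (pow_pos (hvpos x) 2).ne')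
  have hd : Continuous fun x => (v x) ^ 2 * ‖deriv auxStep x‖ ^ 2 :=
    (hv.pow 2).mul (auxStep_contDiff.continuous_deriv_one.norm.pow 2)
  have hm : Measurable fun x => ENNReal.ofReal (((v x) ^ 2)⁻¹) := hc.measurable.ennreal_ofReal
  have hm2 : Measurable fun x => ENNReal.ofReal ((v x) ^ 2 * ‖deriv auxStep x‖ ^ 2) :=
    hd.measurable.ennreal_ofReal
  unfold vNormSq
  rw [lintegral_add_left hm2]
  refine ENNReal.add_lt_top.2 ⟨?_, ?_⟩
  · refine lt_of_le_of_lt ?_ (aux_compact_fin _ hd (-1) 0)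
    rw [← lintegral_indicator measurableSet_Icc]
    apply lintegral_mono
    intro x
    by_cases hx : x ∈ Icc (-1:ℝ) 0
    · simp [indicator_of_mem hx]
    · simp [auxStep_deriv x hx]
  · calc _ ≤ ∫⁻ x in Icc (-1:ℝ) 0 ∪ Ioi 0, ENNReal.ofReal (((v x) ^ 2)⁻¹) := by
          rw [← lintegral_indicator (measurableSet_Icc.union measurableSet_Ioi)]
          apply lintegral_mono
          intro x
          by_cases hx : x ∈ Icc (-1:ℝ) 0 ∪ Ioi 0
          · rw [indicator_of_mem hx]
            apply ENNReal.ofReal_le_ofReal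
            have h1 := auxStep_norm x
            have h2 : 0 < ((v x) ^ 2)⁻¹ := inv_pos.2 (pow_pos (hvpos x) 2)
            have h3 : ‖auxStep x‖ ^ 2 ≤ 1 := pow_le_one₀ (norm_nonneg _) h1
            nlinarith
          · have : x ≤ -1 := by
              simp only [mem_union, mem_Icc, mem_Ioi, not_or, not_and, not_le, not_lt] at hx
              by_contra! h
              linarith [hx.1 h.le]
            simp [auxStep_zero x this]
      _ ≤ _ := lintegral_union_le _ _ _
      _ < ⊤ := ENNReal.add_lt_top.2 ⟨aux_compact_fin _ hc _ _, hfin.lt_top⟩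

lemma aux_tail (φ : ℝ → ℂ) (hφ : HasCompactSupport φ) : ∃ M, ∀ x, M ≤ |x| → φ x = 0 := by
  obtain ⟨R, hR⟩ := hφ.isCompact.isBounded.subset_closedBall (0:ℝ)
  refine ⟨R + 1, fun x hx => ?_⟩
  by_contra hne
  have := hR (subset_tsupport φ hne)
  rw [Metric.mem_closedBall, dist_zero_right, Real.norm_eq_abs] at this
  linarith

lemma aux_backward
    (v : ℝ → ℝ) (hv : Continuous v) (hvpos : ∀ ξ, 0 < v ξ)
    (H : ∀ g g' : ℝ → ℂ, IsLocAC g g' → vNormSq v g g' < ⊤ →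
          ∀ ε : ℝ, 0 < ε → ∃ φ : ℝ → ℂ, ContDiff ℝ 1 φ ∧ HasCompactSupport φ ∧
            vNormSq v (fun ξ => g ξ - φ ξ) (fun ξ => g' ξ - deriv φ ξ)
              < ENNReal.ofReal (ε ^ 2)) :
    ((∫⁻ ξ in Ioi (0 : ℝ), ENNReal.ofReal (((v ξ) ^ 2)⁻¹) = ⊤)
        ∧ (∫⁻ ξ in Iio (0 : ℝ), ENNReal.ofReal (((v ξ) ^ 2)⁻¹) = ⊤)) := by
  have hder : ∀ g φ : ℝ → ℂ, ContDiff ℝ 1 g → ContDiff ℝ 1 φ →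
      (fun ξ => deriv g ξ - deriv φ ξ) = deriv (fun ξ => g ξ - φ ξ) := by
    intro g φ hg hφ
    ext x
    exact (deriv_fun_sub (hg.differentiable one_ne_zero x)
      (hφ.differentiable one_ne_zero x)).symm
  constructor
  · by_contra hfin
    obtain ⟨ε, hε, hlow⟩ := aux_lower v hv hvpos hfin
    obtain ⟨φ, hφ, hφc, hlt⟩ := H auxStep (deriv auxStep) (aux_isLocAC _ auxStep_contDiff)
      (auxStep_fin v hv hvpos hfin) ε hε
    rw [hder _ _ auxStep_contDiff hφ] at hlt
    refine absurd hlt (not_lt.2 (hlow _ (auxStep_contDiff.sub hφ) ?_))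
    obtain ⟨M, hM⟩ := aux_tail φ hφc
    refine ⟨max M 0, fun x hx => ?_⟩
    rw [auxStep_one x ((le_max_right _ _).trans hx),
      hM x (((le_max_left _ _).trans hx).trans (le_abs_self x)), sub_zero]
  · by_contra hfin
    have hvn : Continuous fun x => v (-x) := hv.comp continuous_neg
    have hvnpos : ∀ x, 0 < v (-x) := fun x => hvpos _
    have hfin' : ∫⁻ ξ in Ioi (0 : ℝ), ENNReal.ofReal (((v (-ξ)) ^ 2)⁻¹) ≠ ⊤ := by
      have : ∫⁻ ξ in Ioi (0 : ℝ), ENNReal.ofReal (((v (-ξ)) ^ 2)⁻¹)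
          = ∫⁻ ξ in Iio (0 : ℝ), ENNReal.ofReal (((v ξ) ^ 2)⁻¹) := by
        rw [← lintegral_indicator measurableSet_Ioi, ← lintegral_indicator measurableSet_Iio,
          ← lintegral_neg_eq_self (μ := volume)]
        apply lintegral_congr
        intro x
        simp [indicator]
      rwa [this]
    obtain ⟨ε, hε, hlow⟩ := aux_lower _ hvn hvnpos hfin'
    have hsd : ContDiff ℝ 1 fun x => auxStep (-x) := auxStep_contDiff.comp contDiff_neg
    have hn : vNormSq v (fun x => auxStep (-x)) (deriv fun x => auxStep (-x)) < ⊤ := by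
      rw [← aux_vNormSq_neg]
      simpa using auxStep_fin _ hvn hvnpos hfin'
    obtain ⟨φ, hφ, hφc, hlt⟩ := H _ _ (aux_isLocAC _ hsd) hn ε hε
    rw [hder _ _ hsd hφ, ← aux_vNormSq_neg] at hlt
    refine absurd hlt (not_lt.2 (hlow _ ((hsd.sub hφ).comp contDiff_neg) ?_))
    obtain ⟨M, hM⟩ := aux_tail φ hφc
    refine ⟨max M 0, fun x hx => ?_⟩
    simp only [neg_neg]
    rw [auxStep_one x ((le_max_right _ _).trans hx),
      hM (-x) (by rw [abs_neg]; exact ((le_max_left _ _).trans hx).trans (le_abs_self x)), sub_zero]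

lemma aux_bump : ∃ χ : ℝ → ℝ, ContDiff ℝ 1 χ ∧ (∀ x, 0 ≤ χ x) ∧ (∀ x, χ x ≤ 1) ∧
    (∀ x, |x| ≤ 1 → χ x = 1) ∧ (∀ x, 2 < |x| → χ x = 0) ∧ (∀ x, 2 < |x| → deriv χ x = 0) ∧
    ∃ C : ℝ, 0 ≤ C ∧ ∀ x, |deriv χ x| ≤ C := by
  let f : ContDiffBump (0:ℝ) := ⟨1, 2, one_pos, one_lt_two⟩
  have h0 : ∀ x, 2 < |x| → f x = 0 := fun x hx =>
    f.zero_of_le_dist (by rw [dist_zero_right, Real.norm_eq_abs]; exact hx.le)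
  have hcd : ContDiff ℝ 1 f := f.contDiff
  refine ⟨f, hcd, fun x => f.nonneg, fun x => f.le_one, fun x hx => ?_, h0, fun x hx => ?_, ?_⟩
  · apply f.one_of_mem_closedBall
    rw [Metric.mem_closedBall, dist_zero_right, Real.norm_eq_abs]; exact hx
  · have : f =ᶠ[𝓝 x] fun _ => 0 := by
      filter_upwards [(isOpen_lt continuous_const continuous_abs).mem_nhds hx] with y hy
      exact h0 y hy
    rw [this.deriv_eq]; simp
  · obtain ⟨C, hC⟩ := f.hasCompactSupport.deriv.exists_bound_of_continuous hcd.continuous_deriv_one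
    exact ⟨C, (norm_nonneg _).trans (hC 0), hC⟩

lemma aux_pt (v : ℝ) (hv : 0 < v) (g g' G k : ℂ) (X q r C : ℝ) (hX0 : 0 ≤ X) (hX1 : X ≤ 1)
    (hq : |q| ≤ r) (hr : r ≤ C) :
    v ^ 2 * ‖g' - (((q * (v ^ 2)⁻¹ : ℝ) : ℂ) * G + (X : ℂ) * k)‖ ^ 2
      + (v ^ 2)⁻¹ * ‖g - (X : ℂ) * G‖ ^ 2
    ≤ 4 * ((1 - X) ^ 2 + r ^ 2) * (v ^ 2 * ‖g'‖ ^ 2 + (v ^ 2)⁻¹ * ‖g‖ ^ 2)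
      + 4 * (v ^ 2 * ‖g' - k‖ ^ 2) + (4 * C ^ 2 + 2) * ((v ^ 2)⁻¹ * ‖g - G‖ ^ 2) := by
  set w := (v ^ 2)⁻¹ with hw
  have hwpos : 0 < w := by positivity
  have hvw : v ^ 2 * w = 1 := by rw [hw]; field_simp
  have hv2 : 0 < v ^ 2 := by positivity
  set V := v ^ 2
  have e1 : g' - (((q * w : ℝ) : ℂ) * G + (X : ℂ) * k)
      = ((1 - X : ℝ) : ℂ) * g' + (X : ℂ) * (g' - k) - ((q * w : ℝ) : ℂ) * g
        + ((q * w : ℝ) : ℂ) * (g - G) := by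
    push_cast; ring
  have e2 : g - (X : ℂ) * G = ((1 - X : ℝ) : ℂ) * g + (X : ℂ) * (g - G) := by
    push_cast; ring
  have n1 : ‖g' - (((q * w : ℝ) : ℂ) * G + (X : ℂ) * k)‖
      ≤ (1 - X) * ‖g'‖ + X * ‖g' - k‖ + |q| * w * ‖g‖ + |q| * w * ‖g - G‖ := by
    rw [e1]
    refine (norm_add_le _ _).trans ?_
    have h1 := norm_sub_le (((1 - X : ℝ) : ℂ) * g' + (X : ℂ) * (g' - k)) (((q * w : ℝ) : ℂ) * g)
    have h2 := norm_add_le (((1 - X : ℝ) : ℂ) * g') ((X : ℂ) * (g' - k))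
    simp only [norm_mul, Complex.norm_real, Real.norm_eq_abs, abs_of_pos hwpos,
      abs_of_nonneg hX0, abs_of_nonneg (sub_nonneg.2 hX1)] at h1 h2 ⊢
    linarith
  have n2 : ‖g - (X : ℂ) * G‖ ≤ (1 - X) * ‖g‖ + X * ‖g - G‖ := by
    rw [e2]
    refine (norm_add_le _ _).trans ?_
    simp only [norm_mul, Complex.norm_real, Real.norm_eq_abs,
      abs_of_nonneg hX0, abs_of_nonneg (sub_nonneg.2 hX1)]
    exact le_rfl
  have m1 := pow_le_pow_left₀ (norm_nonneg _) n1 2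
  have m2 := pow_le_pow_left₀ (norm_nonneg _) n2 2
  generalize ‖g' - (((q * w : ℝ) : ℂ) * G + (X : ℂ) * k)‖ = D' at *
  generalize ‖g - (X : ℂ) * G‖ = D at *
  generalize ‖g'‖ = a at *
  generalize ‖g‖ = b at *
  generalize ‖g' - k‖ = c at *
  generalize ‖g - G‖ = d at *
  have hX2 : X ^ 2 ≤ 1 := pow_le_one₀ hX0 hX1
  have hq2 : |q| ^ 2 ≤ r ^ 2 := pow_le_pow_left₀ (abs_nonneg _) hq 2
  have hr2 : r ^ 2 ≤ C ^ 2 := pow_le_pow_left₀ ((abs_nonneg _).trans hq) hr 2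
  have four : ∀ x y z t : ℝ, (x + y + z + t) ^ 2 ≤ 4 * (x ^ 2 + y ^ 2 + z ^ 2 + t ^ 2) := by
    intro x y z t
    nlinarith [sq_nonneg (x - y), sq_nonneg (x - z), sq_nonneg (x - t), sq_nonneg (y - z),
      sq_nonneg (y - t), sq_nonneg (z - t)]
  have k1 := m1.trans (four _ _ _ _)
  have k2 : D ^ 2 ≤ 2 * (((1 - X) * b) ^ 2 + (X * d) ^ 2) :=
    m2.trans (by nlinarith [sq_nonneg ((1 - X) * b - X * d)])
  calc V * D' ^ 2 + w * D ^ 2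
      ≤ V * (4 * (((1 - X) * a) ^ 2 + (X * c) ^ 2 + (|q| * w * b) ^ 2 + (|q| * w * d) ^ 2))
        + w * (2 * (((1 - X) * b) ^ 2 + (X * d) ^ 2)) := by gcongr
    _ = 4 * (1 - X) ^ 2 * (V * a ^ 2) + 4 * X ^ 2 * (V * c ^ 2)
        + 4 * |q| ^ 2 * ((V * w) * w * b ^ 2) + 4 * |q| ^ 2 * ((V * w) * w * d ^ 2)
        + 2 * (1 - X) ^ 2 * (w * b ^ 2) + 2 * X ^ 2 * (w * d ^ 2) := by ring
    _ = 4 * (1 - X) ^ 2 * (V * a ^ 2) + 4 * X ^ 2 * (V * c ^ 2)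
        + 4 * |q| ^ 2 * (w * b ^ 2) + 4 * |q| ^ 2 * (w * d ^ 2)
        + 2 * (1 - X) ^ 2 * (w * b ^ 2) + 2 * X ^ 2 * (w * d ^ 2) := by rw [hvw]; ring
    _ ≤ 4 * (1 - X) ^ 2 * (V * a ^ 2) + 4 * 1 * (V * c ^ 2)
        + 4 * r ^ 2 * (w * b ^ 2) + 4 * C ^ 2 * (w * d ^ 2)
        + 4 * (1 - X) ^ 2 * (w * b ^ 2) + 2 * 1 * (w * d ^ 2) + 4 * r ^ 2 * (V * a ^ 2) := by
        have := hq2.trans hr2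
        have h3 : 0 ≤ 4 * r ^ 2 * (V * a ^ 2) := by positivity
        refine le_trans ?_ (le_add_of_nonneg_right h3)
        gcongr
        norm_num
    _ = _ := by ring

/-- L² approximation of the derivative by continuous functions. -/
lemma aux_approx (v : ℝ → ℝ) (hv : Continuous v) (hvpos : ∀ ξ, 0 < v ξ) (g' : ℝ → ℂ)
    (hm : AEStronglyMeasurable g' volume)
    (hfin : ∫⁻ x, ENNReal.ofReal ((v x) ^ 2 * ‖g' x‖ ^ 2) < ⊤) (δ : ℝ) (hδ : 0 < δ) :
    ∃ k : ℝ → ℂ, Continuous k ∧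
      ∫⁻ x, ENNReal.ofReal ((v x) ^ 2 * ‖g' x - k x‖ ^ 2) ≤ ENNReal.ofReal δ := by
  have hFm : AEStronglyMeasurable (fun x => (v x : ℂ) * g' x) volume :=
    (Complex.continuous_ofReal.comp hv).aestronglyMeasurable.mul hm
  have key : ∀ f : ℝ → ℂ, ∫⁻ x, ENNReal.ofReal (‖f x‖ ^ 2) = eLpNorm f 2 volume ^ 2 := by
    intro f
    rw [eLpNorm_eq_lintegral_rpow_enorm_toReal two_ne_zero ENNReal.ofNat_ne_top]
    rw [← ENNReal.rpow_natCast, ← ENNReal.rpow_mul]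
    simp only [ENNReal.toReal_ofNat, Nat.cast_ofNat]
    norm_num
  have hF : MemLp (fun x => (v x : ℂ) * g' x) 2 volume := by
    refine ⟨hFm, ?_⟩
    have h1 := key (fun x => (v x : ℂ) * g' x)
    simp only [norm_mul, Complex.norm_real, Real.norm_eq_abs, mul_pow, sq_abs] at h1
    rw [h1] at hfin
    by_contra h
    rw [not_lt, top_le_iff] at h
    rw [h] at hfin
    simp at hfin
  obtain ⟨K, -, hK, hKc, -⟩ := hF.exists_hasCompactSupport_eLpNorm_sub_le
    ENNReal.ofNat_ne_top (ε := ENNReal.ofReal (√δ)) (by simpa using hδ)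
  have hvne : ∀ x, (v x : ℂ) ≠ 0 := fun x => by exact_mod_cast (hvpos x).ne'
  refine ⟨fun x => (v x : ℂ)⁻¹ * K x,
    ((Complex.continuous_ofReal.comp hv).inv₀ hvne).mul hKc, ?_⟩
  have h2 := key ((fun x => (v x : ℂ) * g' x) - K)
  have h3 : ∀ x, ENNReal.ofReal ((v x) ^ 2 * ‖g' x - (v x : ℂ)⁻¹ * K x‖ ^ 2)
      = ENNReal.ofReal (‖((fun x => (v x : ℂ) * g' x) - K) x‖ ^ 2) := by
    intro x
    congr 1
    have : ((fun x => (v x : ℂ) * g' x) - K) x = (v x : ℂ) * (g' x - (v x : ℂ)⁻¹ * K x) := by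
      simp only [Pi.sub_apply]
      have := hvne x
      field_simp
    rw [this, norm_mul, mul_pow, Complex.norm_real, Real.norm_eq_abs, sq_abs]
  simp only [h3]
  rw [h2]
  calc _ ≤ ENNReal.ofReal (√δ) ^ 2 := by gcongr
    _ = _ := by rw [← ENNReal.ofReal_pow (Real.sqrt_nonneg _), Real.sq_sqrt hδ.le]

lemma aux_unbdd (w : ℝ → ℝ) (hw : Continuous w) (hpos : ∀ x, 0 < w x)
    (h1 : ∫⁻ ξ in Ioi (0 : ℝ), ENNReal.ofReal (w ξ) = ⊤)
    (h2 : ∫⁻ ξ in Iio (0 : ℝ), ENNReal.ofReal (w ξ) = ⊤) (B : ℝ) :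
    ∃ M : ℝ, 0 < M ∧ ∀ x, x ∉ Icc (-M) M → B < |∫ t in (0:ℝ)..x, w t| := by
  have hii : ∀ a b, IntervalIntegrable w volume a b := fun a b => hw.intervalIntegrable a b
  have hnn : ∀ x, ‖w x‖ = w x := fun x => Real.norm_of_nonneg (hpos x).le
  have hfin : ∀ s : Set ℝ, IntegrableOn w s → ∫⁻ ξ in s, ENNReal.ofReal (w ξ) ≠ ⊤ := by
    intro s hs
    have := hs.2
    rw [hasFiniteIntegral_iff_norm] at this
    simp only [hnn] at this
    exact this.ne
  have hR : ∃ M1 : ℝ, 0 < M1 ∧ B < ∫ t in (0:ℝ)..M1, w t := by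
    by_contra! H
    refine hfin _ ?_ h1
    refine integrableOn_Ioi_of_intervalIntegral_norm_bounded (l := atTop) (b := fun x : ℝ => x) B 0
      (fun i => (hii 0 i).1) tendsto_id ?_
    filter_upwards [eventually_gt_atTop 0] with x hx
    simpa only [hnn] using H x hx
  have hL : ∃ M2 : ℝ, 0 < M2 ∧ B < ∫ t in (-M2)..0, w t := by
    by_contra! H
    refine hfin _ ?_ h2
    refine IntegrableOn.mono_set ?_ Iio_subset_Iic_self
    refine integrableOn_Iic_of_intervalIntegral_norm_bounded (l := atBot) (a := fun x : ℝ => x) B 0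
      (fun i => (hii i 0).1) tendsto_id ?_
    filter_upwards [eventually_lt_atBot 0] with x hx
    have := H (-x) (by linarith)
    simpa only [hnn, neg_neg] using this
  obtain ⟨M1, hM1, hB1⟩ := hR
  obtain ⟨M2, hM2, hB2⟩ := hL
  refine ⟨max M1 M2, lt_max_of_lt_left hM1, fun x hx => ?_⟩
  rw [mem_Icc, not_and_or, not_le, not_le] at hx
  rcases hx with hx | hx
  · have hx2 : x ≤ -M2 := by linarith [le_max_right M1 M2]
    have e : ∫ t in (0:ℝ)..x, w t = - ((∫ t in x..(-M2), w t) + ∫ t in (-M2)..0, w t) := by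
      rw [intervalIntegral.integral_add_adjacent_intervals (hii _ _) (hii _ _),
        intervalIntegral.integral_symm]
    have p : 0 ≤ ∫ t in x..(-M2), w t :=
      intervalIntegral.integral_nonneg hx2 (fun t _ => (hpos t).le)
    rw [e, abs_neg]
    exact lt_of_lt_of_le (by linarith) (le_abs_self _)
  · have hx2 : M1 ≤ x := by linarith [le_max_left M1 M2]
    have e : ∫ t in (0:ℝ)..x, w t = (∫ t in (0:ℝ)..M1, w t) + ∫ t in M1..x, w t := by
      rw [intervalIntegral.integral_add_adjacent_intervals (hii _ _) (hii _ _)]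
    have p : 0 ≤ ∫ t in M1..x, w t :=
      intervalIntegral.integral_nonneg hx2 (fun t _ => (hpos t).le)
    rw [e]
    exact lt_of_lt_of_le (by linarith) (le_abs_self _)

lemma aux_forward
    (v : ℝ → ℝ) (hv : Continuous v) (hvpos : ∀ ξ, 0 < v ξ)
    (hi1 : ∫⁻ ξ in Ioi (0 : ℝ), ENNReal.ofReal (((v ξ) ^ 2)⁻¹) = ⊤)
    (hi2 : ∫⁻ ξ in Iio (0 : ℝ), ENNReal.ofReal (((v ξ) ^ 2)⁻¹) = ⊤)
    (g g' : ℝ → ℂ) (hg : IsLocAC g g') (hfin : vNormSq v g g' < ⊤) (ε : ℝ) (hε : 0 < ε) :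
    ∃ φ : ℝ → ℂ, ContDiff ℝ 1 φ ∧ HasCompactSupport φ ∧
      vNormSq v (fun ξ => g ξ - φ ξ) (fun ξ => g' ξ - deriv φ ξ) < ENNReal.ofReal (ε ^ 2) := by
  obtain ⟨χ, hχ, hχ0, hχ1, hχone, hχz, hχdz, C, hC0, hC⟩ := aux_bump
  have hc : Continuous fun x => ((v x) ^ 2)⁻¹ :=
    (hv.pow 2).inv₀ (fun x => (pow_pos (hvpos x) 2).ne')
  have hwpos : ∀ x, 0 < ((v x) ^ 2)⁻¹ := fun x => inv_pos.2 (pow_pos (hvpos x) 2)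
  have hwm : Measurable fun x => ENNReal.ofReal (((v x) ^ 2)⁻¹) := hc.measurable.ennreal_ofReal
  have hg'i : ∀ a b, IntervalIntegrable g' volume a b := fun a b =>
    (hg.1.integrableOn_isCompact isCompact_uIcc).intervalIntegrable
  have hg'm : AEStronglyMeasurable g' volume := hg.1.aestronglyMeasurable
  have hgc : Continuous g := by
    rw [funext hg.2]
    exact continuous_const.add (intervalIntegral.continuous_primitive hg'i 0)
  have hE : ∫⁻ x, ENNReal.ofReal ((v x) ^ 2 * ‖g' x‖ ^ 2) < ⊤ :=
    lt_of_le_of_lt (lintegral_mono fun x => le_self_add) hfin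
  set s : ℝ → ℝ := fun x => ∫ t in (0:ℝ)..x, ((v t) ^ 2)⁻¹ with hs
  have hsd : ∀ x, HasDerivAt s (((v x) ^ 2)⁻¹) x := fun x =>
    intervalIntegral.integral_hasDerivAt_right (hc.intervalIntegrable _ _)
      hc.stronglyMeasurable.stronglyMeasurableAtFilter hc.continuousAt
  have hsc : Continuous s := continuous_iff_continuousAt.2 fun x => (hsd x).continuousAt
  set e : ℝ → ℝ := fun x => (v x) ^ 2 * ‖g' x‖ ^ 2 + ((v x) ^ 2)⁻¹ * ‖g x‖ ^ 2 with he
  have he0 : ∀ x, 0 ≤ e x := fun x => by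
    have := hwpos x
    simp only [he]; positivity
  have hefin : ∫⁻ x, ENNReal.ofReal (e x) < ⊤ := by
    convert hfin using 1
    apply lintegral_congr
    intro x
    have := hwpos x
    rw [he, ENNReal.ofReal_add (by positivity) (by positivity)]
  have hem : AEMeasurable e volume :=
    ((hv.pow 2).aemeasurable.mul (hg'm.norm.aemeasurable.pow_const 2)).add
      (hc.aemeasurable.mul (hgc.norm.pow 2).aemeasurable)
  -- choice of the cutoff scale
  set X : ℕ → ℝ → ℝ := fun n x => χ (s x / (n + 1)) with hX
  have hXc : ∀ n, Continuous (X n) := fun n => hχ.continuous.comp (hsc.div_const _)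
  set P : ℕ → ℝ → ℝ := fun n x => 4 * ((1 - X n x) ^ 2 + (C / (n + 1)) ^ 2) * e x with hP
  have hPm : ∀ n, AEMeasurable (P n) volume := fun n => by
    have h1 : Continuous fun x => 4 * ((1 - X n x) ^ 2 + (C / ((n:ℝ) + 1)) ^ 2) := by
      have := hXc n
      fun_prop
    exact h1.aemeasurable.mul hem
  have hCn : ∀ n : ℕ, C / ((n:ℝ) + 1) ≤ C := fun n =>
    div_le_self hC0 (by linarith [Nat.cast_nonneg (α := ℝ) n])
  have hCn0 : ∀ n : ℕ, 0 ≤ C / ((n:ℝ) + 1) := fun n => by positivity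
  have htend : Tendsto (fun n => ∫⁻ x, ENNReal.ofReal (P n x)) atTop (𝓝 (∫⁻ _ : ℝ, 0)) := by
    refine tendsto_lintegral_of_dominated_convergence'
      (fun x => ENNReal.ofReal (4 * (1 + C ^ 2)) * ENNReal.ofReal (e x))
      (fun n => (hPm n).ennreal_ofReal) (fun n => ae_of_all _ fun x => ?_) ?_
      (ae_of_all _ fun x => ?_)
    · dsimp only
      rw [← ENNReal.ofReal_mul (by positivity)]
      apply ENNReal.ofReal_le_ofReal
      have h1 : (1 - X n x) ^ 2 ≤ 1 := pow_le_one₀ (by linarith [hχ1 (s x / (n + 1))])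
        (by linarith [hχ0 (s x / (n + 1))])
      have h2 := pow_le_pow_left₀ (hCn0 n) (hCn n) 2
      have h3 := he0 x
      simp only [hP]
      gcongr
    · rw [lintegral_const_mul' _ _ ENNReal.ofReal_ne_top]
      exact ENNReal.mul_ne_top ENNReal.ofReal_ne_top hefin.ne
    · have h1 : Tendsto (fun n : ℕ => C / ((n:ℝ) + 1)) atTop (𝓝 0) :=
        tendsto_const_nhds.div_atTop
          (tendsto_atTop_add_const_right _ _ tendsto_natCast_atTop_atTop)
      have h2 : Tendsto (fun n : ℕ => X n x) atTop (𝓝 1) := by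
        refine tendsto_const_nhds.congr' ?_
        obtain ⟨N, hN⟩ := exists_nat_gt |s x|
        filter_upwards [eventually_ge_atTop N] with n hn
        symm
        apply hχone
        have : (0:ℝ) < n + 1 := by positivity
        rw [abs_div, abs_of_pos this, div_le_one this]
        have : (N:ℝ) ≤ n := by exact_mod_cast hn
        linarith
      have h3 : Tendsto (fun n => P n x) atTop (𝓝 (4 * ((1 - 1) ^ 2 + 0 ^ 2) * e x)) :=
        ((((tendsto_const_nhds.sub h2).pow 2).add (h1.pow 2)).const_mul 4).mul_const _
      have h4 := ENNReal.tendsto_ofReal h3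
      simpa using h4
  rw [lintegral_zero] at htend
  have hε4 : 0 < ENNReal.ofReal (ε ^ 2 / 4) := ENNReal.ofReal_pos.2 (by positivity)
  obtain ⟨n, hn⟩ := (htend.eventually (gt_mem_nhds hε4)).exists
  have hn1 : (0:ℝ) < n + 1 := by positivity
  obtain ⟨M, hM0, hM⟩ := aux_unbdd _ hc hwpos hi1 hi2 (2 * (n + 1))
  have hoff : ∀ x, x ∉ Icc (-M) M → 2 < |s x / (n + 1)| := by
    intro x hx
    rw [abs_div, abs_of_pos hn1, lt_div_iff₀ hn1]
    exact hM x hx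
  -- constants
  set b := (∫⁻ x in Icc (-M) M, ENNReal.ofReal (((v x) ^ 2)⁻¹)).toReal with hb
  have hb0 : 0 ≤ b := ENNReal.toReal_nonneg
  have hbe : ∫⁻ x in Icc (-M) M, ENNReal.ofReal (((v x) ^ 2)⁻¹) = ENNReal.ofReal b :=
    (ENNReal.ofReal_toReal (aux_compact_fin _ hc _ _).ne).symm
  clear_value b
  obtain ⟨η, hη0, hη⟩ : ∃ η : ℝ, 0 < η ∧ (4 * C ^ 2 + 2) * η ^ 2 * b ≤ ε ^ 2 / 4 := by
    refine ⟨√(ε ^ 2 / 4 / ((4 * C ^ 2 + 2) * (b + 1))), Real.sqrt_pos.2 (by positivity), ?_⟩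
    rw [Real.sq_sqrt (by positivity)]
    calc (4 * C ^ 2 + 2) * (ε ^ 2 / 4 / ((4 * C ^ 2 + 2) * (b + 1))) * b
        = ε ^ 2 / 4 * (b / (b + 1)) := by field_simp
      _ ≤ ε ^ 2 / 4 * 1 := by
          gcongr
          rw [div_le_one (by positivity)]; linarith
      _ = _ := mul_one _
  set l := (b + 1) / (2 * η) with hl
  have hl0 : 0 < l := by positivity
  set δ := min (ε ^ 2 / 16) (η / (2 * l)) with hδ
  have hδ0 : 0 < δ := by positivity
  obtain ⟨k, hkc, hk⟩ := aux_approx v hv hvpos g' hg'm hE δ hδ0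
  set G : ℝ → ℂ := fun x => g 0 + ∫ t in (0:ℝ)..x, k t with hG
  have hGd : ∀ x, HasDerivAt G (k x) x := fun x =>
    (intervalIntegral.integral_hasDerivAt_right (hkc.intervalIntegrable _ _)
      hkc.stronglyMeasurable.stronglyMeasurableAtFilter hkc.continuousAt).const_add _
  have hGc : Continuous G := continuous_iff_continuousAt.2 fun x => (hGd x).continuousAt
  have hgG : ∀ x ∈ Icc (-M) M, ‖g x - G x‖ ≤ η := by
    intro x hx
    have e1 : g x - G x = ∫ t in (0:ℝ)..x, (g' t - k t) := by
      rw [intervalIntegral.integral_sub (hg'i _ _) (hkc.intervalIntegrable _ _), hg.2 x, hG]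
      ring
    have h1 := aux_integral_bound v hv hvpos (fun t => g' t - k t) l hl0 0 x
    rw [← e1] at h1
    have h2 : ∫⁻ t in uIoc 0 x, ENNReal.ofReal (((v t) ^ 2)⁻¹) ≤ ENNReal.ofReal b := by
      rw [← hbe]
      apply lintegral_mono_set
      refine uIoc_subset_uIcc.trans (uIcc_subset_Icc ⟨by linarith, hM0.le⟩ hx)
    have h3 : ‖g x - G x‖ₑ ≤ ENNReal.ofReal (l * δ + 1 / (4 * l) * b) := by
      refine h1.trans ?_
      rw [ENNReal.ofReal_add (by positivity) (by positivity), ENNReal.ofReal_mul hl0.le,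
        ENNReal.ofReal_mul (by positivity)]
      gcongr
    rw [← ofReal_norm, ENNReal.ofReal_le_ofReal_iff (by positivity)] at h3
    have h4 : l * δ ≤ l * (η / (2 * l)) := by gcongr; exact min_le_right _ _
    have h5 : l * (η / (2 * l)) = η / 2 := by field_simp
    have h6 : 1 / (4 * l) * b ≤ η / 2 := by
      have : 1 / (4 * l) * b = η / 2 * (b / (b + 1)) := by rw [hl]; field_simp; ring
      rw [this]
      have : b / (b + 1) ≤ 1 := by rw [div_le_one (by positivity)]; linarith
      nlinarith
    linarith
  -- the approximating function
  set q : ℝ → ℝ := fun x => deriv χ (s x / (n + 1)) / (n + 1) with hq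
  have hXd : ∀ x, HasDerivAt (X n) (q x * ((v x) ^ 2)⁻¹) x := by
    intro x
    have h1 : HasDerivAt χ (deriv χ (s x / (n + 1))) (s x / (n + 1)) :=
      (hχ.differentiable one_ne_zero _).hasDerivAt
    have h2 := h1.comp x ((hsd x).div_const ((n:ℝ) + 1))
    have h3 : q x * ((v x) ^ 2)⁻¹
        = deriv χ (s x / (n + 1)) * (((v x) ^ 2)⁻¹ / ((n:ℝ) + 1)) := by
      simp only [hq]; ring
    rw [h3]
    exact h2
  have hqc : Continuous q := (hχ.continuous_deriv_one.comp (hsc.div_const _)).div_const _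
  have hφd : ∀ x, HasDerivAt (fun x => (X n x : ℂ) * G x)
      (((q x * ((v x) ^ 2)⁻¹ : ℝ) : ℂ) * G x + (X n x : ℂ) * k x) x := fun x =>
    (hXd x).ofReal_comp.mul (hGd x)
  have hderiv : deriv (fun x => (X n x : ℂ) * G x)
      = fun x => ((q x * ((v x) ^ 2)⁻¹ : ℝ) : ℂ) * G x + (X n x : ℂ) * k x :=
    funext fun x => (hφd x).deriv
  refine ⟨fun x => (X n x : ℂ) * G x, ?_, ?_, ?_⟩
  · rw [contDiff_one_iff_deriv]
    refine ⟨fun x => (hφd x).differentiableAt, ?_⟩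
    rw [hderiv]
    exact ((Complex.continuous_ofReal.comp (hqc.mul hc)).mul hGc).add
      ((Complex.continuous_ofReal.comp (hXc n)).mul hkc)
  · refine HasCompactSupport.intro (K := Icc (-M) M) isCompact_Icc fun x hx => ?_
    have : X n x = 0 := hχz _ (hoff x hx)
    simp [this]
  · rw [hderiv]
    have hpt : ∀ x, ENNReal.ofReal ((v x) ^ 2 * ‖g' x
          - (((q x * ((v x) ^ 2)⁻¹ : ℝ) : ℂ) * G x + (X n x : ℂ) * k x)‖ ^ 2)
        + ENNReal.ofReal (((v x) ^ 2)⁻¹ * ‖g x - (X n x : ℂ) * G x‖ ^ 2)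
        ≤ ENNReal.ofReal (P n x) + (ENNReal.ofReal 4 *
            ENNReal.ofReal ((v x) ^ 2 * ‖g' x - k x‖ ^ 2)
          + (Icc (-M) M).indicator (fun x => ENNReal.ofReal ((4 * C ^ 2 + 2) * η ^ 2)
            * ENNReal.ofReal (((v x) ^ 2)⁻¹)) x) := by
      intro x
      have hw := hwpos x
      have hqx : |q x| ≤ C / (n + 1) := by
        simp only [hq]
        rw [abs_div, abs_of_pos hn1]
        gcongr
        exact hC _
      have hPx : 0 ≤ P n x := by
        have := he0 x
        simp only [hP]; positivity
      rw [← ENNReal.ofReal_add (by positivity) (by positivity)]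
      by_cases hx : x ∈ Icc (-M) M
      · rw [indicator_of_mem hx, ← ENNReal.ofReal_mul (by positivity),
          ← ENNReal.ofReal_mul (by positivity), ← ENNReal.ofReal_add (by positivity) (by positivity),
          ← ENNReal.ofReal_add (by positivity) (by positivity)]
        apply ENNReal.ofReal_le_ofReal
        refine (aux_pt (v x) (hvpos x) (g x) (g' x) (G x) (k x) (X n x) (q x) (C / (n + 1)) C
          (hχ0 _) (hχ1 _) hqx (hCn n)).trans ?_
        have h1 := hgG x hx
        have h2 : ‖g x - G x‖ ^ 2 ≤ η ^ 2 := pow_le_pow_left₀ (norm_nonneg _) h1 2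
        have h3 : (4 * C ^ 2 + 2) * (((v x) ^ 2)⁻¹ * ‖g x - G x‖ ^ 2)
            ≤ (4 * C ^ 2 + 2) * (((v x) ^ 2)⁻¹ * η ^ 2) := by gcongr
        simp only [hP, he]
        linarith
      · have hX0 : X n x = 0 := hχz _ (hoff x hx)
        have hq0 : q x = 0 := by simp only [hq]; rw [hχdz _ (hoff x hx), zero_div]
        refine le_trans ?_ le_self_add
        apply ENNReal.ofReal_le_ofReal
        simp only [hP, hX0, hq0]
        have h1 : 0 ≤ (C / ((n:ℝ) + 1)) ^ 2 := sq_nonneg _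
        have h2 := he0 x
        simp only [zero_mul, Complex.ofReal_zero, zero_add, sub_zero]
        change e x ≤ _
        nlinarith
    have hm3 : Measurable ((Icc (-M) M).indicator (fun x => ENNReal.ofReal ((4 * C ^ 2 + 2) * η ^ 2)
            * ENNReal.ofReal (((v x) ^ 2)⁻¹))) :=
      (hwm.const_mul _).indicator measurableSet_Icc
    have hS : ∫⁻ x, (Icc (-M) M).indicator (fun x => ENNReal.ofReal ((4 * C ^ 2 + 2) * η ^ 2)
            * ENNReal.ofReal (((v x) ^ 2)⁻¹)) x ≤ ENNReal.ofReal (ε ^ 2 / 4) := by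
      rw [lintegral_indicator measurableSet_Icc, lintegral_const_mul' _ _ ENNReal.ofReal_ne_top,
        hbe, ← ENNReal.ofReal_mul (by positivity)]
      exact ENNReal.ofReal_le_ofReal hη
    have hQ : ∫⁻ x, ENNReal.ofReal 4 * ENNReal.ofReal ((v x) ^ 2 * ‖g' x - k x‖ ^ 2)
        ≤ ENNReal.ofReal (ε ^ 2 / 4) := by
      rw [lintegral_const_mul' _ _ ENNReal.ofReal_ne_top]
      calc _ ≤ ENNReal.ofReal 4 * ENNReal.ofReal δ := by gcongr
        _ = ENNReal.ofReal (4 * δ) := by rw [ENNReal.ofReal_mul (by norm_num)]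
        _ ≤ _ := by
            apply ENNReal.ofReal_le_ofReal
            have : δ ≤ ε ^ 2 / 16 := min_le_left _ _
            linarith
    calc _ ≤ ∫⁻ x, (ENNReal.ofReal (P n x) + (ENNReal.ofReal 4 *
            ENNReal.ofReal ((v x) ^ 2 * ‖g' x - k x‖ ^ 2)
          + (Icc (-M) M).indicator (fun x => ENNReal.ofReal ((4 * C ^ 2 + 2) * η ^ 2)
            * ENNReal.ofReal (((v x) ^ 2)⁻¹)) x)) := lintegral_mono hpt
      _ = (∫⁻ x, ENNReal.ofReal (P n x)) + ((∫⁻ x, ENNReal.ofReal 4 *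
            ENNReal.ofReal ((v x) ^ 2 * ‖g' x - k x‖ ^ 2))
          + ∫⁻ x, (Icc (-M) M).indicator (fun x => ENNReal.ofReal ((4 * C ^ 2 + 2) * η ^ 2)
            * ENNReal.ofReal (((v x) ^ 2)⁻¹)) x) := by
          rw [lintegral_add_left' (hPm n).ennreal_ofReal, lintegral_add_right _ hm3]
      _ ≤ ENNReal.ofReal (ε ^ 2 / 4) + (ENNReal.ofReal (ε ^ 2 / 4) + ENNReal.ofReal (ε ^ 2 / 4)) := by
          gcongr
      _ = ENNReal.ofReal (ε ^ 2 / 4 + (ε ^ 2 / 4 + ε ^ 2 / 4)) := by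
          rw [ENNReal.ofReal_add (by positivity) (by positivity),
            ENNReal.ofReal_add (by positivity) (by positivity)]
      _ < _ := by
          rw [ENNReal.ofReal_lt_ofReal_iff (by positivity)]
          nlinarith [pow_pos hε 2]

/-- `C_c¹(ℝ)` is dense in the space of locally absolutely continuous functions with finite
weighted norm `‖g‖_v² = ∫ (v²|g'|² + v⁻²|g|²)` if and only if
`∫_0^∞ v⁻² = ∫_{-∞}^0 v⁻² = ∞`. -/
theorem denseness_iff_divergence
    (v : ℝ → ℝ) (hv : ContDiff ℝ 1 v) (hvpos : ∀ ξ, 0 < v ξ) :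
    ((∫⁻ ξ in Ioi (0 : ℝ), ENNReal.ofReal (((v ξ) ^ 2)⁻¹) = ⊤)
        ∧ (∫⁻ ξ in Iio (0 : ℝ), ENNReal.ofReal (((v ξ) ^ 2)⁻¹) = ⊤))
      ↔ (∀ g g' : ℝ → ℂ, IsLocAC g g' → vNormSq v g g' < ⊤ →
          ∀ ε : ℝ, 0 < ε → ∃ φ : ℝ → ℂ, ContDiff ℝ 1 φ ∧ HasCompactSupport φ ∧
            vNormSq v (fun ξ => g ξ - φ ξ) (fun ξ => g' ξ - deriv φ ξ)
              < ENNReal.ofReal (ε ^ 2)) := by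
  exact ⟨fun h g g' hg hfin ε hε =>
      aux_forward v hv.continuous hvpos h.1 h.2 g g' hg hfin ε hε,
    fun H => aux_backward v hv.continuous hvpos H⟩
end

section
/- Let K ≥ 1, let v ∈ C^K(ℝ) be bounded with v(ξ) > 0 for all ξ and |v'(ξ)| ≤ C v(ξ) for some constant C, and let Q(x) = Σ_{k=0}^K q_k x^k be a polynomial with real coefficients and q_K ≠ 0. Define the unbounded operator A_0 in L^2(ℝ) with domain the image in L^2(ℝ) of C_c^K(ℝ) and action A_0 g = v·Q(D)(v·g), where Q(D)u = Σ_k q_k i^k u^{(k)}. Then A_0 is densely defined, symmetric, and essentially self-adjoint: the closure of A_0 equals the adjoint of A_0 and is self-adjoint. -/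
open MeasureTheory Real Set

/-- The differential expression `Q(D) u = ∑_k q_k i^k u^{(k)}` with `D = i d/dξ`. -/
noncomputable def QD (K : ℕ) (q : ℕ → ℝ) (u : ℝ → ℂ) (ξ : ℝ) : ℂ :=
  ∑ k ∈ Finset.range (K + 1), (q k : ℂ) * Complex.I ^ k * iteratedDeriv k u ξ

namespace VQDV

open Filter Topology Convolution ContDiff ENNReal

lemma growth {v : ℝ → ℝ} (hv : Differentiable ℝ v) (hpos : ∀ x, 0 < v x) {C : ℝ}
    (h : ∀ x, |deriv v x| ≤ C * v x) (x y : ℝ) : v x ≤ Real.exp (C * |x - y|) * v y := by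
  have h1 := Convex.norm_image_sub_le_of_norm_deriv_le (f := fun t => Real.log (v t)) (C := C)
    (s := univ) (fun t _ => (hv t).log (hpos t).ne')
    (fun t _ => by
      rw [deriv.log (hv t) (hpos t).ne', Real.norm_eq_abs, abs_div, abs_of_pos (hpos t),
        div_le_iff₀ (hpos t)]
      exact h t) convex_univ (mem_univ y) (mem_univ x)
  rw [Real.norm_eq_abs, Real.norm_eq_abs] at h1
  have h2 := (le_abs_self _).trans h1
  have h3 : Real.log (v x) ≤ C * |x - y| + Real.log (v y) := by linarith
  have h4 := Real.exp_le_exp.2 h3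
  rwa [Real.exp_add, Real.exp_log (hpos x), Real.exp_log (hpos y)] at h4

lemma eLpNorm_two_sq {E : Type*} [NormedAddCommGroup E] (f : ℝ → E) :
    eLpNorm f 2 volume ^ 2 = ∫⁻ x, ‖f x‖ₑ ^ 2 := by
  have := eLpNorm_nnreal_pow_eq_lintegral (f := f) (μ := volume) (p := 2) (by norm_num)
  simpa using this

lemma cs_lintegral {a b : ℝ → ℝ≥0∞} (ha : AEMeasurable a) (hb : AEMeasurable b) :
    (∫⁻ t, a t * b t) ^ 2 ≤ (∫⁻ t, a t) * ∫⁻ t, a t * b t ^ 2 := by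
  have h := ENNReal.lintegral_mul_norm_pow_le (μ := volume) ha (ha.mul (hb.pow_const 2))
    (p := 1/2) (q := 1/2) (by norm_num) (by norm_num) (by norm_num)
  have e : ∀ t, a t ^ (1/2 : ℝ) * ((a * fun x => b x ^ 2) t) ^ (1/2:ℝ) = a t * b t := by
    intro t
    simp only [Pi.mul_apply]
    rw [← ENNReal.mul_rpow_of_nonneg _ _ (by norm_num)]
    have : a t * (a t * b t ^ 2) = (a t * b t) ^ (2:ℝ) := by
      rw [ENNReal.rpow_two]; ring
    rw [this, ← ENNReal.rpow_mul]; norm_num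
  simp only [e] at h
  calc _ ≤ ((∫⁻ t, a t) ^ (1/2:ℝ) * (∫⁻ t, (a * fun x => b x ^ 2) t) ^ (1/2:ℝ)) ^ 2 := by
        gcongr
    _ = _ := by
        rw [← ENNReal.mul_rpow_of_nonneg _ _ (by norm_num), ← ENNReal.rpow_two,
          ← ENNReal.rpow_mul]
        norm_num

lemma young {W : ℝ → ℝ} {B : ℝ} (hB : 0 ≤ B) (hW0 : ∀ x, 0 ≤ W x) (hWc : Continuous W)
    (hW : ∀ x t, |t| ≤ 1 → W x ≤ B * W (x - t))
    {k : ℝ → ℝ} (hk : Continuous k) (hks : ∀ t, 1 < |t| → k t = 0)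
    {w : ℝ → ℂ} (hw : AEStronglyMeasurable w volume) :
    eLpNorm (fun x => W x • (k ⋆[ContinuousLinearMap.lsmul ℝ ℝ, volume] w) x) 2 volume
      ≤ ENNReal.ofReal B * (∫⁻ t, ‖k t‖ₑ) * eLpNorm (fun x => W x • w x) 2 volume := by
  rw [← ENNReal.pow_le_pow_left_iff (n := 2) (by norm_num), mul_pow, eLpNorm_two_sq, eLpNorm_two_sq]
  have hmeas : AEMeasurable (fun x => ‖W x • w x‖ₑ) :=
    (hWc.aestronglyMeasurable.smul hw).enorm
  have hmeas' : AEMeasurable (fun z : ℝ × ℝ => ‖W (z.1 - z.2) • w (z.1 - z.2)‖ₑ)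
      (volume.prod volume) :=
    hmeas.comp_quasiMeasurePreserving (quasiMeasurePreserving_sub volume volume)
  have pt : ∀ x, ‖W x • (k ⋆[ContinuousLinearMap.lsmul ℝ ℝ, volume] w) x‖ₑ ≤
      ENNReal.ofReal B * ∫⁻ t, ‖k t‖ₑ * ‖W (x - t) • w (x - t)‖ₑ := by
    intro x
    rw [convolution_lsmul, ← integral_smul, ← lintegral_const_mul' _ _ ENNReal.ofReal_ne_top]
    refine (enorm_integral_le_lintegral_enorm _).trans (lintegral_mono fun t => ?_)
    by_cases ht : |t| ≤ 1
    · simp only [enorm_smul]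
      have h1 : ‖W x‖ₑ ≤ ENNReal.ofReal B * ‖W (x - t)‖ₑ := by
        rw [Real.enorm_of_nonneg (hW0 _), Real.enorm_of_nonneg (hW0 _), ← ENNReal.ofReal_mul hB]
        exact ENNReal.ofReal_le_ofReal (hW x t ht)
      calc _ ≤ (ENNReal.ofReal B * ‖W (x - t)‖ₑ) * (‖k t‖ₑ * ‖w (x - t)‖ₑ) := by gcongr
        _ = _ := by ring
    · simp [hks t (not_le.1 ht)]
  have hkm : AEMeasurable (fun t => ‖k t‖ₑ) := hk.enorm.measurable.aemeasurable
  have hmx : ∀ x, AEMeasurable (fun t => ‖W (x - t) • w (x - t)‖ₑ) := fun x =>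
    hmeas.comp_quasiMeasurePreserving (quasiMeasurePreserving_sub_left volume x)
  calc ∫⁻ x, ‖W x • (k ⋆[ContinuousLinearMap.lsmul ℝ ℝ, volume] w) x‖ₑ ^ 2
      ≤ ∫⁻ x, ENNReal.ofReal B ^ 2 * ((∫⁻ t, ‖k t‖ₑ) *
          ∫⁻ t, ‖k t‖ₑ * ‖W (x - t) • w (x - t)‖ₑ ^ 2) := by
        refine lintegral_mono fun x => ?_
        calc _ ≤ (ENNReal.ofReal B * ∫⁻ t, ‖k t‖ₑ * ‖W (x - t) • w (x - t)‖ₑ) ^ 2 := by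
              gcongr; exact pt x
          _ ≤ _ := by rw [mul_pow]; gcongr; exact cs_lintegral hkm (hmx x)
    _ = ENNReal.ofReal B ^ 2 * ((∫⁻ t, ‖k t‖ₑ) *
          ∫⁻ x, ∫⁻ t, ‖k t‖ₑ * ‖W (x - t) • w (x - t)‖ₑ ^ 2) := by
        have hm2 : AEMeasurable (fun z : ℝ × ℝ => ‖k z.2‖ₑ *
            ‖W (z.1 - z.2) • w (z.1 - z.2)‖ₑ ^ 2) (volume.prod volume) :=
          ((hk.enorm.measurable.comp measurable_snd).aemeasurable).mul (hmeas'.pow_const 2)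
        have hm3 := hm2.lintegral_prod_right'
        rw [lintegral_const_mul'' _ (hm3.const_mul _), lintegral_const_mul'' _ hm3]
    _ = ENNReal.ofReal B ^ 2 * ((∫⁻ t, ‖k t‖ₑ) *
          ((∫⁻ t, ‖k t‖ₑ) * ∫⁻ x, ‖W x • w x‖ₑ ^ 2)) := by
        congr 2
        rw [lintegral_lintegral_swap]
        · have : ∀ t : ℝ, ∫⁻ x, ‖k t‖ₑ * ‖W (x - t) • w (x - t)‖ₑ ^ 2
              = ‖k t‖ₑ * ∫⁻ x, ‖W x • w x‖ₑ ^ 2 := by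
            intro t
            rw [lintegral_const_mul' _ _ (by simp)]
            rw [lintegral_sub_right_eq_self (fun x => ‖W x • w x‖ₑ ^ 2) t]
          simp only [this]
          rw [lintegral_mul_const'' _ hkm]
        · exact ((hk.enorm.measurable.comp measurable_snd).aemeasurable).mul (hmeas'.pow_const 2)
    _ = _ := by ring

lemma tendsto_dominated {F : ℕ → ℝ → ℂ} {G : ℝ → ℝ} 
    (hF : ∀ n, AEStronglyMeasurable (F n) volume)
    (hG : MemLp G 2 volume) (hb : ∀ n x, ‖F n x‖ ≤ G x)
    (hl : ∀ x, Tendsto (fun n => F n x) atTop (𝓝 0)) :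
    Tendsto (fun n => eLpNorm (F n) 2 volume) atTop (𝓝 0) := by
  have h : Tendsto (fun n => ∫⁻ x, ‖F n x‖ₑ ^ 2) atTop (𝓝 (∫⁻ x : ℝ, 0)) := by
    refine tendsto_lintegral_of_dominated_convergence' (fun x => ‖G x‖ₑ ^ 2) 
      (fun n => (hF n).enorm.pow_const 2) (fun n => ae_of_all _ fun x => ?_) ?_ 
      (ae_of_all _ fun x => ?_)
    · exact pow_le_pow_left' (enorm_le_iff_norm_le.2 ((hb n x).trans (le_abs_self _))) 2
    · rw [← eLpNorm_two_sq]; exact ENNReal.pow_ne_top hG.eLpNorm_ne_top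
    · have h0 := ((ENNReal.continuous_pow 2).comp (continuous_enorm (E := ℂ))).tendsto 0
      have := h0.comp (hl x)
      simpa [Function.comp_def] using this
  simp only [← eLpNorm_two_sq, lintegral_zero] at h
  have h2 := (ENNReal.continuous_rpow_const (y := 1/2)).tendsto 0 |>.comp h
  refine (h2.congr fun n => ?_).trans (by simp)
  simp only [Function.comp]
  rw [← ENNReal.rpow_two, ← ENNReal.rpow_mul]; norm_num

lemma conv_deriv {k : ℝ → ℝ} (hk : ContDiff ℝ ∞ k) (hkc : HasCompactSupport k) {w : ℝ → ℂ}
    (hw : LocallyIntegrable w volume) (n : ℕ) :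
    iteratedDeriv n (k ⋆[ContinuousLinearMap.lsmul ℝ ℝ, volume] w)
      = (iteratedDeriv n k) ⋆[ContinuousLinearMap.lsmul ℝ ℝ, volume] w := by
  induction n generalizing k with
  | zero => simp
  | succ n ih =>
    rw [iteratedDeriv_succ', iteratedDeriv_succ', ← ih (k := deriv k) 
      ((contDiff_infty_iff_deriv.1 hk).2) hkc.deriv]
    congr 1
    ext x
    exact (hkc.hasDerivAt_convolution_left _ (hk.of_le (by exact_mod_cast le_top)) hw x).deriv

lemma memLp_div {W : ℝ → ℝ} (hWc : Continuous W) (hWp : ∀ x, 0 < W x) {w : ℝ → ℂ}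
    (hw : MemLp (fun x => W x • w x) 2 volume) : LocallyIntegrable w volume := by
  have h1 : LocallyIntegrable (fun x => W x • w x) volume := hw.locallyIntegrable (by norm_num)
  have h2 := (h1.locallyIntegrableOn univ).continuousOn_smul isOpen_univ.isLocallyClosed
    (hWc.inv₀ fun x => (hWp x).ne').continuousOn
  rw [locallyIntegrableOn_univ] at h2
  refine h2.congr (ae_of_all _ fun x => ?_)
  simp only [Pi.inv_apply, smul_smul]
  rw [inv_mul_cancel₀ (hWp x).ne', one_smul]

lemma mollify_cc {W : ℝ → ℝ} (hWc : Continuous W) {w : ℝ → ℂ} (hw : Continuous w)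
    (hwc : HasCompactSupport w) {φ : ℕ → ContDiffBump (0 : ℝ)} (hφ1 : ∀ n, (φ n).rOut ≤ 1)
    (hφ : Tendsto (fun n => (φ n).rOut) atTop (𝓝 0)) :
    Tendsto (fun n => eLpNorm (fun x => W x •
      (((φ n).normed volume ⋆[ContinuousLinearMap.lsmul ℝ ℝ, volume] w) x - w x)) 2 volume)
      atTop (𝓝 0) := by
  obtain ⟨M, hM⟩ := hw.bounded_above_of_compact_support hwc
  set T := Metric.cthickening 1 (tsupport w)
  have hT : IsCompact T := hwc.isCompact.cthickening
  obtain ⟨S, hS⟩ := hT.exists_bound_of_continuousOn hWc.continuousOn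
  have hconv : ∀ n, Continuous
      ((φ n).normed volume ⋆[ContinuousLinearMap.lsmul ℝ ℝ, volume] w) := fun n =>
    hwc.continuous_convolution_right _ ((φ n).continuous_normed.locallyIntegrable) hw
  refine tendsto_dominated (G := T.indicator fun _ => S * (2 * M)) (fun n => ?_) ?_
    (fun n x => ?_) (fun x => ?_)
  · exact (hWc.smul ((hconv n).sub hw)).aestronglyMeasurable
  · exact memLp_indicator_const 2 hT.measurableSet _ (Or.inr hT.measure_lt_top.ne)
  · by_cases hx : x ∈ T
    · rw [indicator_of_mem hx, norm_smul, Real.norm_eq_abs]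
      have hM0 : 0 ≤ M := (norm_nonneg _).trans (hM x)
      have hS0 : 0 ≤ S := (norm_nonneg _).trans (hS x hx)
      refine mul_le_mul (hS x hx) ?_ (norm_nonneg _) hS0
      rw [← dist_eq_norm]
      refine (φ n).dist_normed_convolution_le hw.aestronglyMeasurable fun y _ => ?_
      rw [dist_eq_norm]
      calc _ ≤ ‖w y‖ + ‖w x‖ := norm_sub_le _ _
        _ ≤ 2 * M := by linarith [hM x, hM y]
    · have h0 : ∀ y, dist y x < 1 → w y = 0 := by
        intro y hy
        by_contra hne
        exact hx (Metric.mem_cthickening_of_dist_le x y 1 _ (subset_tsupport _ hne)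
          (by rw [dist_comm]; exact hy.le))
      have hx0 := h0 x (by simp)
      rw [(φ n).normed_convolution_eq_right (fun y hy => ?_)]
      · rw [indicator_of_notMem hx]; simp
      · rw [hx0, h0 y (lt_of_lt_of_le hy (hφ1 n))]
  · have h := ContDiffBump.convolution_tendsto_right_of_continuous (μ := volume) hφ hw x
    have h2 := (h.sub_const (w x)).const_smul (W x)
    simpa using h2

lemma exists_div {W : ℝ → ℝ} (hWp : ∀ x, 0 < W x) (hWc : Continuous W) {g : ℝ → ℂ}
    (hg : Continuous g) (hgc : HasCompactSupport g) :
    ∃ w' : ℝ → ℂ, Continuous w' ∧ HasCompactSupport w' ∧ ∀ x, W x • w' x = g x := by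
  refine ⟨fun x => (W x)⁻¹ • g x, ?_, ?_, fun x => ?_⟩
  · have hi : Continuous fun x => (W x)⁻¹ := hWc.inv₀ fun x => (hWp x).ne'
    exact hi.smul hg
  · exact hgc.mono fun x hx => by
      rw [Function.mem_support] at hx ⊢
      intro h
      exact hx (by rw [h, smul_zero])
  · rw [smul_smul, mul_inv_cancel₀ (hWp x).ne', one_smul]

set_option maxHeartbeats 400000 in
lemma mollify {W : ℝ → ℝ} {B : ℝ} (hB : 0 ≤ B) (hWp : ∀ x, 0 < W x) (hWc : Continuous W)
    (hW : ∀ x t, |t| ≤ 1 → W x ≤ B * W (x - t))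
    {w : ℝ → ℂ} (hw : MemLp (fun x => W x • w x) 2 volume)
    {φ : ℕ → ContDiffBump (0 : ℝ)} (hφ1 : ∀ n, (φ n).rOut ≤ 1)
    (hφ : Tendsto (fun n => (φ n).rOut) atTop (𝓝 0)) :
    Tendsto (fun n => eLpNorm (fun x => W x •
      ((φ n).normed volume ⋆[ContinuousLinearMap.lsmul ℝ ℝ, volume] w) x - W x • w x) 2 volume)
      atTop (𝓝 0) := by
  have hwl := memLp_div hWc hWp hw
  rw [ENNReal.tendsto_nhds_zero]
  intro ε hε
  by_cases hεt : ε = ⊤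
  · simp [hεt]
  obtain ⟨η, hη, hηε⟩ : ∃ η : ℝ≥0∞, η ≠ 0 ∧ ENNReal.ofReal B * η + (η + η) ≤ ε := by
    refine ⟨ε / (ENNReal.ofReal B + 2), ?_, ?_⟩
    · simp [hε.ne', ENNReal.div_eq_zero_iff]
    · rw [← two_mul, ← add_mul]
      exact ENNReal.mul_div_le
  obtain ⟨g, hgc, hg1, hg, hgm⟩ := hw.exists_hasCompactSupport_eLpNorm_sub_le (by norm_num) hη
  obtain ⟨w', hw'c, hw's, hWw'⟩ := exists_div hWp hWc hg hgc
  have hw'l : LocallyIntegrable w' volume := hw'c.locallyIntegrable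
  filter_upwards [(ENNReal.tendsto_nhds_zero.1 (mollify_cc hWc hw'c hw's hφ1 hφ)) η
    (pos_iff_ne_zero.2 hη)] with n hn
  have hcont : ∀ z : ℝ → ℂ, LocallyIntegrable z volume → Continuous
      ((φ n).normed volume ⋆[ContinuousLinearMap.lsmul ℝ ℝ, volume] z) := fun z hz =>
    (φ n).hasCompactSupport_normed.continuous_convolution_left _ (φ n).continuous_normed hz
  have hex : ∀ z : ℝ → ℂ, LocallyIntegrable z volume → ConvolutionExists
      ((φ n).normed volume) z (ContinuousLinearMap.lsmul ℝ ℝ) volume := fun z hz =>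
    (φ n).hasCompactSupport_normed.convolutionExists_left _ (φ n).continuous_normed hz
  have e : (fun x => W x •
      ((φ n).normed volume ⋆[ContinuousLinearMap.lsmul ℝ ℝ, volume] w) x - W x • w x)
      = (fun x => W x • ((φ n).normed volume ⋆[ContinuousLinearMap.lsmul ℝ ℝ, volume] (w - w')) x)
        + ((fun x => W x • (((φ n).normed volume ⋆[ContinuousLinearMap.lsmul ℝ ℝ, volume] w') x
          - w' x)) - ((fun x => W x • w x) - g)) := by
    have h1 : ((φ n).normed volume ⋆[ContinuousLinearMap.lsmul ℝ ℝ, volume] w)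
      = ((φ n).normed volume ⋆[ContinuousLinearMap.lsmul ℝ ℝ, volume] (w - w'))
       + ((φ n).normed volume ⋆[ContinuousLinearMap.lsmul ℝ ℝ, volume] w') := by
      rw [← (hex _ (hwl.sub hw'l)).distrib_add (hex _ hw'l), sub_add_cancel]
    ext x
    simp only [h1, Pi.add_apply, Pi.sub_apply, ← hWw' x, smul_add, smul_sub]
    ring
  have hmass : ∫⁻ t, ‖(φ n).normed volume t‖ₑ = 1 := by
    have : ∀ t, ‖(φ n).normed volume t‖ₑ = ENNReal.ofReal ((φ n).normed volume t) := fun t =>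
      Real.enorm_of_nonneg ((φ n).nonneg_normed t)
    simp only [this]
    rw [← ofReal_integral_eq_lintegral_ofReal (φ n).integrable_normed
      (ae_of_all _ (φ n).nonneg_normed), (φ n).integral_normed, ENNReal.ofReal_one]
  have hks : ∀ t, 1 < |t| → (φ n).normed volume t = 0 := by
    intro t ht
    have : t ∉ Function.support ((φ n).normed volume) := by
      rw [(φ n).support_normed_eq, Metric.mem_ball, dist_zero_right, Real.norm_eq_abs]
      linarith [hφ1 n]
    simpa using this
  have y := young hB (fun x => (hWp x).le) hWc hW (φ n).continuous_normed hks
    (hwl.sub hw'l).aestronglyMeasurable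
  rw [hmass, mul_one] at y
  have e2 : (fun x => W x • (w - w') x) = (fun x => W x • w x) - g := by
    ext x; simp only [Pi.sub_apply, ← hWw' x, smul_sub]
  rw [e2] at y
  rw [e]
  have m1 : AEStronglyMeasurable (fun x => W x • ((φ n).normed volume
      ⋆[ContinuousLinearMap.lsmul ℝ ℝ, volume] (w - w')) x) volume :=
    (hWc.smul (hcont _ (hwl.sub hw'l))).aestronglyMeasurable
  have m2 : AEStronglyMeasurable (fun x => W x • (((φ n).normed volume
      ⋆[ContinuousLinearMap.lsmul ℝ ℝ, volume] w') x - w' x)) volume :=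
    (hWc.smul ((hcont _ hw'l).sub hw'c)).aestronglyMeasurable
  have m3 : AEStronglyMeasurable ((fun x => W x • w x) - g) volume :=
    hw.1.sub hg.aestronglyMeasurable
  refine (eLpNorm_add_le m1 (m2.sub m3) (by norm_num)).trans ?_
  refine le_trans ?_ hηε
  refine add_le_add (y.trans (mul_le_mul_right hg1 _)) ?_
  exact (eLpNorm_sub_le m2 m3 (by norm_num)).trans (add_le_add hn hg1)

lemma hcs_iter {u : ℝ → ℂ} (hu : HasCompactSupport u) (k : ℕ) :
    HasCompactSupport (iteratedDeriv k u) := by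
  induction k with
  | zero => simpa using hu
  | succ n ih => rw [iteratedDeriv_succ]; exact ih.deriv

lemma QD_cont {K : ℕ} {q : ℕ → ℝ} {u : ℝ → ℂ} (hu : ContDiff ℝ K u) : Continuous (QD K q u) := by
  unfold QD
  refine continuous_finsetSum _ fun k hk => ?_
  have hk' : k ≤ K := by simpa [Nat.lt_succ_iff] using hk
  exact continuous_const.mul (hu.continuous_iteratedDeriv k (by exact_mod_cast hk'))

lemma QD_hcs {K : ℕ} {q : ℕ → ℝ} {u : ℝ → ℂ} (hu : HasCompactSupport u) :
    HasCompactSupport (QD K q u) := by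
  have : QD K q u = ∑ k ∈ Finset.range (K + 1),
      fun ξ => (q k : ℂ) * Complex.I ^ k * iteratedDeriv k u ξ := by
    ext ξ; simp [QD]
  rw [this]
  refine Finset.sum_induction _ HasCompactSupport (fun a b ha hb => ha.add hb)
    HasCompactSupport.zero fun k _ => ?_
  exact (hcs_iter hu k).mul_left

lemma exists_cutoff (K : ℕ) : ∃ χ : ℕ → ℝ → ℂ, (∀ n, ContDiff ℝ ∞ (χ n)) ∧
    (∀ n, HasCompactSupport (χ n)) ∧
    (∃ B : ℝ, 0 ≤ B ∧ ∀ n x, ∀ j ≤ K, ‖iteratedDeriv j (χ n) x‖ ≤ B) ∧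
    ∀ x, ∀ᶠ n in atTop, χ n =ᶠ[𝓝 x] fun _ => 1 := by
  let b : ContDiffBump (0 : ℝ) := ⟨1, 2, by norm_num, by norm_num⟩
  let θ : ℝ → ℂ := fun x => ((b x : ℝ) : ℂ)
  have hθ : ContDiff ℝ ∞ θ := Complex.ofRealCLM.contDiff.comp b.contDiff
  have hθc : HasCompactSupport θ := b.hasCompactSupport.comp_left (g := fun r : ℝ => (r : ℂ)) (by simp)
  have hb : ∀ j, ∃ B : ℝ, ∀ x, ‖iteratedDeriv j θ x‖ ≤ B := fun j =>
    (hθ.continuous_iteratedDeriv j (by exact_mod_cast le_top)).bounded_above_of_compact_support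
      (hcs_iter hθc j)
  choose B hB using hb
  have hB0 : ∀ j, 0 ≤ B j := fun j => (norm_nonneg _).trans (hB j 0)
  let c : ℕ → ℝ := fun n => 1 / ((n : ℝ) + 1)
  have hc0 : ∀ n, 0 < c n := fun n => by positivity
  have hc1 : ∀ n, c n ≤ 1 := fun n => by
    simp only [c]; rw [div_le_one (by positivity)]; linarith [Nat.cast_nonneg (α := ℝ) n]
  refine ⟨fun n x => θ (c n * x), fun n => ?_, fun n => ?_, ⟨∑ j ∈ Finset.range (K + 1), B j,
    Finset.sum_nonneg fun j _ => hB0 j, fun n x j hj => ?_⟩, fun x => ?_⟩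
  · exact hθ.comp (contDiff_const.mul contDiff_id)
  · exact hθc.comp_homeomorph (Homeomorph.mulLeft₀ (c n) (hc0 n).ne')
  · have := iteratedDeriv_comp_const_smul (n := j) (hθ.of_le (by exact_mod_cast le_top)) (c n)
    rw [this, norm_smul, norm_pow, Real.norm_eq_abs, abs_of_pos (hc0 n)]
    calc _ ≤ 1 * B j := mul_le_mul (pow_le_one₀ (hc0 n).le (hc1 n)) (hB j _) (norm_nonneg _) (by norm_num)
      _ = B j := one_mul _
      _ ≤ _ := Finset.single_le_sum (f := B) (fun j _ => hB0 j) (by simpa [Nat.lt_succ_iff] using hj)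
  · have ht : Tendsto (fun n => c n * x) atTop (𝓝 0) := by
      have := (tendsto_one_div_add_atTop_nhds_zero_nat (𝕜 := ℝ)).mul_const x
      rw [zero_mul] at this
      exact this
    filter_upwards [ht.eventually (Metric.ball_mem_nhds 0 one_pos)] with n hn
    have hc : Continuous fun y => c n * y := by fun_prop
    filter_upwards [hc.continuousAt.eventually (Metric.isOpen_ball.mem_nhds hn)] with y hy
    simp only [θ]
    rw [b.one_of_mem_closedBall (Metric.ball_subset_closedBall hy)]
    simp

lemma cutoff_tendsto {K : ℕ} {q : ℕ → ℝ} {W : ℝ → ℝ} (hW : Continuous W) {U : ℝ → ℂ}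
    (hU : ContDiff ℝ K U)
    (hm : ∀ a ≤ K, MemLp (fun x => W x • iteratedDeriv a U x) 2 volume)
    {χ : ℕ → ℝ → ℂ} (hχ : ∀ n, ContDiff ℝ ∞ (χ n)) {B : ℝ} (hB0 : 0 ≤ B)
    (hB : ∀ n x, ∀ j ≤ K, ‖iteratedDeriv j (χ n) x‖ ≤ B)
    (h1 : ∀ x, ∀ᶠ n in atTop, χ n =ᶠ[𝓝 x] fun _ => 1) :
    Tendsto (fun n => eLpNorm (fun x => W x • QD K q (fun y => χ n y * U y) x - W x • QD K q U x) 2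
      volume) atTop (𝓝 0) := by
  have hχK : ∀ n, ContDiff ℝ K (χ n) := fun n => (hχ n).of_le (by exact_mod_cast le_top)
  have hχU : ∀ n, ContDiff ℝ K (fun y => χ n y * U y) := fun n => (hχK n).mul hU
  let G : ℝ → ℝ := fun x => ∑ k ∈ Finset.range (K + 1), |q k| *
    ((∑ i ∈ Finset.range (k + 1), (k.choose i : ℝ) * B * ‖W x • iteratedDeriv (k - i) U x‖)
      + ‖W x • iteratedDeriv k U x‖)
  have hG : MemLp G 2 volume := by
    have g1 : ∀ k ≤ K, ∀ i, MemLp (fun x => (k.choose i : ℝ) * B *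
        ‖W x • iteratedDeriv (k - i) U x‖) 2 volume := fun k hk i =>
      ((hm (k - i) (by omega)).norm).const_mul ((k.choose i : ℝ) * B)
    have g2 : ∀ k ≤ K, MemLp (fun x => ∑ i ∈ Finset.range (k + 1), (k.choose i : ℝ) * B *
        ‖W x • iteratedDeriv (k - i) U x‖) 2 volume := fun k hk =>
      memLp_finsetSum _ fun i _ => g1 k hk i
    have g3 : ∀ k ≤ K, MemLp (fun x => |q k| * ((∑ i ∈ Finset.range (k + 1), (k.choose i : ℝ) * B *
        ‖W x • iteratedDeriv (k - i) U x‖) + ‖W x • iteratedDeriv k U x‖)) 2 volume := fun k hk =>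
      ((g2 k hk).add (hm k hk).norm).const_mul |q k|
    exact memLp_finsetSum _ fun k hk => g3 k (by simpa [Nat.lt_succ_iff] using hk)
  refine tendsto_dominated (G := G) (fun n => ?_) ?_ (fun n x => ?_) fun x => ?_
  · exact ((hW.smul (QD_cont (hχU n))).sub (hW.smul (QD_cont hU))).aestronglyMeasurable
  · exact hG
  · rw [← smul_sub, QD, QD, ← Finset.sum_sub_distrib, Finset.smul_sum]
    refine (norm_sum_le _ _).trans (Finset.sum_le_sum fun k hk => ?_)
    have hk' : k ≤ K := by simpa [Nat.lt_succ_iff] using hk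
    rw [← mul_sub, ← mul_smul_comm, norm_mul, norm_mul, norm_pow, Complex.norm_I, one_pow, mul_one,
      Complex.norm_real, Real.norm_eq_abs, smul_sub]
    refine mul_le_mul_of_nonneg_left ((norm_sub_le _ _).trans (add_le_add ?_ le_rfl)) (abs_nonneg _)
    have hl := norm_iteratedFDeriv_mul_le (𝕜 := ℝ) (hχK n) hU x (n := k) (by exact_mod_cast hk')
    simp only [norm_iteratedFDeriv_eq_norm_iteratedDeriv] at hl
    rw [norm_smul]
    refine (mul_le_mul_of_nonneg_left hl (norm_nonneg _)).trans ?_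
    rw [Finset.mul_sum]
    refine Finset.sum_le_sum fun i hi => ?_
    have hi' : i ≤ k := by simpa [Nat.lt_succ_iff] using hi
    rw [norm_smul]
    have := hB n x i (by omega)
    calc _ = (k.choose i : ℝ) * ‖iteratedDeriv i (χ n) x‖ * (‖W x‖ * ‖iteratedDeriv (k - i) U x‖) := by
          ring
      _ ≤ _ := by gcongr
  · refine tendsto_const_nhds.congr' ?_
    filter_upwards [h1 x] with n hn
    have : (fun y => χ n y * U y) =ᶠ[𝓝 x] U := by
      filter_upwards [hn] with y hy
      rw [hy, one_mul]
    simp only [QD, this.iteratedDeriv_eq, sub_self]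

lemma parts (k : ℕ) : ∀ (φ ψ : ℝ → ℂ), ContDiff ℝ k φ → ContDiff ℝ k ψ → HasCompactSupport φ →
    HasCompactSupport ψ →
    ∫ x, ψ x * starRingEnd ℂ (iteratedDeriv k φ x)
      = (-1) ^ k * ∫ x, iteratedDeriv k ψ x * starRingEnd ℂ (φ x) := by
  induction k with
  | zero => intros; simp
  | succ n ih =>
    intro φ ψ hφ hψ hφc hψc
    have hφ' : ContDiff ℝ n (deriv φ) := by
      have := contDiff_succ_iff_deriv.1 (by exact_mod_cast hφ : ContDiff ℝ ((n : WithTop ℕ∞) + 1) φ)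
      exact this.2.2
    have hφd : Differentiable ℝ φ := hφ.differentiable (by simp)
    have hψn : ContDiff ℝ 1 (iteratedDeriv n ψ) := by
      refine ContDiff.iterate_deriv' 1 n ?_ |> fun h => by simpa [iteratedDeriv_eq_iterate] using h
      simpa [add_comm] using hψ
    have hψd : Differentiable ℝ (iteratedDeriv n ψ) := hψn.differentiable (by simp)
    rw [iteratedDeriv_succ', ih _ _ hφ' (hψ.of_le (by exact_mod_cast Nat.le_succ n)) hφc.deriv hψc,
      pow_succ, mul_assoc]
    congr 1
    have hφcont := hφ.continuous
    have hφ'cont := hφ'.continuous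
    have hcsn := hcs_iter hψc n
    have hcsn' := hcs_iter hψc (n + 1)
    have hcc : Continuous (iteratedDeriv (n + 1) ψ) := hψ.continuous_iteratedDeriv _ (by simp)
    have := integral_mul_deriv_eq_deriv_mul_of_integrable (u := iteratedDeriv n ψ)
      (u' := iteratedDeriv (n + 1) ψ)
      (v := fun x => starRingEnd ℂ (φ x)) (v' := fun x => starRingEnd ℂ (deriv φ x))
      (fun x _ => by rw [iteratedDeriv_succ]; exact (hψd x).hasDerivAt)
      (fun x _ => (hφd x).hasDerivAt.star)
      (Continuous.integrable_of_hasCompactSupport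
        (hψn.continuous.mul (Complex.continuous_conj.comp hφ'cont)) hcsn.mul_right)
      (Continuous.integrable_of_hasCompactSupport
        (hcc.mul (Complex.continuous_conj.comp hφcont)) hcsn'.mul_right)
      (Continuous.integrable_of_hasCompactSupport
        (hψn.continuous.mul (Complex.continuous_conj.comp hφcont)) hcsn.mul_right)
    rw [this]; ring

lemma QD_symm {K : ℕ} {q : ℕ → ℝ} {φ ψ : ℝ → ℂ} (hφ : ContDiff ℝ K φ) (hψ : ContDiff ℝ K ψ)
    (hφc : HasCompactSupport φ) (hψc : HasCompactSupport ψ) :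
    ∫ x, ψ x * starRingEnd ℂ (QD K q φ x) = ∫ x, QD K q ψ x * starRingEnd ℂ (φ x) := by
  have hle : ∀ k ∈ Finset.range (K + 1), (k : WithTop ℕ∞) ≤ K := fun k hk => by
    have : k ≤ K := by simpa [Nat.lt_succ_iff] using hk
    exact_mod_cast this
  simp only [QD, map_sum, Finset.mul_sum, Finset.sum_mul]
  rw [integral_finsetSum, integral_finsetSum]
  · refine Finset.sum_congr rfl fun k hk => ?_
    have h := parts k φ ψ (hφ.of_le (hle k hk)) (hψ.of_le (hle k hk)) hφc hψc
    have e1 : ∀ x, ψ x * starRingEnd ℂ ((q k : ℂ) * Complex.I ^ k * iteratedDeriv k φ x)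
      = ((q k : ℂ) * (-1) ^ k * Complex.I ^ k) * (ψ x * starRingEnd ℂ (iteratedDeriv k φ x)) := by
      intro x
      simp only [map_mul, map_pow, Complex.conj_I, Complex.conj_ofReal]
      rw [neg_pow]; ring
    have e2 : ∀ x, (q k : ℂ) * Complex.I ^ k * iteratedDeriv k ψ x * starRingEnd ℂ (φ x)
      = ((q k : ℂ) * Complex.I ^ k) * (iteratedDeriv k ψ x * starRingEnd ℂ (φ x)) := by
      intro x; ring
    simp only [e1, e2]
    rw [integral_const_mul, integral_const_mul, h]
    have : ((-1 : ℂ) ^ k) * (-1) ^ k = 1 := by rw [← mul_pow]; simp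
    linear_combination ((q k : ℂ) * Complex.I ^ k *
      ∫ x, iteratedDeriv k ψ x * starRingEnd ℂ (φ x)) * this
  · intro k hk
    exact Continuous.integrable_of_hasCompactSupport ((continuous_const.mul
      (hψ.continuous_iteratedDeriv k (hle k hk))).mul (Complex.continuous_conj.comp hφ.continuous))
      ((hcs_iter hψc k).mul_left.mul_right)
  · intro k hk
    exact Continuous.integrable_of_hasCompactSupport (hψ.continuous.mul
      (Complex.continuous_conj.comp (continuous_const.mul
      (hφ.continuous_iteratedDeriv k (hle k hk))))) hψc.mul_right

lemma iter_ofReal {ρ : ℝ → ℝ} (hρ : ContDiff ℝ ∞ ρ) (k : ℕ) :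
    iteratedDeriv k (fun y => (ρ y : ℂ)) = fun y => ((iteratedDeriv k ρ y : ℝ) : ℂ) := by
  induction k with
  | zero => simp
  | succ n ih =>
    rw [iteratedDeriv_succ, ih]
    ext y
    rw [iteratedDeriv_succ]
    have hd : Differentiable ℝ (iteratedDeriv n ρ) :=
      hρ.differentiable_iteratedDeriv n (by exact_mod_cast WithTop.coe_lt_top _)
    exact (hd y).hasDerivAt.ofReal_comp.deriv

lemma hcs_iter_real {u : ℝ → ℝ} (hu : HasCompactSupport u) (k : ℕ) :
    HasCompactSupport (iteratedDeriv k u) := by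
  induction k with
  | zero => simpa using hu
  | succ n ih => rw [iteratedDeriv_succ]; exact ih.deriv

lemma weak_identity {K : ℕ} {q : ℕ → ℝ} {u s : ℝ → ℂ} (hu : LocallyIntegrable u volume)
    (hweak : ∀ φ : ℝ → ℂ, ContDiff ℝ K φ → HasCompactSupport φ →
      ∫ x, QD K q φ x * starRingEnd ℂ (u x) = ∫ x, φ x * starRingEnd ℂ (s x))
    {ρ : ℝ → ℝ} (hρ : ContDiff ℝ ∞ ρ) (hρc : HasCompactSupport ρ) (x : ℝ) :
    QD K q (ρ ⋆[ContinuousLinearMap.lsmul ℝ ℝ, volume] u) x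
      = (ρ ⋆[ContinuousLinearMap.lsmul ℝ ℝ, volume] s) x := by
  have hρC : ContDiff ℝ ∞ (fun y => (ρ y : ℂ)) := Complex.ofRealCLM.contDiff.comp hρ
  have hφ : ContDiff ℝ K (fun y => (ρ (x - y) : ℂ)) :=
    (hρC.comp (contDiff_const.sub contDiff_id)).of_le (by exact_mod_cast le_top)
  have hφc : HasCompactSupport (fun y => (ρ (x - y) : ℂ)) := by
    have h1 : HasCompactSupport (fun y => (ρ y : ℂ)) :=
      hρc.comp_left (g := fun r : ℝ => (r : ℂ)) (by simp)
    exact h1.comp_homeomorph (Homeomorph.subLeft x)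
  have hid : ∀ k y, iteratedDeriv k (fun y => (ρ (x - y) : ℂ)) y
      = (-1) ^ k * ((iteratedDeriv k ρ (x - y) : ℝ) : ℂ) := by
    intro k y
    have := congrFun (iteratedDeriv_comp_const_sub k (f := fun y => (ρ y : ℂ)) x) y
    rw [iter_ofReal hρ k] at this
    simpa using this
  have h := hweak _ hφ hφc
  have hconv : ∀ (κ : ℝ → ℝ) (w : ℝ → ℂ), ∫ y, (κ (x - y) : ℂ) * starRingEnd ℂ (w y)
      = starRingEnd ℂ ((κ ⋆[ContinuousLinearMap.lsmul ℝ ℝ, volume] w) x) := by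
    intro κ w
    rw [convolution_lsmul_swap, ← integral_conj]
    refine integral_congr_ae (ae_of_all _ fun y => ?_)
    simp [Complex.real_smul]
  rw [hconv] at h
  simp only [QD, Finset.sum_mul] at h
  rw [integral_finsetSum] at h
  · have h2 := congrArg (starRingEnd ℂ) h
    rw [Complex.conj_conj] at h2
    rw [← h2, map_sum, QD]
    refine Finset.sum_congr rfl fun k hk => ?_
    have e : ∀ y, (q k : ℂ) * Complex.I ^ k * iteratedDeriv k (fun y => (ρ (x - y) : ℂ)) y *
        starRingEnd ℂ (u y) = ((q k : ℂ) * Complex.I ^ k * (-1) ^ k) *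
        (((iteratedDeriv k ρ (x - y) : ℝ) : ℂ) * starRingEnd ℂ (u y)) := by
      intro y; rw [hid]; ring
    simp only [e]
    rw [integral_const_mul, hconv (iteratedDeriv k ρ) u, conv_deriv hρ hρc hu]
    simp only [map_mul, map_pow, Complex.conj_conj, Complex.conj_ofReal, Complex.conj_I, map_neg,
      map_one]
    rw [neg_pow Complex.I]
    have : ((-1 : ℂ) ^ k) * (-1) ^ k = 1 := by rw [← mul_pow]; simp
    linear_combination -((q k : ℂ) * Complex.I ^ k *
      (iteratedDeriv k ρ ⋆[ContinuousLinearMap.lsmul ℝ ℝ, volume] u) x) * this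
  · intro k hk
    have hk' : k ≤ K := by simpa [Nat.lt_succ_iff] using hk
    have hc : Continuous (fun y => (q k : ℂ) * Complex.I ^ k *
        iteratedDeriv k (fun y => (ρ (x - y) : ℂ)) y) :=
      continuous_const.mul (hφ.continuous_iteratedDeriv k (by exact_mod_cast hk'))
    have hcs : HasCompactSupport (fun y => (q k : ℂ) * Complex.I ^ k *
        iteratedDeriv k (fun y => (ρ (x - y) : ℂ)) y) := (hcs_iter hφc k).mul_left
    have hul : LocallyIntegrable (fun y => starRingEnd ℂ (u y)) volume := fun z => by
      obtain ⟨t, ht, hti⟩ := hu z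
      exact ⟨t, ht, (Complex.conjLIE.toContinuousLinearEquiv.toContinuousLinearMap).integrable_comp hti⟩
    have := hul.integrable_smul_left_of_hasCompactSupport hc hcs
    simpa [smul_eq_mul] using this

lemma iter_zero_out {k : ℝ → ℝ} (hks : ∀ t, 1 < |t| → k t = 0) (a : ℕ) :
    ∀ t, 1 < |t| → iteratedDeriv a k t = 0 := by
  intro t ht
  have hev : k =ᶠ[𝓝 t] fun _ => 0 := by
    filter_upwards [(isOpen_lt continuous_const continuous_abs).mem_nhds ht] with y hy
    exact hks y hy
  rw [hev.iteratedDeriv_eq]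
  simp

lemma memLp_conv {W : ℝ → ℝ} {B : ℝ} (hB : 0 ≤ B) (hWp : ∀ x, 0 < W x) (hWc : Continuous W)
    (hW : ∀ x t, |t| ≤ 1 → W x ≤ B * W (x - t)) {k : ℝ → ℝ} (hk : Continuous k)
    (hkc : HasCompactSupport k) (hks : ∀ t, 1 < |t| → k t = 0) {w : ℝ → ℂ}
    (hw : MemLp (fun x => W x • w x) 2 volume) :
    MemLp (fun x => W x • (k ⋆[ContinuousLinearMap.lsmul ℝ ℝ, volume] w) x) 2 volume := by
  have hwl := memLp_div hWc hWp hw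
  have hy := young hB (fun x => (hWp x).le) hWc hW hk hks hwl.aestronglyMeasurable
  refine ⟨(hWc.smul (hkc.continuous_convolution_left _ hk hwl)).aestronglyMeasurable,
    hy.trans_lt ?_⟩
  have h1 : ∫⁻ t, ‖k t‖ₑ < ⊤ := (hk.integrable_of_hasCompactSupport hkc).2
  exact ENNReal.mul_lt_top (ENNReal.mul_lt_top ENNReal.ofReal_lt_top h1) hw.2

lemma exists_bumps : ∃ φ : ℕ → ContDiffBump (0 : ℝ), (∀ n, (φ n).rOut ≤ 1) ∧
    Tendsto (fun n => (φ n).rOut) atTop (𝓝 0) := by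
  refine ⟨fun n => ⟨1 / ((n : ℝ) + 1) / 2, 1 / ((n : ℝ) + 1), by positivity,
    half_lt_self (by positivity)⟩, fun n => ?_, ?_⟩
  · show 1 / ((n : ℝ) + 1) ≤ 1
    rw [div_le_one (by positivity)]; linarith [Nat.cast_nonneg (α := ℝ) n]
  · exact tendsto_one_div_add_atTop_nhds_zero_nat

lemma eLpNorm_tri {a b c : ℝ → ℂ} {ε : ℝ≥0∞} (ha : AEStronglyMeasurable a volume)
    (hb : AEStronglyMeasurable b volume) (hc : AEStronglyMeasurable c volume)
    (h1 : eLpNorm (fun x => a x - b x) 2 volume ≤ ε / 2)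
    (h2 : eLpNorm (fun x => b x - c x) 2 volume ≤ ε / 2) :
    eLpNorm (fun x => a x - c x) 2 volume ≤ ε := by
  have e : (fun x => a x - c x) = (fun x => a x - b x) + (fun x => b x - c x) := by
    ext x; simp
  rw [e]
  refine (eLpNorm_add_le (ha.sub hb) (hb.sub hc) (by norm_num)).trans ?_
  exact (add_le_add h1 h2).trans (ENNReal.add_halves ε).le

lemma approx {K : ℕ} {q : ℕ → ℝ} {v Wi : ℝ → ℝ} {B M : ℝ} (hB : 0 ≤ B)
    (hvp : ∀ x, 0 < v x) (hvc : Continuous v) (hv : ∀ x t, |t| ≤ 1 → v x ≤ B * v (x - t))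
    (hip : ∀ x, 0 < Wi x) (hic : Continuous Wi) (hi : ∀ x t, |t| ≤ 1 → Wi x ≤ B * Wi (x - t))
    (hvi : ∀ x, v x ≤ M * Wi x) {u s : ℝ → ℂ}
    (hu : MemLp (fun x => Wi x • u x) 2 volume) (hs : MemLp (fun x => v x • s x) 2 volume)
    (hweak : ∀ φ : ℝ → ℂ, ContDiff ℝ K φ → HasCompactSupport φ →
      ∫ x, QD K q φ x * starRingEnd ℂ (u x) = ∫ x, φ x * starRingEnd ℂ (s x))
    {ε : ℝ≥0∞} (hε : ε ≠ 0) :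
    ∃ φ : ℝ → ℂ, ContDiff ℝ K φ ∧ HasCompactSupport φ ∧
      eLpNorm (fun x => Wi x • φ x - Wi x • u x) 2 volume ≤ ε ∧
      eLpNorm (fun x => v x • QD K q φ x - v x • s x) 2 volume ≤ ε := by
  have hε2 : 0 < ε / 2 := ENNReal.half_pos hε
  have hul := memLp_div hic hip hu
  have hsl := memLp_div hvc hvp hs
  have hvu : MemLp (fun x => v x • u x) 2 volume := by
    refine MemLp.of_le_mul (c := M) hu
      (hvc.aestronglyMeasurable.smul hul.aestronglyMeasurable) (ae_of_all _ fun x => ?_)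
    rw [norm_smul, norm_smul, Real.norm_eq_abs, Real.norm_eq_abs, abs_of_pos (hvp x),
      abs_of_pos (hip x), ← mul_assoc]
    exact mul_le_mul_of_nonneg_right (hvi x) (norm_nonneg _)
  obtain ⟨b, hb1, hb0⟩ := exists_bumps
  have t1 := ENNReal.tendsto_nhds_zero.1 (mollify hB hip hic hi hu hb1 hb0) _ hε2
  have t2 := ENNReal.tendsto_nhds_zero.1 (mollify hB hvp hvc hv hs hb1 hb0) _ hε2
  obtain ⟨n, hn1, hn2⟩ := (t1.and t2).exists
  obtain ⟨ρ, hρe⟩ : ∃ ρ : ℝ → ℝ, ρ = (b n).normed volume := ⟨_, rfl⟩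
  have hρ : ContDiff ℝ ∞ ρ := hρe ▸ (b n).contDiff_normed
  have hρc : HasCompactSupport ρ := hρe ▸ (b n).hasCompactSupport_normed
  have hρs : ∀ t, 1 < |t| → ρ t = 0 := by
    intro t ht
    have : t ∉ Function.support ((b n).normed volume) := by
      rw [(b n).support_normed_eq, Metric.mem_ball, dist_zero_right, Real.norm_eq_abs]
      linarith [hb1 n]
    rw [hρe]
    simpa using this
  rw [← hρe] at hn1 hn2
  clear t1 t2
  have hwk := fun x => weak_identity hul hweak hρ hρc x
  have hcd := fun a => conv_deriv hρ hρc hul a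
  have hUm : ∀ a, MemLp (fun x => v x • (iteratedDeriv a ρ ⋆[ContinuousLinearMap.lsmul ℝ ℝ, volume] u) x)
      2 volume := fun a =>
    memLp_conv hB hvp hvc hv (hρ.continuous_iteratedDeriv a (by exact_mod_cast le_top))
      (hcs_iter_real hρc a) (iter_zero_out hρs a) hvu
  have hUi : MemLp (fun x => Wi x • (ρ ⋆[ContinuousLinearMap.lsmul ℝ ℝ, volume] u) x) 2 volume :=
    memLp_conv hB hip hic hi hρ.continuous hρc hρs hu
  have hUc : ContDiff ℝ ∞ (ρ ⋆[ContinuousLinearMap.lsmul ℝ ℝ, volume] u) :=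
    hρc.contDiff_convolution_left _ hρ hul
  obtain ⟨U, hUe⟩ : ∃ U : ℝ → ℂ, U = ρ ⋆[ContinuousLinearMap.lsmul ℝ ℝ, volume] u := ⟨_, rfl⟩
  rw [← hUe] at hUc hUi hn1
  simp only [← hcd] at hUm
  rw [← hUe] at hUm hwk
  have hsw : (fun x => v x • (ρ ⋆[ContinuousLinearMap.lsmul ℝ ℝ, volume] s) x - v x • s x)
      = fun x => v x • QD K q U x - v x • s x := by
    ext x; rw [hwk]
  rw [hsw] at hn2
  have hUK : ContDiff ℝ K U := hUc.of_le (by exact_mod_cast le_top)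
  obtain ⟨χ, hχ, hχc, ⟨A, hA0, hA⟩, hχ1⟩ := exists_cutoff K
  have c1 := ENNReal.tendsto_nhds_zero.1 (cutoff_tendsto (q := q) hvc hUK (fun a _ => hUm a) hχ hA0
    hA hχ1) _ hε2
  have c2 := ENNReal.tendsto_nhds_zero.1 (cutoff_tendsto (K := 0) (q := fun _ => 1) hic
    (hUc.of_le (by simp)) (fun a ha => by
      obtain rfl : a = 0 := by omega
      simpa using hUi) hχ hA0
    (fun n x j hj => hA n x j (by omega)) hχ1) _ hε2
  obtain ⟨m, hm1, hm2⟩ := (c1.and c2).exists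
  have hQ0 : ∀ w x, QD 0 (fun _ => 1) w x = w x := by
    intro w x; simp [QD]
  simp only [hQ0] at hm2
  have hχU : ContDiff ℝ K (fun y => χ m y * U y) :=
    ((hχ m).of_le (by exact_mod_cast le_top)).mul hUK
  refine ⟨fun y => χ m y * U y, hχU, (hχc m).mul_right, ?_, ?_⟩
  · exact eLpNorm_tri (hic.smul hχU.continuous).aestronglyMeasurable hUi.1 hu.1 hm2 hn1
  · exact eLpNorm_tri (hvc.smul (QD_cont hχU)).aestronglyMeasurable
      (hvc.smul (QD_cont hUK)).aestronglyMeasurable hs.1 hm1 hn2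

lemma esa {E : Type*} [NormedAddCommGroup E] [InnerProductSpace ℂ E] [CompleteSpace E]
    (T : E →ₗ.[ℂ] E) (hd : Dense (T.domain : Set E))
    (hs : ∀ x y : T.domain, inner ℂ (T x) (y : E) = inner ℂ (x : E) (T y))
    (h : ∀ y : T.adjoint.domain, ((y : E), T.adjoint y) ∈ closure (T.graph : Set (E × E))) :
    T.closure = T.adjoint ∧ IsSelfAdjoint T.closure := by
  have hfa : T.IsFormalAdjoint T := fun x y => hs x y
  have hle : T ≤ T.adjoint := hfa.le_adjoint hd
  have hcl := LinearPMap.adjoint_isClosed (T := T) hd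
  have hcb : T.IsClosable := hcl.isClosable.leIsClosable hle
  have hgr := hcb.graph_closure_eq_closure_graph
  have hgr' : closure (T.graph : Set (E × E)) = (T.closure.graph : Set (E × E)) := by
    rw [← hgr]; rfl
  have hle2 : T.closure.graph ≤ T.adjoint.graph := by
    intro p hp
    have hp' : p ∈ closure (T.graph : Set (E × E)) := by rw [hgr']; exact hp
    exact closure_minimal (LinearPMap.le_graph_of_le hle) hcl hp'
  have heq : T.closure = T.adjoint := by
    refine LinearPMap.eq_of_eq_graph (le_antisymm hle2 ?_)
    intro p hp
    obtain ⟨y, hy1, hy2⟩ := (LinearPMap.mem_graph_iff _).1 hp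
    have := h y
    rw [hgr', hy1, hy2] at this
    exact this
  refine ⟨heq, ?_⟩
  have hdc : Dense (T.closure.domain : Set E) := hd.mono (T.le_closure).1
  rw [LinearPMap.isSelfAdjoint_def]
  refine le_antisymm ?_ ?_
  · have h1 : T.closure.adjoint.IsFormalAdjoint T.closure := T.closure.adjoint_isFormalAdjoint hdc
    have h2 : T.closure.adjoint.IsFormalAdjoint T := by
      intro x y
      have := h1 x ⟨y, T.le_closure.1 y.2⟩
      rw [T.le_closure.2 (x := y) (y := ⟨y, T.le_closure.1 y.2⟩) rfl]
      exact this
    rw [heq] at h2 ⊢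
    exact h2.symm.le_adjoint hd
  · have h1 : T.closure.IsFormalAdjoint T.closure := by
      intro x y
      have hx : ((x : E), T.closure x) ∈ closure (T.graph : Set (E × E)) := by
        rw [hgr']; exact LinearPMap.mem_graph _ x
      have hcs : IsClosed {p : E × E | inner ℂ p.2 (y : E) = inner ℂ p.1 (T.closure y)} :=
        isClosed_eq (by fun_prop) (by fun_prop)
      refine closure_minimal ?_ hcs hx
      intro p hp
      obtain ⟨z, hz1, hz2⟩ := (LinearPMap.mem_graph_iff _).1 hp
      have h3 := (T.adjoint_isFormalAdjoint hd).symm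
      rw [← heq] at h3
      have := h3 z y
      simp only [Set.mem_ofPred_eq, ← hz1, ← hz2]
      exact this
    exact h1.le_adjoint hdc

lemma inner_ae {a b : Lp ℂ 2 (volume : Measure ℝ)} {f g : ℝ → ℂ} (ha : ⇑a =ᵐ[volume] f)
    (hb : ⇑b =ᵐ[volume] g) : inner ℂ a b = ∫ x, g x * starRingEnd ℂ (f x) := by
  rw [MeasureTheory.L2.inner_def]
  refine integral_congr_ae ?_
  filter_upwards [ha, hb] with x hx hy
  rw [hx, hy, RCLike.inner_apply]

lemma edist_le_ae {a b : Lp ℂ 2 (volume : Measure ℝ)} {f g : ℝ → ℂ} {ε : ℝ≥0∞}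
    (ha : ⇑a =ᵐ[volume] f) (hb : ⇑b =ᵐ[volume] g)
    (h : eLpNorm (fun x => f x - g x) 2 volume ≤ ε) : edist a b ≤ ε := by
  rw [Lp.edist_def]
  refine le_trans (le_of_eq (eLpNorm_congr_ae ?_)) h
  filter_upwards [ha, hb] with x hx hy
  simp [hx, hy]

lemma graph_mem {K : ℕ} {v : ℝ → ℝ} {q : ℕ → ℝ}
    (hv : ContDiff ℝ K v) (hvpos : ∀ ξ, 0 < v ξ)
    (A₀ : Lp ℂ 2 (volume : Measure ℝ) →ₗ.[ℂ] Lp ℂ 2 (volume : Measure ℝ))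
    (hdom : ∀ F : Lp ℂ 2 (volume : Measure ℝ), F ∈ A₀.domain ↔
      ∃ g : ℝ → ℂ, ContDiff ℝ K g ∧ HasCompactSupport g ∧ ⇑F =ᵐ[volume] g)
    (hact : ∀ (F : A₀.domain) (g : ℝ → ℂ), ContDiff ℝ K g → HasCompactSupport g →
      ⇑(F : Lp ℂ 2 (volume : Measure ℝ)) =ᵐ[volume] g →
      ⇑(A₀ F) =ᵐ[volume]
        fun ξ => (v ξ : ℂ) * QD K q (fun η => (v η : ℂ) * g η) ξ)
    {φ : ℝ → ℂ} (hφ : ContDiff ℝ K φ) (hφc : HasCompactSupport φ) :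
    ∃ x : A₀.domain, ⇑(x : Lp ℂ 2 (volume : Measure ℝ)) =ᵐ[volume] (fun ξ => (v ξ)⁻¹ • φ ξ) ∧
      ⇑(A₀ x) =ᵐ[volume] fun ξ => v ξ • QD K q φ ξ := by
  have hg : ContDiff ℝ K (fun ξ => (v ξ)⁻¹ • φ ξ) :=
    (hv.inv fun x => (hvpos x).ne').smul hφ
  have hgc : HasCompactSupport (fun ξ => (v ξ)⁻¹ • φ ξ) := hφc.mono fun x hx => by
    rw [Function.mem_support] at hx ⊢
    intro h
    exact hx (by rw [h, smul_zero])
  have hm : MemLp (fun ξ => (v ξ)⁻¹ • φ ξ) 2 volume :=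
    hg.continuous.memLp_of_hasCompactSupport hgc
  have hd : hm.toLp ∈ A₀.domain := (hdom _).2 ⟨_, hg, hgc, hm.coeFn_toLp⟩
  refine ⟨⟨hm.toLp, hd⟩, hm.coeFn_toLp, ?_⟩
  have := hact ⟨hm.toLp, hd⟩ _ hg hgc hm.coeFn_toLp
  have e : (fun η => (v η : ℂ) * ((v η)⁻¹ • φ η)) = φ := by
    ext η
    rw [← Complex.real_smul, smul_smul, mul_inv_cancel₀ (hvpos η).ne', one_smul]
  rw [e] at this
  simpa only [Complex.real_smul] using this

lemma growth_one {v : ℝ → ℝ} (hv : Differentiable ℝ v) (hpos : ∀ x, 0 < v x) {C : ℝ}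
    (h : ∀ x, |deriv v x| ≤ C * v x) :
    (∀ x t, |t| ≤ 1 → v x ≤ exp C * v (x - t)) ∧
    (∀ x t, |t| ≤ 1 → (v x)⁻¹ ≤ exp C * (v (x - t))⁻¹) := by
  have hC : 0 ≤ C := nonneg_of_mul_nonneg_left ((abs_nonneg _).trans (h 0)) (hpos 0)
  have key : ∀ x y, |x - y| ≤ 1 → v x ≤ exp C * v y := fun x y hxy =>
    (growth hv hpos h x y).trans (mul_le_mul_of_nonneg_right
      (exp_le_exp.2 (mul_le_of_le_one_right hC hxy)) (hpos y).le)
  refine ⟨fun x t ht => key x (x - t) (by simpa using ht), fun x t ht => ?_⟩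
  have h1 := key (x - t) x (by simpa using ht)
  rw [← div_eq_mul_inv, le_div_iff₀ (hpos _), inv_mul_le_iff₀ (hpos _), mul_comm]
  exact h1

end VQDV

/-- Let `v ∈ C^K(ℝ)` be bounded, positive and satisfy `|v'| ≤ C v`, and let
`Q(x) = ∑_{k=0}^K q_k x^k` be a real polynomial with `q_K ≠ 0`, `K ≥ 1`.  The operator
`A₀ g = v Q(D)(v g)` in `L²(ℝ)`, with domain the (classes of) functions of class `C_c^K(ℝ)`,
is densely defined, symmetric, and essentially self-adjoint: its closure equals its adjoint
and is self-adjoint. -/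
theorem vQDv_essentially_selfAdjoint
    (K : ℕ) (hK : 1 ≤ K) (v : ℝ → ℝ) (q : ℕ → ℝ)
    (hv : ContDiff ℝ K v) (hvbdd : ∃ M : ℝ, ∀ ξ, v ξ ≤ M) (hvpos : ∀ ξ, 0 < v ξ)
    (C : ℝ) (hv' : ∀ ξ, |deriv v ξ| ≤ C * v ξ)
    (hqK : q K ≠ 0)
    (A₀ : Lp ℂ 2 (volume : Measure ℝ) →ₗ.[ℂ] Lp ℂ 2 (volume : Measure ℝ))
    (hdom : ∀ F : Lp ℂ 2 (volume : Measure ℝ), F ∈ A₀.domain ↔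
      ∃ g : ℝ → ℂ, ContDiff ℝ K g ∧ HasCompactSupport g ∧ ⇑F =ᵐ[volume] g)
    (hact : ∀ (F : A₀.domain) (g : ℝ → ℂ), ContDiff ℝ K g → HasCompactSupport g →
      ⇑(F : Lp ℂ 2 (volume : Measure ℝ)) =ᵐ[volume] g →
      ⇑(A₀ F) =ᵐ[volume]
        fun ξ => (v ξ : ℂ) * QD K q (fun η => (v η : ℂ) * g η) ξ) :
    Dense (A₀.domain : Set (Lp ℂ 2 (volume : Measure ℝ)))
      ∧ (∀ x y : A₀.domain,
          inner (𝕜 := ℂ) (A₀ x) ((y : Lp ℂ 2 (volume : Measure ℝ)))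
            = inner (𝕜 := ℂ) ((x : Lp ℂ 2 (volume : Measure ℝ))) (A₀ y))
      ∧ A₀.closure = A₀.adjoint
      ∧ IsSelfAdjoint A₀.closure := by
  classical
  have hvc : Continuous v := hv.continuous
  have hvd : Differentiable ℝ v := hv.differentiable (by
    have : K ≠ 0 := by omega
    exact_mod_cast this)
  have hvC : ContDiff ℝ K (fun η => (v η : ℂ)) := Complex.ofRealCLM.contDiff.comp hv
  have hdense : Dense (A₀.domain : Set (Lp ℂ 2 (volume : Measure ℝ))) := by
    refine (MeasureTheory.Lp.dense_hasCompactSupport_contDiff (E := ℝ) (F := ℂ) (μ := volume)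
      (p := 2) (by norm_num)).mono ?_
    rintro F ⟨g, hFg, hgc, hg⟩
    exact (hdom F).2 ⟨g, hg.of_le (by exact_mod_cast le_top), hgc, hFg⟩
  have hsymm : ∀ x y : A₀.domain,
      inner (𝕜 := ℂ) (A₀ x) ((y : Lp ℂ 2 (volume : Measure ℝ)))
        = inner (𝕜 := ℂ) ((x : Lp ℂ 2 (volume : Measure ℝ))) (A₀ y) := by
    intro x y
    obtain ⟨g, hg, hgc, hxg⟩ := (hdom x).1 x.2
    obtain ⟨k, hk, hkc, hyk⟩ := (hdom y).1 y.2
    rw [VQDV.inner_ae (hact x g hg hgc hxg) hyk, VQDV.inner_ae hxg (hact y k hk hkc hyk)]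
    have h := VQDV.QD_symm (q := q) (hvC.mul hg) (hvC.mul hk) hgc.mul_left hkc.mul_left
    calc _ = ∫ x, ((v x : ℂ) * k x) * starRingEnd ℂ (QD K q (fun η => (v η : ℂ) * g η) x) := by
          refine integral_congr_ae (ae_of_all _ fun x => ?_)
          simp only [map_mul, Complex.conj_ofReal]; ring
      _ = ∫ x, QD K q (fun η => (v η : ℂ) * k η) x * starRingEnd ℂ ((v x : ℂ) * g x) := h
      _ = _ := by
          refine integral_congr_ae (ae_of_all _ fun x => ?_)
          simp only [map_mul, Complex.conj_ofReal]; ring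
  refine ⟨hdense, hsymm, VQDV.esa A₀ hdense hsymm fun y => ?_⟩
  obtain ⟨M, hM⟩ := hvbdd
  obtain ⟨hg1, hg2⟩ := VQDV.growth_one hvd hvpos hv'
  obtain ⟨f, hfdef⟩ : ∃ f : ℝ → ℂ, f = ⇑(y : Lp ℂ 2 (volume : Measure ℝ)) := ⟨_, rfl⟩
  obtain ⟨h, hhdef⟩ : ∃ h : ℝ → ℂ, h = ⇑(A₀.adjoint y) := ⟨_, rfl⟩
  have hf2 : MemLp f 2 volume := hfdef ▸ Lp.memLp _
  have hh2 : MemLp h 2 volume := hhdef ▸ Lp.memLp _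
  obtain ⟨u, hu⟩ : ∃ u : ℝ → ℂ, ∀ x, u x = v x • f x := ⟨_, fun _ => rfl⟩
  obtain ⟨s, hs⟩ : ∃ s : ℝ → ℂ, ∀ x, s x = (v x)⁻¹ • h x := ⟨_, fun _ => rfl⟩
  obtain ⟨Wi, hWi⟩ : ∃ Wi : ℝ → ℝ, ∀ x, Wi x = (v x)⁻¹ := ⟨_, fun _ => rfl⟩
  have huf : (fun x => Wi x • u x) = f := by
    ext x; rw [hWi, hu, smul_smul, inv_mul_cancel₀ (hvpos x).ne', one_smul]
  have hsh : (fun x => v x • s x) = h := by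
    ext x; rw [hs, smul_smul, mul_inv_cancel₀ (hvpos x).ne', one_smul]
  have hWip : ∀ x, 0 < Wi x := fun x => by rw [hWi]; exact inv_pos.2 (hvpos x)
  have hWic : Continuous Wi := by
    rw [show Wi = fun x => (v x)⁻¹ from funext hWi]
    exact hvc.inv₀ fun x => (hvpos x).ne'
  have hvWi : ∀ x, v x ≤ M ^ 2 * Wi x := by
    intro x
    rw [hWi, ← div_eq_mul_inv, le_div_iff₀ (hvpos x), ← sq]
    exact pow_le_pow_left₀ (hvpos x).le (hM x) 2
  have hweak : ∀ φ : ℝ → ℂ, ContDiff ℝ K φ → HasCompactSupport φ →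
      ∫ x, QD K q φ x * starRingEnd ℂ (u x) = ∫ x, φ x * starRingEnd ℂ (s x) := by
    intro φ hφ hφc
    obtain ⟨z, hz1, hz2⟩ := VQDV.graph_mem hv hvpos A₀ hdom hact hφ hφc
    have hadj := A₀.adjoint_isFormalAdjoint hdense y z
    rw [VQDV.inner_ae (Filter.EventuallyEq.of_eq hhdef.symm) hz1,
      VQDV.inner_ae (Filter.EventuallyEq.of_eq hfdef.symm) hz2] at hadj
    calc _ = ∫ x, (v x • QD K q φ x) * starRingEnd ℂ (f x) := by
          refine integral_congr_ae (ae_of_all _ fun x => ?_)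
          simp only [hu, Complex.real_smul, map_mul, Complex.conj_ofReal]; ring
      _ = ∫ x, ((v x)⁻¹ • φ x) * starRingEnd ℂ (h x) := hadj.symm
      _ = _ := by
          refine integral_congr_ae (ae_of_all _ fun x => ?_)
          simp only [hs, Complex.real_smul, map_mul, Complex.conj_ofReal]; ring
  rw [EMetric.mem_closure_iff]
  intro ε hε
  obtain ⟨δ, hδ0, hδε⟩ := exists_between hε
  obtain ⟨φ, hφ, hφc, h1, h2⟩ := VQDV.approx (q := q) (exp_pos C).le hvpos hvc hg1 hWip hWic
    (fun x t ht => by rw [hWi, hWi]; exact hg2 x t ht) hvWi (by rw [huf]; exact hf2)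
    (by rw [hsh]; exact hh2) hweak hδ0.ne'
  obtain ⟨z, hz1, hz2⟩ := VQDV.graph_mem hv hvpos A₀ hdom hact hφ hφc
  refine ⟨((z : Lp ℂ 2 (volume : Measure ℝ)), A₀ z), LinearPMap.mem_graph _ z, ?_⟩
  rw [edist_comm]
  refine lt_of_le_of_lt ?_ hδε
  rw [Prod.edist_eq]
  refine max_le ?_ ?_
  · refine VQDV.edist_le_ae (hz1.trans (Filter.EventuallyEq.of_eq ?_))
      (Filter.EventuallyEq.of_eq (hfdef.symm.trans huf.symm)) h1
    ext x; rw [hWi]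
  · exact VQDV.edist_le_ae hz2 (Filter.EventuallyEq.of_eq (hhdef.symm.trans hsh.symm)) h2
end

section
/- Let K ≥ 2 be even, let P(x) = Σ_{k=0}^K p_k x^k have real coefficients with p_K > 0, let h(t) = P(ln t)·t^{-1}, and define ω(z) = 1/Γ(1−z), q_k = Σ_{ℓ=k}^K binom(ℓ,k) ω^{(ℓ−k)}(0) p_ℓ, Q(x) = Σ_{k=0}^K q_k x^k. Then the following are equivalent: (i) ∫_0^∞ ∫_0^∞ h(t+s) f(s) conj(f(t)) ds dt ≥ 0 for every f ∈ 𝒟_0; (ii) Q(x) ≥ 0 for all x ∈ ℝ. -/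
open MeasureTheory Real Set ComplexConjugate
open scoped ComplexOrder

/-- `ω(z) = 1/Γ(1−z)`. -/
noncomputable def omegaGamma : ℂ → ℂ := fun z => (Complex.Gamma (1 - z))⁻¹

/-- The real kernel `h(t) = P(ln t) t⁻¹` where `P(x) = ∑_{k=0}^K p_k x^k`. -/
noncomputable def hankelLogKernelR (K : ℕ) (p : ℕ → ℝ) (t : ℝ) : ℝ :=
  (∑ k ∈ Finset.range (K + 1), p k * (Real.log t) ^ k) / t


open ProbabilityTheory Filter Topology

/-- The measure `e^{-tλ} dλ` on `(0,∞)`. -/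
noncomputable def expMeas (t : ℝ) : Measure ℝ :=
  (volume.restrict (Ioi (0 : ℝ))).withDensity (fun l => ENNReal.ofReal (Real.exp (-(t * l))))

lemma expMeas_integrable_iff {E : Type*} [NormedAddCommGroup E] [NormedSpace ℝ E]
    (t : ℝ) (g : ℝ → E) :
    Integrable g (expMeas t) ↔ IntegrableOn (fun l => Real.exp (-(t * l)) • g l) (Ioi 0) := by
  unfold expMeas
  rw [integrable_withDensity_iff_integrable_smul' (by fun_prop) (by simp)]
  simp only [ENNReal.toReal_ofReal (Real.exp_pos _).le, IntegrableOn]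

lemma expMeas_integral {E : Type*} [NormedAddCommGroup E] [NormedSpace ℝ E]
    (t : ℝ) (g : ℝ → E) :
    ∫ l, g l ∂(expMeas t) = ∫ l in Ioi 0, Real.exp (-(t * l)) • g l := by
  unfold expMeas
  rw [integral_withDensity_eq_integral_toReal_smul (by fun_prop) (by simp)]
  simp only [ENNReal.toReal_ofReal (Real.exp_pos _).le]

lemma expMeas_mem_set {t : ℝ} (ht : 0 < t) {z : ℝ} (hz : z < 1) :
    z ∈ integrableExpSet (fun l => -Real.log l) (expMeas t) := by
  change Integrable _ _
  rw [expMeas_integrable_iff]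
  have h := integrableOn_rpow_mul_exp_neg_mul_rpow (p := 1) (s := -z) (b := t)
    (by linarith) one_pos ht
  refine h.congr_fun (fun l hl => ?_) measurableSet_Ioi
  have hl : 0 < l := hl
  simp only [Real.rpow_one, smul_eq_mul]
  rw [Real.rpow_def_of_pos hl, mul_comm]
  congr 2 <;> ring_nf

lemma expMeas_interior {t : ℝ} (ht : 0 < t) :
    (0 : ℝ) ∈ interior (integrableExpSet (fun l => -Real.log l) (expMeas t)) := by
  rw [mem_interior]
  exact ⟨Iio 1, fun z hz => expMeas_mem_set ht hz, isOpen_Iio, by simp⟩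

lemma log_pow_integrable {t : ℝ} (ht : 0 < t) (k : ℕ) :
    IntegrableOn (fun l => Real.exp (-(t * l)) * |Real.log l| ^ k) (Ioi 0) := by
  have := integrable_pow_abs_of_mem_interior_integrableExpSet (expMeas_interior ht) k
  rw [expMeas_integrable_iff] at this
  simpa using this

lemma complexMGF_eq {t : ℝ} (ht : 0 < t) {z : ℂ} (hz : z.re < 1) :
    complexMGF (fun l => -Real.log l) (expMeas t) z
      = (t : ℂ)⁻¹ * Complex.exp (Real.log t * z) * Complex.Gamma (1 - z) := by
  have h := Complex.integral_cpow_mul_exp_neg_mul_Ioi (a := 1 - z) (r := t)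
    (by simp; linarith) ht
  rw [complexMGF, expMeas_integral]
  have htc : (t : ℂ) ≠ 0 := by exact_mod_cast ht.ne'
  have e : (1 / (t : ℂ)) ^ (1 - z) = (t : ℂ)⁻¹ * Complex.exp (Real.log t * z) := by
    rw [one_div, Complex.inv_cpow _ _ (by
      rw [Complex.arg_ofReal_of_nonneg ht.le]; exact Real.pi_pos.ne), Complex.cpow_sub _ _ htc,
      Complex.cpow_one, Complex.cpow_def_of_ne_zero htc, Complex.ofReal_log ht.le]
    field_simp
  rw [← e, ← h]
  refine setIntegral_congr_fun measurableSet_Ioi (fun l hl => ?_)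
  have hl : 0 < l := hl
  have hlc : (l : ℂ) ≠ 0 := by exact_mod_cast hl.ne'
  simp only [Complex.real_smul]
  rw [Complex.cpow_def_of_ne_zero hlc, ← Complex.ofReal_log hl.le, mul_comm]
  push_cast
  congr 2
  ring

lemma log_pow_div_eq {t : ℝ} (ht : 0 < t) (n : ℕ) :
    ((Real.log t : ℂ)) ^ n / t = ∑ i ∈ Finset.range (n + 1),
      (n.choose i : ℂ) * iteratedDeriv i omegaGamma 0 *
        ∫ l in Ioi (0 : ℝ), (Real.exp (-(t * l)) : ℂ) * (-(Real.log l : ℂ)) ^ (n - i) := by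
  have hmemInt := expMeas_interior ht
  have hω : Differentiable ℂ omegaGamma :=
    Complex.differentiable_one_div_Gamma.comp (by fun_prop : Differentiable ℂ fun z : ℂ => 1 - z)
  have hF : AnalyticAt ℂ (complexMGF (fun l => -Real.log l) (expMeas t)) 0 :=
    analyticAt_complexMGF (by simpa using hmemInt)
  have h1 := iteratedDeriv_mul (n := n) (hω.contDiff.contDiffAt (x := 0)) (hF.contDiffAt)
  have h2 : (omegaGamma * complexMGF (fun l => -Real.log l) (expMeas t))
      =ᶠ[𝓝 0] fun z => (t : ℂ)⁻¹ * Complex.exp (Real.log t * z) := by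
    have : ∀ᶠ z : ℂ in 𝓝 0, z.re < 1 := by
      apply (isOpen_lt Complex.continuous_re continuous_const).mem_nhds
      simp
    filter_upwards [this] with z hz
    have : Complex.Gamma (1 - z) ≠ 0 := Complex.Gamma_ne_zero_of_re_pos (by simp; linarith)
    simp only [Pi.mul_apply, complexMGF_eq ht hz, omegaGamma]
    field_simp
  rw [h2.iteratedDeriv_eq, iteratedDeriv_const_mul_field, iteratedDeriv_cexp_const_mul] at h1
  simp only [mul_zero, Complex.exp_zero, mul_one] at h1
  rw [div_eq_inv_mul, h1]
  refine Finset.sum_congr rfl fun i _ => ?_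
  rw [iteratedDeriv_complexMGF (by simpa using hmemInt), expMeas_integral]
  simp

/-- The polynomial `Q`. -/
noncomputable def Qpoly (K : ℕ) (q : ℕ → ℂ) (x : ℝ) : ℂ :=
  ∑ k ∈ Finset.range (K + 1), q k * (x : ℂ) ^ k

lemma Qpoly_continuous (K : ℕ) (q : ℕ → ℂ) : Continuous (Qpoly K q) := by
  unfold Qpoly; fun_prop

lemma Qpoly_bound (K : ℕ) (q : ℕ → ℂ) (x : ℝ) :
    ‖Qpoly K q x‖ ≤ (∑ k ∈ Finset.range (K + 1), ‖q k‖) * (1 + |x|) ^ K := by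
  unfold Qpoly
  refine (norm_sum_le _ _).trans ?_
  rw [Finset.sum_mul]
  refine Finset.sum_le_sum fun k hk => ?_
  rw [norm_mul, norm_pow, Complex.norm_real, Real.norm_eq_abs]
  gcongr
  have hk : k ≤ K := by simpa [Nat.lt_succ_iff] using hk
  calc |x| ^ k ≤ (1 + |x|) ^ k := by gcongr; linarith
    _ ≤ (1 + |x|) ^ K := pow_le_pow_right₀ (by linarith [abs_nonneg x]) hk

lemma one_add_log_integrable {t : ℝ} (ht : 0 < t) (K : ℕ) :
    IntegrableOn (fun l => Real.exp (-(t * l)) * (1 + |Real.log l|) ^ K) (Ioi 0) := by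
  simp_rw [add_comm (1 : ℝ), add_pow, Finset.mul_sum]
  refine integrable_finsetSum _ fun k _ => ?_
  refine ((log_pow_integrable ht k).mul_const (K.choose k : ℝ)).congr ?_
  refine Eventually.of_forall fun l => ?_
  simp; ring

lemma neg_log_pow_integrable {t : ℝ} (ht : 0 < t) (k : ℕ) :
    IntegrableOn (fun l => (Real.exp (-(t * l)) : ℂ) * (-(Real.log l : ℂ)) ^ k) (Ioi 0) := by
  refine (log_pow_integrable ht k).mono' ?_ ?_
  · exact (by fun_prop : Measurable _).aestronglyMeasurable
  · refine Eventually.of_forall fun l => ?_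
    rw [norm_mul, norm_pow, norm_neg, Complex.norm_real, Complex.norm_real, Real.norm_eq_abs,
      Real.norm_eq_abs, abs_of_pos (Real.exp_pos _)]

lemma kernel_eq (K : ℕ) (p : ℕ → ℝ) (q : ℕ → ℂ)
    (hq : ∀ k, q k = ∑ ℓ ∈ Finset.Icc k K,
      (ℓ.choose k : ℂ) * iteratedDeriv (ℓ - k) omegaGamma 0 * (p ℓ : ℂ))
    {t : ℝ} (ht : 0 < t) :
    (hankelLogKernelR K p t : ℂ)
      = ∫ l in Ioi (0 : ℝ), (Real.exp (-(t * l)) : ℂ) * Qpoly K q (-Real.log l) := by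
  have h1 : ∫ l in Ioi (0 : ℝ), (Real.exp (-(t * l)) : ℂ) * Qpoly K q (-Real.log l)
      = ∑ k ∈ Finset.range (K + 1), q k *
        ∫ l in Ioi (0 : ℝ), (Real.exp (-(t * l)) : ℂ) * (-(Real.log l : ℂ)) ^ k := by
    simp_rw [← integral_const_mul]
    rw [← integral_finsetSum _ fun k _ => (neg_log_pow_integrable ht k).const_mul _]
    refine integral_congr_ae (Eventually.of_forall fun l => ?_)
    simp only [Qpoly, Finset.mul_sum]
    refine Finset.sum_congr rfl fun k _ => ?_
    push_cast; ring
  have h2 : ∀ n : ℕ, ((Real.log t : ℂ)) ^ n / t = ∑ k ∈ Finset.range (n + 1),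
      (n.choose k : ℂ) * iteratedDeriv (n - k) omegaGamma 0 *
        ∫ l in Ioi (0 : ℝ), (Real.exp (-(t * l)) : ℂ) * (-(Real.log l : ℂ)) ^ k := by
    intro n
    rw [log_pow_div_eq ht n, ← Finset.sum_range_reflect]
    refine Finset.sum_congr rfl fun k hk => ?_
    have hk : k ≤ n := by simpa [Nat.lt_succ_iff] using hk
    have e1 : n + 1 - 1 - k = n - k := by omega
    have e2 : n - (n - k) = k := by omega
    rw [e1, e2, Nat.choose_symm hk]
  rw [h1]
  unfold hankelLogKernelR
  rw [Complex.ofReal_div, Complex.ofReal_sum, Finset.sum_div]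
  simp only [Complex.ofReal_mul, Complex.ofReal_pow]
  simp_rw [mul_div_assoc, h2, hq, Finset.mul_sum, Finset.sum_mul]
  rw [Finset.sum_comm' (s := Finset.range (K + 1)) (t' := Finset.range (K + 1))
    (s' := fun k => Finset.Icc k K)]
  · refine Finset.sum_congr rfl fun k _ => Finset.sum_congr rfl fun n _ => ?_
    ring
  · intro x y
    simp only [Finset.mem_range, Finset.mem_Icc]
    omega

lemma log_integral_bound {T : ℝ} (hT : 0 < T) (K : ℕ) :
    ∫ l in Ioi (0 : ℝ), Real.exp (-(T * l)) * (1 + |Real.log l|) ^ K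
      ≤ (∫ l in Ioi (0 : ℝ), Real.exp (-l) * (1 + |Real.log l|) ^ K)
        * ((1 + |Real.log T|) ^ K * T⁻¹) := by
  have hs := integral_comp_mul_left_Ioi
    (fun u => Real.exp (-u) * (1 + |Real.log u|) ^ K) 0 hT
  have hI : IntegrableOn (fun u => Real.exp (-u) * (1 + |Real.log u|) ^ K) (Ioi 0) := by
    simpa using one_add_log_integrable one_pos K
  have hI' : IntegrableOn
      (fun l => Real.exp (-(T * l)) * (1 + |Real.log (T * l)|) ^ K) (Ioi 0) := by
    have := (integrableOn_Ioi_comp_mul_left_iff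
      (fun u => Real.exp (-u) * (1 + |Real.log u|) ^ K) 0 hT).2 (by simpa using hI)
    exact this
  rw [mul_zero, smul_eq_mul] at hs
  calc _ ≤ ∫ l in Ioi (0 : ℝ), (1 + |Real.log T|) ^ K *
          (Real.exp (-(T * l)) * (1 + |Real.log (T * l)|) ^ K) := by
        refine setIntegral_mono_on (one_add_log_integrable hT K) (hI'.const_mul _)
          measurableSet_Ioi fun l hl => ?_
        have hl : 0 < l := hl
        have : 1 + |Real.log l| ≤ (1 + |Real.log T|) * (1 + |Real.log (T * l)|) := by
          have e : Real.log l = Real.log (T * l) - Real.log T := by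
            rw [Real.log_mul hT.ne' hl.ne']; ring
          have := abs_sub (Real.log (T * l)) (Real.log T)
          rw [← e] at this
          nlinarith [mul_nonneg (abs_nonneg (Real.log (T * l))) (abs_nonneg (Real.log T))]
        have h3 := pow_le_pow_left₀ (by positivity) this K
        rw [mul_pow] at h3
        have := mul_le_mul_of_nonneg_left h3 (Real.exp_pos (-(T * l))).le
        linarith
    _ = _ := by
        rw [integral_const_mul, hs]; ring

lemma log_weight_integrable {r : ℝ} (hr : 1 < r) :
    IntegrableOn (fun t : ℝ => t⁻¹ * (1 + |Real.log t|) ^ (-r)) (Ioi 0) := by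
  have h : Integrable (fun x : ℝ => (1 + ‖x‖) ^ (-r)) := integrable_one_add_norm (by simpa using hr)
  have h2 := integrableOn_image_iff_integrableOn_abs_deriv_smul (MeasurableSet.univ)
    (fun x _ => (Real.hasDerivAt_exp x).hasDerivWithinAt) (Real.exp_injective.injOn)
    (fun t : ℝ => t⁻¹ * (1 + |Real.log t|) ^ (-r))
  rw [image_univ, Real.range_exp] at h2
  rw [h2, integrableOn_univ]
  refine h.congr (Eventually.of_forall fun x => ?_)
  simp [abs_of_pos (Real.exp_pos x)]

lemma pair_bound {t s : ℝ} (ht : 0 < t) (hs : 0 < s) (K : ℕ) (n : ℝ) :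
    (t ^ (-(1 : ℝ) / 2) * (1 + |Real.log t|) ^ (-n)) *
      (s ^ (-(1 : ℝ) / 2) * (1 + |Real.log s|) ^ (-n)) *
      ((1 + |Real.log (t + s)|) ^ K * (t + s)⁻¹)
    ≤ 2 ^ K * ((t⁻¹ * (1 + |Real.log t|) ^ (-(n - K))) *
      (s⁻¹ * (1 + |Real.log s|) ^ (-(n - K)))) := by
  have hw : ∀ u : ℝ, 0 < u → u⁻¹ * (1 + |Real.log u|) ^ (-(n - K)) =
      (u ^ (-(1 : ℝ) / 2) * (1 + |Real.log u|) ^ (-n)) *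
        (u ^ (-(1 : ℝ) / 2) * (1 + |Real.log u|) ^ K) := by
    intro u hu
    have hp : 0 < 1 + |Real.log u| := by positivity
    have e1 : u⁻¹ = u ^ (-(1 : ℝ) / 2) * u ^ (-(1 : ℝ) / 2) := by
      rw [← Real.rpow_add hu, ← Real.rpow_neg_one]; norm_num
    have e2 : (1 + |Real.log u|) ^ (-(n - K)) =
        (1 + |Real.log u|) ^ (-n) * (1 + |Real.log u|) ^ K := by
      rw [← Real.rpow_natCast, ← Real.rpow_add hp]; congr 1; ring
    rw [e2]; nth_rewrite 1 [e1]; ring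
  have hlog : 1 + |Real.log (t + s)| ≤ 2 * ((1 + |Real.log t|) * (1 + |Real.log s|)) := by
    have hlog2 : Real.log 2 ≤ 1 := by linarith [Real.log_two_lt_d9]
    have key : |Real.log (t + s)| ≤ 1 + |Real.log t| + |Real.log s| := by
      wlog hts : t ≤ s generalizing t s
      · have := this hs ht (le_of_not_ge hts)
        rw [add_comm s t] at this
        linarith
      rw [abs_le]
      constructor
      · have : Real.log s ≤ Real.log (t + s) := Real.log_le_log hs (by linarith)
        linarith [neg_abs_le (Real.log s), abs_nonneg (Real.log t)]
      · have : Real.log (t + s) ≤ Real.log (2 * s) := Real.log_le_log (by linarith) (by linarith)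
        rw [Real.log_mul two_ne_zero hs.ne'] at this
        linarith [le_abs_self (Real.log s), abs_nonneg (Real.log t)]
    nlinarith [mul_nonneg (abs_nonneg (Real.log t)) (abs_nonneg (Real.log s)),
      abs_nonneg (Real.log t), abs_nonneg (Real.log s)]
  have hinv : (t + s)⁻¹ ≤ t ^ (-(1 : ℝ) / 2) * s ^ (-(1 : ℝ) / 2) := by
    have e : ∀ u : ℝ, 0 < u → u ^ (-(1 : ℝ) / 2) = (√u)⁻¹ := fun u hu => by
      rw [Real.sqrt_eq_rpow, ← Real.rpow_neg hu.le]; norm_num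
    rw [e t ht, e s hs, ← mul_inv]
    have h1 := Real.sqrt_pos.2 ht
    have h2 := Real.sqrt_pos.2 hs
    apply inv_anti₀ (by positivity)
    nlinarith [Real.sq_sqrt ht.le, Real.sq_sqrt hs.le, sq_nonneg (√t - √s)]
  have hpow := pow_le_pow_left₀ (by positivity) hlog K
  rw [hw t ht, hw s hs]
  calc _ ≤ (t ^ (-(1 : ℝ) / 2) * (1 + |Real.log t|) ^ (-n)) *
      (s ^ (-(1 : ℝ) / 2) * (1 + |Real.log s|) ^ (-n)) *
      ((2 * ((1 + |Real.log t|) * (1 + |Real.log s|))) ^ K *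
        (t ^ (-(1 : ℝ) / 2) * s ^ (-(1 : ℝ) / 2))) := by
        gcongr
    _ = _ := by rw [mul_pow, mul_pow]; ring

/-- Laplace transform. -/
noncomputable def lapl (f : ℝ → ℂ) (l : ℝ) : ℂ :=
  ∫ t in Ioi (0 : ℝ), (Real.exp (-(t * l)) : ℂ) * f t

lemma triple_integrable (K : ℕ) (q : ℕ → ℂ) (f : ℝ → ℂ) (hf : Measurable f)
    {C n : ℝ} (hn : (K : ℝ) + 1 < n)
    (hC : ∀ t ∈ Ioi (0 : ℝ), ‖f t‖ ≤ C * t ^ (-(1 : ℝ) / 2) * (1 + |Real.log t|) ^ (-n)) :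
    Integrable (fun x : (ℝ × ℝ) × ℝ =>
      (Real.exp (-((x.1.1 + x.1.2) * x.2)) : ℂ) * Qpoly K q (-Real.log x.2) * f x.1.2 *
        conj (f x.1.1))
      (((volume.restrict (Ioi (0 : ℝ))).prod (volume.restrict (Ioi (0 : ℝ)))).prod
        (volume.restrict (Ioi (0 : ℝ)))) := by
  have hQm : Measurable (Qpoly K q) := (Qpoly_continuous K q).measurable
  have hmeas : Measurable (fun x : (ℝ × ℝ) × ℝ =>
      (Real.exp (-((x.1.1 + x.1.2) * x.2)) : ℂ) * Qpoly K q (-Real.log x.2) * f x.1.2 *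
        conj (f x.1.1)) := by
    have hc : Measurable (fun z : ℂ => conj z) := Complex.continuous_conj.measurable
    have h2 : Measurable (fun x : (ℝ × ℝ) × ℝ => conj (f x.1.1)) := by
      exact hc.comp (hf.comp (by fun_prop))
    fun_prop
  have hmem : ∀ᵐ x : ℝ × ℝ ∂((volume.restrict (Ioi (0 : ℝ))).prod (volume.restrict (Ioi (0 : ℝ)))),
      0 < x.1 ∧ 0 < x.2 := by
    rw [Measure.prod_restrict]
    filter_upwards [ae_restrict_mem (measurableSet_Ioi.prod measurableSet_Ioi)] with x hx
    exact hx
  set A := ∑ k ∈ Finset.range (K + 1), ‖q k‖ with hA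
  have hA0 : 0 ≤ A := Finset.sum_nonneg fun _ _ => norm_nonneg _
  set M := ∫ l in Ioi (0 : ℝ), Real.exp (-l) * (1 + |Real.log l|) ^ K with hM
  have hM0 : 0 ≤ M := integral_nonneg fun l => by positivity
  have hnorm : ∀ t s l : ℝ, ‖(Real.exp (-((t + s) * l)) : ℂ) * Qpoly K q (-Real.log l) * f s *
        conj (f t)‖ ≤ (A * ‖f s‖ * ‖f t‖) *
          (Real.exp (-((t + s) * l)) * (1 + |Real.log l|) ^ K) := by
    intro t s l
    rw [norm_mul, norm_mul, norm_mul, RCLike.norm_conj, Complex.norm_real, Real.norm_eq_abs,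
      abs_of_pos (Real.exp_pos _)]
    have := Qpoly_bound K q (-Real.log l)
    rw [abs_neg] at this
    calc _ ≤ Real.exp (-((t + s) * l)) * (A * (1 + |Real.log l|) ^ K) * ‖f s‖ * ‖f t‖ := by
          gcongr
      _ = _ := by ring
  have hsectInt : ∀ t s : ℝ, 0 < t → 0 < s → IntegrableOn (fun l =>
      (Real.exp (-((t + s) * l)) : ℂ) * Qpoly K q (-Real.log l) * f s * conj (f t)) (Ioi 0) := by
    intro t s ht hs
    refine ((one_add_log_integrable (add_pos ht hs) K).const_mul (A * ‖f s‖ * ‖f t‖)).mono' ?_ ?_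
    · exact (hmeas.comp (measurable_prodMk_left (x := (t, s)))).aestronglyMeasurable
    · exact Eventually.of_forall fun l => hnorm t s l
  rw [integrable_prod_iff hmeas.aestronglyMeasurable]
  constructor
  · filter_upwards [hmem] with x hx
    exact hsectInt x.1 x.2 hx.1 hx.2
  · have hw := log_weight_integrable (r := n - K) (by linarith)
    refine ((hw.mul_prod hw).const_mul (A * M * (|C| * |C|) * 2 ^ K)).mono' ?_ ?_
    · exact hmeas.norm.aestronglyMeasurable.integral_prod_right'
    · filter_upwards [hmem] with x hx
      obtain ⟨t, s⟩ := x
      obtain ⟨ht, hs⟩ := hx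
      simp only at ht hs ⊢
      have hT := add_pos ht hs
      have hC' : ∀ u : ℝ, 0 < u →
          ‖f u‖ ≤ |C| * (u ^ (-(1 : ℝ) / 2) * (1 + |Real.log u|) ^ (-n)) := fun u hu => by
        refine (hC u hu).trans ?_
        rw [mul_assoc]
        gcongr
        exact le_abs_self C
      rw [Real.norm_eq_abs, abs_of_nonneg (integral_nonneg fun _ => norm_nonneg _)]
      calc _ ≤ ∫ l in Ioi (0 : ℝ), (A * ‖f s‖ * ‖f t‖) *
          (Real.exp (-((t + s) * l)) * (1 + |Real.log l|) ^ K) :=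
            integral_mono (hsectInt t s ht hs).norm
              ((one_add_log_integrable hT K).const_mul _) fun l => hnorm t s l
        _ ≤ (A * ‖f s‖ * ‖f t‖) * (M * ((1 + |Real.log (t + s)|) ^ K * (t + s)⁻¹)) := by
            rw [integral_const_mul]
            exact mul_le_mul_of_nonneg_left (log_integral_bound hT K) (by positivity)
        _ ≤ (A * (|C| * (s ^ (-(1 : ℝ) / 2) * (1 + |Real.log s|) ^ (-n))) *
              (|C| * (t ^ (-(1 : ℝ) / 2) * (1 + |Real.log t|) ^ (-n)))) *
              (M * ((1 + |Real.log (t + s)|) ^ K * (t + s)⁻¹)) := by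
            gcongr
            · exact hC' s hs
            · exact hC' t ht
        _ = (A * M * (|C| * |C|)) * ((t ^ (-(1 : ℝ) / 2) * (1 + |Real.log t|) ^ (-n)) *
              (s ^ (-(1 : ℝ) / 2) * (1 + |Real.log s|) ^ (-n)) *
              ((1 + |Real.log (t + s)|) ^ K * (t + s)⁻¹)) := by ring
        _ ≤ (A * M * (|C| * |C|)) * (2 ^ K * ((t⁻¹ * (1 + |Real.log t|) ^ (-(n - K))) *
              (s⁻¹ * (1 + |Real.log s|) ^ (-(n - K))))) :=
            mul_le_mul_of_nonneg_left (pair_bound ht hs K n) (by positivity)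
        _ = _ := by ring

lemma quad_form (K : ℕ) (p : ℕ → ℝ) (q : ℕ → ℂ)
    (hq : ∀ k, q k = ∑ ℓ ∈ Finset.Icc k K,
      (ℓ.choose k : ℂ) * iteratedDeriv (ℓ - k) omegaGamma 0 * (p ℓ : ℂ))
    (f : ℝ → ℂ) (hf : Measurable f)
    {C n : ℝ} (hn : (K : ℝ) + 1 < n)
    (hC : ∀ t ∈ Ioi (0 : ℝ), ‖f t‖ ≤ C * t ^ (-(1 : ℝ) / 2) * (1 + |Real.log t|) ^ (-n)) :
    IntegrableOn (fun l => Qpoly K q (-Real.log l) * ((‖lapl f l‖ ^ 2 : ℝ) : ℂ)) (Ioi 0) ∧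
    ∫ t in Ioi (0 : ℝ), ∫ s in Ioi (0 : ℝ),
        (hankelLogKernelR K p (t + s) : ℂ) * f s * conj (f t)
      = ∫ l in Ioi (0 : ℝ), Qpoly K q (-Real.log l) * ((‖lapl f l‖ ^ 2 : ℝ) : ℂ) := by
  have hI := triple_integrable K q f hf hn hC
  have inner : ∀ l : ℝ, ∫ x : ℝ × ℝ, (Real.exp (-((x.1 + x.2) * l)) : ℂ) *
        Qpoly K q (-Real.log l) * f x.2 * conj (f x.1)
        ∂((volume.restrict (Ioi (0 : ℝ))).prod (volume.restrict (Ioi (0 : ℝ))))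
      = Qpoly K q (-Real.log l) * ((‖lapl f l‖ ^ 2 : ℝ) : ℂ) := by
    intro l
    have e : ∀ x : ℝ × ℝ, (Real.exp (-((x.1 + x.2) * l)) : ℂ) *
        Qpoly K q (-Real.log l) * f x.2 * conj (f x.1) =
        Qpoly K q (-Real.log l) * (conj ((Real.exp (-(x.1 * l)) : ℂ) * f x.1) *
          ((Real.exp (-(x.2 * l)) : ℂ) * f x.2)) := by
      intro x
      rw [map_mul, Complex.conj_ofReal, add_mul, neg_add, Real.exp_add, Complex.ofReal_mul]
      ring
    simp_rw [e]
    rw [integral_const_mul, integral_prod_mul (fun t => conj ((Real.exp (-(t * l)) : ℂ) * f t))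
      (fun t => (Real.exp (-(t * l)) : ℂ) * f t), integral_conj]
    change _ * (conj (lapl f l) * lapl f l) = _
    rw [Complex.conj_mul']
    push_cast
    rfl
  constructor
  · have := hI.integral_prod_right
    simp only [inner] at this
    exact this
  · simp_rw [← inner]
    have h1 := integral_prod _ hI
    have h2 := integral_prod_symm _ hI
    simp only at h1 h2
    rw [← h2, h1, integral_prod _ hI.integral_prod_left]
    refine setIntegral_congr_fun measurableSet_Ioi fun t ht => ?_
    refine setIntegral_congr_fun measurableSet_Ioi fun s hs => ?_
    simp only
    rw [kernel_eq K p q hq (add_pos ht hs), ← integral_mul_const, ← integral_mul_const]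

lemma one_add_log_le {t : ℝ} (ht : 0 < t) {N : ℕ} (hN : 0 < N) :
    t ^ ((1 : ℝ) / 2) * (1 + |Real.log t|) ^ N ≤ (1 + 2 * N) ^ N * (t + 1) := by
  have hN' : (0 : ℝ) < N := by exact_mod_cast hN
  have key : ∀ u : ℝ, 1 ≤ u → (1 + |Real.log u|) ^ N ≤ (1 + 2 * N) ^ N * u ^ ((1 : ℝ) / 2) := by
    intro u hu
    have hu0 : 0 < u := by linarith
    have h1 : Real.log u ≤ u ^ (1 / (2 * N : ℝ)) / (1 / (2 * N : ℝ)) :=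
      Real.log_le_rpow_div hu0.le (by positivity)
    have h2 : 1 ≤ u ^ (1 / (2 * N : ℝ)) := Real.one_le_rpow hu (by positivity)
    have h3 : 1 + |Real.log u| ≤ (1 + 2 * N) * u ^ (1 / (2 * N : ℝ)) := by
      rw [abs_of_nonneg (Real.log_nonneg hu)]
      have : u ^ (1 / (2 * N : ℝ)) / (1 / (2 * N : ℝ)) = 2 * N * u ^ (1 / (2 * N : ℝ)) := by
        field_simp
      rw [this] at h1
      linarith
    have h4 := pow_le_pow_left₀ (by positivity) h3 N
    rw [mul_pow, ← Real.rpow_natCast (u ^ (1 / (2 * N : ℝ))), ← Real.rpow_mul hu0.le] at h4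
    have e : 1 / (2 * N : ℝ) * N = 1 / 2 := by field_simp
    rwa [e] at h4
  have hsq : ∀ u : ℝ, 0 < u → u ^ ((1 : ℝ) / 2) * u ^ ((1 : ℝ) / 2) = u := fun u hu => by
    rw [← Real.rpow_add hu]; norm_num
  rcases le_total 1 t with h | h
  · calc _ ≤ t ^ ((1 : ℝ) / 2) * ((1 + 2 * N) ^ N * t ^ ((1 : ℝ) / 2)) := by
          gcongr; exact key t h
      _ = (1 + 2 * N) ^ N * t := by rw [mul_left_comm, hsq t ht]
      _ ≤ _ := by gcongr; linarith
  · have := key t⁻¹ ((one_le_inv₀ ht).2 h)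
    rw [Real.log_inv, abs_neg] at this
    calc _ ≤ t ^ ((1 : ℝ) / 2) * ((1 + 2 * N) ^ N * t⁻¹ ^ ((1 : ℝ) / 2)) := by gcongr
      _ = (1 + 2 * N) ^ N * 1 := by
          rw [mul_left_comm, ← Real.mul_rpow ht.le (by positivity), mul_inv_cancel₀ ht.ne']
          simp
      _ ≤ _ := by gcongr; linarith

lemma test_bound (K j : ℕ) : ∃ C : ℝ, ∀ t ∈ Ioi (0 : ℝ),
    t ^ j * Real.exp (-t) ≤
      C * (t ^ (-(1 : ℝ) / 2) * (1 + |Real.log t|) ^ (-((K + 2 : ℕ) : ℝ))) := by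
  refine ⟨(1 + 2 * ((K + 2 : ℕ) : ℝ)) ^ (K + 2) * ((j + 1).factorial + j.factorial), ?_⟩
  intro t ht
  have ht : 0 < t := ht
  have h1 := one_add_log_le ht (N := K + 2) (by omega)
  have hm : ∀ m : ℕ, t ^ m * Real.exp (-t) ≤ m.factorial := fun m => by
    have := Real.pow_div_factorial_le_exp t ht.le m
    rw [div_le_iff₀ (by positivity)] at this
    rw [Real.exp_neg, ← div_eq_mul_inv, div_le_iff₀ (Real.exp_pos _)]
    linarith
  have hp : 0 < 1 + |Real.log t| := by positivity
  have ha : 0 < t ^ ((1 : ℝ) / 2) := by positivity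
  rw [neg_div, Real.rpow_neg ht.le, Real.rpow_neg hp.le, ← mul_inv, ← div_eq_mul_inv,
    Real.rpow_natCast, le_div_iff₀ (by positivity)]
  calc _ ≤ t ^ j * Real.exp (-t) * ((1 + 2 * ((K + 2 : ℕ) : ℝ)) ^ (K + 2) * (t + 1)) := by
        gcongr
    _ = (1 + 2 * ((K + 2 : ℕ) : ℝ)) ^ (K + 2) *
        (t ^ (j + 1) * Real.exp (-t) + t ^ j * Real.exp (-t)) := by ring
    _ ≤ _ := by gcongr <;> exact hm _

/-- Test functions. -/
noncomputable def testFn (P : Polynomial ℝ) (t : ℝ) : ℂ :=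
  ((∑ j ∈ Finset.range (P.natDegree + 1), P.coeff j / j.factorial * (t ^ j * Real.exp (-t)) : ℝ) : ℂ)

lemma testFn_measurable (P : Polynomial ℝ) : Measurable (testFn P) := by
  unfold testFn; fun_prop

lemma testFn_bound (K : ℕ) (P : Polynomial ℝ) : ∃ C : ℝ, ∀ t ∈ Ioi (0 : ℝ),
    ‖testFn P t‖ ≤ C * t ^ (-(1 : ℝ) / 2) * (1 + |Real.log t|) ^ (-((K + 2 : ℕ) : ℝ)) := by
  choose C hC using test_bound K
  refine ⟨∑ j ∈ Finset.range (P.natDegree + 1), |P.coeff j / j.factorial| * C j, fun t ht => ?_⟩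
  rw [testFn, Complex.norm_real, mul_assoc, Finset.sum_mul]
  refine (norm_sum_le _ _).trans (Finset.sum_le_sum fun j _ => ?_)
  have ht' : 0 < t := ht
  rw [norm_mul, Real.norm_eq_abs, Real.norm_eq_abs, mul_assoc,
    abs_of_nonneg (by positivity : 0 ≤ t ^ j * Real.exp (-t))]
  exact mul_le_mul_of_nonneg_left (hC j t ht) (abs_nonneg _)

lemma mono_laplace {r : ℝ} (hr : 0 < r) (j : ℕ) :
    IntegrableOn (fun t : ℝ => t ^ j * Real.exp (-(r * t))) (Ioi 0) ∧
    ∫ t in Ioi (0 : ℝ), t ^ j * Real.exp (-(r * t)) = j.factorial * (1 / r) ^ (j + 1) := by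
  constructor
  · have h := integrableOn_rpow_mul_exp_neg_mul_rpow (p := 1) (s := j) (b := r)
      (by have : (0 : ℝ) ≤ j := by positivity
          linarith) one_pos hr
    simpa using h
  · have := Real.integral_rpow_mul_exp_neg_mul_Ioi (a := j + 1) (r := r) (by positivity) hr
    simp only [add_sub_cancel_right, Real.rpow_natCast] at this
    rw [this, Real.Gamma_nat_eq_factorial, mul_comm]
    congr 1
    exact_mod_cast Real.rpow_natCast (1 / r) (j + 1)

lemma lapl_testFn (P : Polynomial ℝ) {l : ℝ} (hl : 0 < l) :
    lapl (testFn P) l = (((1 / (1 + l)) * P.eval (1 / (1 + l)) : ℝ) : ℂ) := by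
  have hr : 0 < 1 + l := by linarith
  have e : ∀ t : ℝ, (Real.exp (-(t * l)) : ℂ) * testFn P t =
      ((∑ j ∈ Finset.range (P.natDegree + 1),
        P.coeff j / j.factorial * (t ^ j * Real.exp (-((1 + l) * t))) : ℝ) : ℂ) := by
    intro t
    rw [testFn, ← Complex.ofReal_mul, Finset.mul_sum]
    congr 1
    refine Finset.sum_congr rfl fun j _ => ?_
    have : -((1 + l) * t) = -(t * l) + -t := by ring
    rw [this, Real.exp_add]
    ring
  unfold lapl
  simp_rw [e]
  rw [integral_complex_ofReal]
  congr 1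
  rw [integral_finsetSum _ fun j _ => ((mono_laplace hr j).1.const_mul _), Polynomial.eval_eq_sum_range,
    Finset.mul_sum]
  refine Finset.sum_congr rfl fun j _ => ?_
  rw [integral_const_mul, (mono_laplace hr j).2]
  have : (j.factorial : ℝ) ≠ 0 := by positivity
  rw [pow_succ, ← mul_assoc, div_mul_cancel₀ _ this]
  ring

lemma nonneg_of_poly (g : ℝ → ℝ) (hg : ContinuousOn g (Ioi 0))
    (hI : IntegrableOn (fun l => g l * (1 / (1 + l)) ^ 2) (Ioi 0))
    (hp : ∀ P : Polynomial ℝ,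
      0 ≤ ∫ l in Ioi (0 : ℝ), g l * (1 / (1 + l) * P.eval (1 / (1 + l))) ^ 2) :
    ∀ x > 0, 0 ≤ g x := by
  intro x hx
  by_contra hneg
  push Not at hneg
  set v0 : ℝ := 1 / (1 + x) with hv0
  have hv0p : 0 < v0 := by positivity
  have hx0 : 1 / v0 - 1 = x := by rw [hv0]; field_simp; ring
  have hev : ∀ᶠ v in 𝓝 v0, g (1 / v - 1) < 0 := by
    have hc1 : ContinuousAt (fun v : ℝ => 1 / v - 1) v0 :=
      (continuousAt_const.div continuousAt_id hv0p.ne').sub continuousAt_const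
    have hc2 : ContinuousAt g (1 / v0 - 1) := by
      rw [hx0]; exact hg.continuousAt (Ioi_mem_nhds hx)
    have hc : ContinuousAt (fun v : ℝ => g (1 / v - 1)) v0 :=
      ContinuousAt.comp (f := fun v : ℝ => 1 / v - 1) hc2 hc1
    exact hc.eventually_lt continuousAt_const (by rw [hx0]; exact hneg)
  obtain ⟨d, hd, hball⟩ := Metric.eventually_nhds_iff.1 hev
  set φ : ℝ → ℝ := fun v => max 0 (d - |v - v0|) with hφ
  have hφc : Continuous φ := by fun_prop
  have hφ0 : ∀ v, 0 ≤ φ v := fun v => le_max_left _ _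
  have hφd : ∀ v, φ v ≤ d := fun v => max_le hd.le (by linarith [abs_nonneg (v - v0)])
  have hP : ∀ m : ℕ, ∃ P : Polynomial ℝ, ∀ v ∈ Icc (0 : ℝ) 1, |P.eval v - φ v| < 1 / ((m : ℝ) + 1) :=
    fun m => exists_polynomial_near_of_continuousOn 0 1 φ hφc.continuousOn _ (by positivity)
  choose P hP using hP
  have hv : ∀ l : ℝ, 0 < l → 1 / (1 + l) ∈ Icc (0 : ℝ) 1 := fun l hl =>
    ⟨by positivity, by rw [div_le_one (by linarith)]; linarith⟩
  have hvm : AEStronglyMeasurable g (volume.restrict (Ioi 0)) :=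
    hg.aestronglyMeasurable measurableSet_Ioi
  have hev' : ∀ Q : Polynomial ℝ, Measurable fun l : ℝ => Q.eval (1 / (1 + l)) := fun Q =>
    Q.continuous.measurable.comp (by fun_prop)
  have hlim : Tendsto (fun m => ∫ l in Ioi (0 : ℝ),
      g l * (1 / (1 + l) * (P m).eval (1 / (1 + l))) ^ 2) atTop
      (𝓝 (∫ l in Ioi (0 : ℝ), g l * (1 / (1 + l) * φ (1 / (1 + l))) ^ 2)) := by
    refine tendsto_integral_of_dominated_convergence
      (fun l => ‖g l * (1 / (1 + l)) ^ 2‖ * (d + 1) ^ 2) ?_ (hI.norm.mul_const _) ?_ ?_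
    · intro m
      refine hvm.mul (Measurable.aestronglyMeasurable ?_)
      have := hev' (P m)
      fun_prop
    · intro m
      filter_upwards [ae_restrict_mem measurableSet_Ioi] with l hl
      have h1 := hP m _ (hv l hl)
      have h2 : |(P m).eval (1 / (1 + l))| ≤ d + 1 := by
        have h3 : 1 / ((m : ℝ) + 1) ≤ 1 := by
          rw [div_le_one (by positivity)]; linarith [(Nat.cast_nonneg m : (0 : ℝ) ≤ m)]
        have := hφ0 (1 / (1 + l))
        have := hφd (1 / (1 + l))
        rw [abs_lt] at h1
        rw [abs_le]
        constructor <;> linarith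
      rw [mul_pow, ← mul_assoc, norm_mul, norm_pow, Real.norm_eq_abs ((P m).eval _)]
      gcongr
    · filter_upwards [ae_restrict_mem measurableSet_Ioi] with l hl
      have h1 : Tendsto (fun m => (P m).eval (1 / (1 + l))) atTop (𝓝 (φ (1 / (1 + l)))) := by
        rw [tendsto_iff_dist_tendsto_zero]
        refine squeeze_zero (fun _ => dist_nonneg) (fun m => ?_)
          (tendsto_one_div_add_atTop_nhds_zero_nat (𝕜 := ℝ))
        rw [Real.dist_eq]
        exact (hP m _ (hv l hl)).le
      exact ((h1.const_mul _).pow 2).const_mul _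
  have hge : 0 ≤ ∫ l in Ioi (0 : ℝ), g l * (1 / (1 + l) * φ (1 / (1 + l))) ^ 2 :=
    ge_of_tendsto' hlim fun m => hp (P m)
  have hφpos : ∀ v, 0 < φ v ↔ |v - v0| < d := fun v => by simp [hφ]
  have hgneg : ∀ l, 0 < l → |1 / (1 + l) - v0| < d → g l < 0 := fun l hl h => by
    have := hball (y := 1 / (1 + l)) (by rwa [Real.dist_eq])
    rwa [show 1 / (1 / (1 + l)) - 1 = l by field_simp; ring] at this
  have hpos : 0 < ∫ l in Ioi (0 : ℝ), -(g l * (1 / (1 + l) * φ (1 / (1 + l))) ^ 2) := by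
    rw [setIntegral_pos_iff_support_of_nonneg_ae]
    · have hopen : IsOpen (Ioi (0 : ℝ) ∩ (fun l : ℝ => |1 / (1 + l) - v0|) ⁻¹' (Iio d)) := by
        refine ContinuousOn.isOpen_inter_preimage ?_ isOpen_Ioi isOpen_Iio
        have : ContinuousOn (fun l : ℝ => 1 / (1 + l)) (Ioi 0) := by
          refine continuousOn_const.div (by fun_prop) fun l hl => ?_
          have : 0 < l := hl
          linarith
        fun_prop
      refine (hopen.measure_pos volume ⟨x, hx, by
        change |1 / (1 + x) - v0| < d
        rw [← hv0, sub_self, abs_zero]; exact hd⟩).trans_le (measure_mono ?_)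
      rintro l ⟨hl, hld⟩
      refine ⟨?_, hl⟩
      have hl' : 0 < l := hl
      have h1 := hgneg l hl hld
      have h2 := (hφpos _).2 hld
      have h3 : 0 < 1 / (1 + l) := by positivity
      rw [Function.mem_support]
      have : (1 / (1 + l) * φ (1 / (1 + l))) ^ 2 ≠ 0 := by positivity
      exact neg_ne_zero.2 (mul_ne_zero h1.ne this)
    · filter_upwards [ae_restrict_mem measurableSet_Ioi] with l hl
      simp only [Pi.zero_apply]
      rcases (hφ0 (1 / (1 + l))).eq_or_lt with h | h
      · rw [← h]; simp
      · have := hgneg l hl ((hφpos _).1 h)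
        have := mul_nonneg (neg_nonneg.2 this.le) (sq_nonneg (1 / (1 + l) * φ (1 / (1 + l))))
        linarith
    · refine ((hI.norm.mul_const (d ^ 2)).mono' ?_ ?_).neg
      · refine hvm.mul (Measurable.aestronglyMeasurable ?_)
        have := hφc.measurable
        fun_prop
      · filter_upwards with l
        have := hφd (1 / (1 + l))
        have := hφ0 (1 / (1 + l))
        rw [mul_pow, ← mul_assoc, norm_mul, norm_pow, Real.norm_eq_abs (φ _), abs_of_nonneg (hφ0 _)]
        gcongr
  rw [integral_neg] at hpos
  linarith

/-- For `K ≥ 2` even and `p_K > 0`, the Hankel operator with kernel `P(ln t) t⁻¹` is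
positive on `𝒟₀` if and only if the polynomial `Q(x) = ∑ q_k x^k`, with
`q_k = ∑_{ℓ=k}^K binom(ℓ,k) ω^{(ℓ−k)}(0) p_ℓ` and `ω(z) = 1/Γ(1−z)`, is nonnegative
on the real line. -/
theorem hankel_log_kernel_positive_iff_Q_nonneg
    (K : ℕ) (hK : 2 ≤ K) (hKeven : Even K)
    (p : ℕ → ℝ) (hpK : 0 < p K)
    (q : ℕ → ℂ)
    (hq : ∀ k, q k = ∑ ℓ ∈ Finset.Icc k K,
      (ℓ.choose k : ℂ) * iteratedDeriv (ℓ - k) omegaGamma 0 * (p ℓ : ℂ)) :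
    (∀ f : ℝ → ℂ, Measurable f →
        (∃ C n : ℝ, (K : ℝ) + 1 < n ∧ ∀ t ∈ Ioi (0 : ℝ),
          ‖f t‖ ≤ C * t ^ (-(1 : ℝ) / 2) * (1 + |Real.log t|) ^ (-n)) →
        0 ≤ ∫ t in Ioi (0 : ℝ), ∫ s in Ioi (0 : ℝ),
              (hankelLogKernelR K p (t + s) : ℂ) * f s * conj (f t))
      ↔ (∀ x : ℝ, 0 ≤ ∑ k ∈ Finset.range (K + 1), q k * (x : ℂ) ^ k) := by
  change _ ↔ ∀ x : ℝ, 0 ≤ Qpoly K q x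
  constructor
  · intro h
    have hn : (K : ℝ) + 1 < ((K + 2 : ℕ) : ℝ) := by push_cast; linarith
    have hsq : ∀ P : Polynomial ℝ, ∀ l ∈ Ioi (0 : ℝ),
        Qpoly K q (-Real.log l) * ((‖lapl (testFn P) l‖ ^ 2 : ℝ) : ℂ) =
        Qpoly K q (-Real.log l) * (((1 / (1 + l) * P.eval (1 / (1 + l))) ^ 2 : ℝ) : ℂ) := by
      intro P l hl
      rw [lapl_testFn P hl, Complex.norm_real, Real.norm_eq_abs, sq_abs]
    have hI : ∀ P : Polynomial ℝ, IntegrableOn (fun l => Qpoly K q (-Real.log l) *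
        (((1 / (1 + l) * P.eval (1 / (1 + l))) ^ 2 : ℝ) : ℂ)) (Ioi 0) := by
      intro P
      obtain ⟨C, hC⟩ := testFn_bound K P
      exact (quad_form K p q hq (testFn P) (testFn_measurable P) hn hC).1.congr_fun (hsq P)
        measurableSet_Ioi
    have hpos : ∀ P : Polynomial ℝ, 0 ≤ ∫ l in Ioi (0 : ℝ), Qpoly K q (-Real.log l) *
        (((1 / (1 + l) * P.eval (1 / (1 + l))) ^ 2 : ℝ) : ℂ) := by
      intro P
      obtain ⟨C, hC⟩ := testFn_bound K P
      have h1 := h (testFn P) (testFn_measurable P) ⟨C, _, hn, hC⟩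
      rw [(quad_form K p q hq (testFn P) (testFn_measurable P) hn hC).2,
        setIntegral_congr_fun measurableSet_Ioi (hsq P)] at h1
      exact h1
    have hQc : ContinuousOn (fun l : ℝ => Qpoly K q (-Real.log l)) (Ioi 0) :=
      (Qpoly_continuous K q).comp_continuousOn
        (Real.continuousOn_log.mono fun l hl => (ne_of_gt hl : l ≠ 0)).neg
    -- general real-linear functional
    have gen : ∀ L : ℂ →L[ℝ] ℝ,
        (∀ P : Polynomial ℝ, 0 ≤ L (∫ l in Ioi (0 : ℝ), Qpoly K q (-Real.log l) *
          (((1 / (1 + l) * P.eval (1 / (1 + l))) ^ 2 : ℝ) : ℂ))) →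
        ∀ x : ℝ, 0 ≤ L (Qpoly K q x) := by
      intro L hL x
      have eL : ∀ (z : ℂ) (r : ℝ), L (z * (r : ℂ)) = L z * r := fun z r => by
        rw [mul_comm, ← Complex.real_smul, map_smul, smul_eq_mul, mul_comm]
      have := nonneg_of_poly (fun l => L (Qpoly K q (-Real.log l)))
        (L.continuous.comp_continuousOn hQc) ?_ ?_ (Real.exp (-x)) (Real.exp_pos _)
      · simpa using this
      · have h1 := L.integrable_comp (hI 1)
        simp only [eL, Polynomial.eval_one, mul_one] at h1
        exact h1
      · intro P
        have h1 := hL P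
        rw [← L.integral_comp_comm (hI P)] at h1
        simpa only [eL] using h1
    intro x
    have hre := gen Complex.reCLM (fun P => (Complex.nonneg_iff.1 (hpos P)).1) x
    have him := gen Complex.imCLM (fun P => (Complex.nonneg_iff.1 (hpos P)).2.le) x
    have him' := gen (-Complex.imCLM) (fun P => by
      have := (Complex.nonneg_iff.1 (hpos P)).2
      simp only [neg_apply, Complex.imCLM_apply]
      linarith) x
    simp only [neg_apply, Complex.imCLM_apply, Complex.reCLM_apply]
      at hre him him'
    exact Complex.nonneg_iff.2 ⟨hre, by linarith⟩
  · rintro h f hf ⟨C, n, hn, hC⟩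
    rw [(quad_form K p q hq f hf hn hC).2]
    have e : ∀ l : ℝ, Qpoly K q (-Real.log l) * ((‖lapl f l‖ ^ 2 : ℝ) : ℂ) =
        (((Qpoly K q (-Real.log l)).re * ‖lapl f l‖ ^ 2 : ℝ) : ℂ) := by
      intro l
      have h1 := Complex.nonneg_iff.1 (h (-Real.log l))
      have h2 : Qpoly K q (-Real.log l) = ((Qpoly K q (-Real.log l)).re : ℂ) :=
        Complex.ext (by simp) (by simp [← h1.2])
      rw [Complex.ofReal_mul, ← h2]
    simp_rw [e]
    rw [integral_complex_ofReal, Complex.zero_le_real]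
    exact integral_nonneg fun l => mul_nonneg (Complex.nonneg_iff.1 (h _)).1 (sq_nonneg _)
end

section
/- Let p_0, p_1 ∈ ℝ, p_2 > 0, and h(t) = (p_0 + p_1 ln t + p_2 ln^2 t)·t^{-1}. Then ∫_0^∞ ∫_0^∞ h(t+s) f(s) conj(f(t)) ds dt ≥ 0 for every f ∈ 𝒟_0 if and only if p_1^2 + 2π^2 p_2^2/3 ≤ 4 p_0 p_2. -/
open MeasureTheory Real Set ComplexConjugate
open scoped ComplexOrder

namespace HankelAux
open ProbabilityTheory Filter Topology

/-- exponential distribution -/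
noncomputable def mu : Measure ℝ :=
  (volume.restrict (Ioi (0 : ℝ))).withDensity (fun x => ENNReal.ofReal (Real.exp (-x)))

lemma integrable_mu (g : ℝ → ℝ) :
    Integrable g mu ↔ IntegrableOn (fun x => Real.exp (-x) * g x) (Ioi 0) := by
  unfold mu
  rw [integrable_withDensity_iff_integrable_smul' (by fun_prop) (by simp)]
  simp [IntegrableOn, ENNReal.toReal_ofReal (Real.exp_pos _).le]

lemma integral_mu (g : ℝ → ℝ) :
    ∫ x, g x ∂mu = ∫ x in Ioi (0 : ℝ), Real.exp (-x) * g x := by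
  unfold mu
  rw [integral_withDensity_eq_integral_toReal_smul (by fun_prop) (by simp)]
  simp [ENNReal.toReal_ofReal (Real.exp_pos _).le]

lemma exp_log_eq (z : ℝ) : EqOn (fun x => Real.exp (-x) * x ^ ((z + 1) - 1))
    (fun x => Real.exp (-x) * Real.exp (z * Real.log x)) (Ioi 0) := by
  intro x hx
  have : (0 : ℝ) < x := hx
  simp only [add_sub_cancel_right]
  rw [Real.rpow_def_of_pos this, mul_comm z]

lemma mem_expSet (z : ℝ) (hz : -1 < z) : z ∈ integrableExpSet Real.log mu := by
  change Integrable _ mu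
  rw [integrable_mu]
  exact (Real.GammaIntegral_convergent (by linarith : 0 < z + 1)).congr_fun (exp_log_eq z)
    measurableSet_Ioi

lemma zero_mem_int : (0 : ℝ) ∈ interior (integrableExpSet Real.log mu) := by
  rw [mem_interior]
  exact ⟨Ioi (-1), fun z hz => mem_expSet z hz, isOpen_Ioi, by simp⟩

lemma mgf_eq (z : ℝ) (hz : -1 < z) : mgf Real.log mu z = Real.Gamma (z + 1) := by
  rw [Real.Gamma_eq_integral (by linarith), mgf, integral_mu]
  exact (setIntegral_congr_fun measurableSet_Ioi (exp_log_eq z)).symm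

lemma mgf_refl : ∀ᶠ z in 𝓝 (0 : ℝ),
    (mgf Real.log mu z * mgf Real.log mu (-z)) * Real.sin (π * z) = π * z := by
  filter_upwards [Ioo_mem_nhds (by norm_num : (-1 : ℝ) < 0) (by norm_num : (0 : ℝ) < 1)] with z hz
  by_cases h0 : z = 0
  · simp [h0]
  rw [mgf_eq z hz.1, mgf_eq (-z) (by linarith [hz.2]), Real.Gamma_add_one h0]
  have h := Real.Gamma_mul_Gamma_one_sub z
  have hs : Real.sin (π * z) ≠ 0 := by
    intro h
    rw [Real.sin_eq_zero_iff] at h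
    obtain ⟨n, hn⟩ := h
    have : (n : ℝ) = z := by
      have := Real.pi_pos.ne'
      field_simp at hn
      linarith
    rw [← this] at hz h0
    have h1 : -1 < n := by exact_mod_cast hz.1
    have h2 : n < 1 := by exact_mod_cast hz.2
    apply h0
    have : n = 0 := by omega
    simp [this]
  rw [show -z + 1 = 1 - z by ring]
  rw [mul_assoc z, h, mul_assoc, div_mul_cancel₀ _ hs, mul_comm]

noncomputable def A : ℝ := ∫ x in Ioi (0 : ℝ), Real.exp (-x) * Real.log x
noncomputable def B : ℝ := ∫ x in Ioi (0 : ℝ), Real.exp (-x) * Real.log x ^ 2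

lemma B_sub_A : B - A ^ 2 = π ^ 2 / 6 := by
  have han := analyticAt_mgf zero_mem_int
  have hM : ContDiffAt ℝ 3 (mgf Real.log mu) 0 := han.contDiffAt
  have hM' : ContDiffAt ℝ 3 (fun z => mgf Real.log mu (-z)) 0 := by
    have : ContDiffAt ℝ 3 (mgf Real.log mu) (-0) := by simpa using hM
    exact this.comp (0 : ℝ) (contDiff_neg.contDiffAt)
  have hS : ContDiffAt ℝ 3 (fun z => Real.sin (π * z)) 0 := by fun_prop
  have key := Filter.EventuallyEq.iteratedDeriv_eq 3 mgf_refl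
  rw [iteratedDeriv_fun_mul (hM.mul hM') hS] at key
  have h0 : iteratedDeriv 0 (mgf Real.log mu) 0 = 1 := by
    simp [mgf_eq 0 (by norm_num)]
  have h1 : iteratedDeriv 1 (mgf Real.log mu) 0 = A := by
    rw [iteratedDeriv_mgf_zero zero_mem_int, integral_mu, A]; simp
  have h2 : iteratedDeriv 2 (mgf Real.log mu) 0 = B := by
    rw [iteratedDeriv_mgf_zero zero_mem_int, integral_mu, B]; simp
  have hn : ∀ n, iteratedDeriv n (fun z => mgf Real.log mu (-z)) 0
      = (-1) ^ n * iteratedDeriv n (mgf Real.log mu) 0 := by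
    intro n
    rw [iteratedDeriv_comp_neg]; simp
  have hG1 : iteratedDeriv 1 (fun z => mgf Real.log mu z * mgf Real.log mu (-z)) 0 = 0 := by
    rw [iteratedDeriv_fun_mul (hM.of_le (by norm_num)) (hM'.of_le (by norm_num))]
    simp only [Finset.sum_range_succ, Finset.sum_range_zero, hn, h0, h1, Nat.sub_zero, Nat.sub_self]
    norm_num
  have hG2 : iteratedDeriv 2 (fun z => mgf Real.log mu z * mgf Real.log mu (-z)) 0
      = 2 * (B - A ^ 2) := by
    rw [iteratedDeriv_fun_mul (hM.of_le (by norm_num)) (hM'.of_le (by norm_num))]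
    simp only [Finset.sum_range_succ, Finset.sum_range_zero, hn, h0, h1, h2, Nat.sub_zero,
      Nat.sub_self, show 2 - 1 = 1 from rfl]
    norm_num
    ring
  have hS1 : deriv (fun z => Real.sin (π * z)) = fun z => π * Real.cos (π * z) := by
    ext z
    have : HasDerivAt (fun z => Real.sin (π * z)) (Real.cos (π * z) * (π * 1)) z :=
      ((hasDerivAt_id z).const_mul π).sin
    rw [this.deriv]; ring
  have hS2 : deriv (fun z => π * Real.cos (π * z)) = fun z => -π ^ 2 * Real.sin (π * z) := by
    ext z
    have : HasDerivAt (fun z => π * Real.cos (π * z)) (π * (-Real.sin (π * z) * (π * 1))) z :=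
      (((hasDerivAt_id z).const_mul π).cos).const_mul π
    rw [this.deriv]; ring
  have hS3 : deriv (fun z => -π ^ 2 * Real.sin (π * z)) = fun z => -π ^ 3 * Real.cos (π * z) := by
    ext z
    have : HasDerivAt (fun z => -π ^ 2 * Real.sin (π * z))
      (-π ^ 2 * (Real.cos (π * z) * (π * 1))) z :=
      (((hasDerivAt_id z).const_mul π).sin).const_mul _
    rw [this.deriv]; ring
  have hR1 : deriv (fun z : ℝ => π * z) = fun z => π := by
    ext z
    have : HasDerivAt (fun z : ℝ => π * z) (π * 1) z := (hasDerivAt_id z).const_mul π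
    rw [this.deriv]; ring
  simp only [Finset.sum_range_succ, Finset.sum_range_zero, hG1, hG2, Nat.sub_zero, Nat.sub_self,
    show 3 - 1 = 2 from rfl, show 3 - 2 = 1 from rfl] at key
  simp only [iteratedDeriv_succ', iteratedDeriv_zero, hS1, hS2, hS3, hR1, deriv_const',
    mgf_eq 0 (by norm_num)] at key
  have h0' : mgf Real.log mu 0 = 1 := by simpa using h0
  simp [h0', Nat.choose] at key
  have hp := Real.pi_pos
  have : π * (6 * (B - A ^ 2) - π ^ 2) = 0 := by linarith
  rcases mul_eq_zero.mp this with h | h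
  · linarith
  · linarith

lemma int_log : IntegrableOn (fun x => Real.exp (-x) * Real.log x) (Ioi 0) := by
  have := integrable_pow_of_mem_interior_integrableExpSet zero_mem_int 1
  rw [integrable_mu] at this
  simpa using this

lemma int_log2 : IntegrableOn (fun x => Real.exp (-x) * Real.log x ^ 2) (Ioi 0) := by
  have := integrable_pow_of_mem_interior_integrableExpSet zero_mem_int 2
  rwa [integrable_mu] at this

lemma int_exp : IntegrableOn (fun x : ℝ => Real.exp (-x)) (Ioi 0) := integrableOn_exp_neg_Ioi 0

lemma int_exp_eq : ∫ x in Ioi (0 : ℝ), Real.exp (-x) = 1 := by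
  simpa using integral_exp_neg_Ioi 0

/-- Laplace transform of quadratic polynomials of the logarithm. -/
lemma laplace_int (a b c t : ℝ) (ht : 0 < t) :
    IntegrableOn (fun x => (a + b * Real.log x + c * Real.log x ^ 2) * Real.exp (-(t * x)))
      (Ioi 0) ∧
    ∫ x in Ioi (0 : ℝ), (a + b * Real.log x + c * Real.log x ^ 2) * Real.exp (-(t * x)) =
      ((a + b * A + c * B) + (- b - 2 * c * A) * Real.log t + c * Real.log t ^ 2) / t := by
  set g : ℝ → ℝ := fun y => (a - b * Real.log t + c * Real.log t ^ 2) * Real.exp (-y)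
    + ((b - 2 * c * Real.log t) * (Real.exp (-y) * Real.log y)
    + c * (Real.exp (-y) * Real.log y ^ 2)) with hg
  have hgi : IntegrableOn g (Ioi 0) :=
    (int_exp.const_mul _).add ((int_log.const_mul _).add (int_log2.const_mul _))
  have hgv : ∫ y in Ioi (0 : ℝ), g y = (a - b * Real.log t + c * Real.log t ^ 2)
      + ((b - 2 * c * Real.log t) * A + c * B) := by
    have hi : IntegrableOn (fun y => (b - 2 * c * Real.log t) * (Real.exp (-y) * Real.log y)
        + c * (Real.exp (-y) * Real.log y ^ 2)) (Ioi 0) :=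
      (int_log.const_mul _).add (int_log2.const_mul _)
    rw [hg, integral_add (int_exp.const_mul _) hi,
      integral_add (int_log.const_mul _) (int_log2.const_mul _), integral_const_mul,
      integral_const_mul, integral_const_mul, int_exp_eq, A, B, mul_one]
  have heq : EqOn (fun x => g (t * x))
      (fun x => (a + b * Real.log x + c * Real.log x ^ 2) * Real.exp (-(t * x))) (Ioi 0) := by
    intro x hx
    have hx : (0 : ℝ) < x := hx
    simp only [hg, Real.log_mul ht.ne' hx.ne']
    ring
  constructor
  · refine IntegrableOn.congr_fun ?_ heq measurableSet_Ioi
    rw [integrableOn_Ioi_comp_mul_left_iff g 0 ht]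
    simpa using hgi
  · rw [← setIntegral_congr_fun measurableSet_Ioi heq, integral_comp_mul_left_Ioi g 0 ht, mul_zero,
      hgv, smul_eq_mul]
    field_simp
    ring

lemma int_V (r : ℝ) (hr : 1 < r) :
    IntegrableOn (fun t : ℝ => t⁻¹ * (1 + |Real.log t|) ^ (-r)) (Ioi 0) := by
  have h := integrableOn_image_iff_integrableOn_abs_deriv_smul (s := univ) (f := Real.exp)
    (f' := Real.exp) MeasurableSet.univ (fun x _ => (Real.hasDerivAt_exp x).hasDerivWithinAt)
    Real.exp_injective.injOn (fun t : ℝ => t⁻¹ * (1 + |Real.log t|) ^ (-r))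
  rw [image_univ, Real.range_exp] at h
  rw [h, integrableOn_univ]
  have h2 := integrable_one_add_norm (E := ℝ) (μ := volume) (r := r) (by simpa using hr)
  refine h2.congr (Eventually.of_forall fun x => ?_)
  have := Real.exp_pos x
  simp only [Real.log_exp, abs_of_pos this, smul_eq_mul, Real.norm_eq_abs]
  rw [← mul_assoc, mul_inv_cancel₀ this.ne', one_mul]

lemma log_add_bound (t s : ℝ) (ht : 0 < t) (hs : 0 < s) :
    1 + |Real.log (t + s)| ≤ 2 * ((1 + |Real.log t|) * (1 + |Real.log s|)) := by
  have h1 : |Real.log (t + s)| ≤ 1 + |Real.log t| + |Real.log s| := by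
    rw [abs_le]
    constructor
    · have : Real.log t ≤ Real.log (t + s) := Real.log_le_log ht (by linarith)
      have := neg_abs_le (Real.log t)
      have := abs_nonneg (Real.log s)
      linarith
    · have h2 : Real.log (t + s) ≤ Real.log (2 * max t s) := by
        apply Real.log_le_log (by linarith)
        have := le_max_left t s
        have := le_max_right t s
        linarith
      rw [Real.log_mul (by norm_num) (by positivity)] at h2
      have h3 := Real.log_two_lt_d9
      have h4 : Real.log (max t s) ≤ |Real.log t| + |Real.log s| := by
        rcases max_choice t s with h | h <;> rw [h]
        · linarith [le_abs_self (Real.log t), abs_nonneg (Real.log s)]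
        · linarith [le_abs_self (Real.log s), abs_nonneg (Real.log t)]
      linarith
  nlinarith [abs_nonneg (Real.log t), abs_nonneg (Real.log s),
    mul_nonneg (abs_nonneg (Real.log t)) (abs_nonneg (Real.log s))]

lemma inv_add_bound (t s : ℝ) (ht : 0 < t) (hs : 0 < s) :
    1 / (t + s) ≤ t ^ (-(1 : ℝ) / 2) * s ^ (-(1 : ℝ) / 2) := by
  rw [← Real.mul_rpow ht.le hs.le, show (-(1 : ℝ) / 2) = -(1 / 2) by ring,
    Real.rpow_neg (by positivity), ← Real.sqrt_eq_rpow, one_div]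
  apply inv_anti₀ (Real.sqrt_pos.mpr (by positivity))
  rw [Real.sqrt_le_left (by positivity)]
  nlinarith [mul_pos ht hs]

/-- the size condition -/
def D0 (f : ℝ → ℂ) : Prop :=
  ∃ C n : ℝ, 3 < n ∧ ∀ t ∈ Ioi (0 : ℝ),
          ‖f t‖ ≤ C * t ^ (-(1 : ℝ) / 2) * (1 + |Real.log t|) ^ (-n)

noncomputable def nu : Measure ℝ := volume.restrict (Ioi (0 : ℝ))

instance : SFinite nu := by unfold nu; infer_instance

lemma ae_nu2 : ∀ᵐ z ∂(nu.prod nu), 0 < z.1 ∧ 0 < z.2 := by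
  unfold nu
  rw [Measure.prod_restrict]
  exact ae_restrict_mem (measurableSet_Ioi.prod measurableSet_Ioi)

lemma kernel_bound (a b c : ℝ) : ∃ K : ℝ, 0 ≤ K ∧ ∀ t : ℝ, 0 < t →
    ∫ x, |(a + b * Real.log x + c * Real.log x ^ 2) * Real.exp (-(t * x))| ∂nu
      ≤ K * (1 + |Real.log t|) ^ 2 / t := by
  refine ⟨(|a| + |b| + |c|) * (2 + 2 * |A| + |B|), by positivity, fun t ht => ?_⟩
  have h1 := laplace_int a b c t ht
  have h2 := laplace_int (|a| + |b| + |c|) 0 (|a| + |b| + |c|) t ht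
  calc ∫ x, |(a + b * Real.log x + c * Real.log x ^ 2) * Real.exp (-(t * x))| ∂nu
      ≤ ∫ x, ((|a| + |b| + |c|) + 0 * Real.log x + (|a| + |b| + |c|) * Real.log x ^ 2)
          * Real.exp (-(t * x)) ∂nu := by
        apply integral_mono h1.1.abs h2.1
        intro x
        simp only
        rw [abs_mul, abs_of_pos (Real.exp_pos _)]
        apply mul_le_mul_of_nonneg_right _ (Real.exp_pos _).le
        have e1 := abs_add_three a (b * Real.log x) (c * Real.log x ^ 2)
        rw [abs_mul, abs_mul, abs_of_nonneg (sq_nonneg (Real.log x))] at e1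
        have e2 : |Real.log x| ≤ 1 + Real.log x ^ 2 := by
          rw [← sq_abs]
          nlinarith [sq_nonneg (|Real.log x| - 1), abs_nonneg (Real.log x)]
        nlinarith [mul_le_mul_of_nonneg_left e2 (abs_nonneg b), abs_nonneg a, abs_nonneg c,
          mul_nonneg (abs_nonneg a) (sq_nonneg (Real.log x))]
    _ = _ := h2.2
    _ ≤ _ := by
        apply div_le_div_of_nonneg_right _ ht.le
        set K := |a| + |b| + |c|
        have hK : 0 ≤ K := by positivity
        have : K + 0 * A + K * B + (-0 - 2 * K * A) * Real.log t + K * Real.log t ^ 2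
            = K * (1 + B + (-2 * A) * Real.log t + Real.log t ^ 2) := by ring
        rw [this, mul_assoc K (2 + 2 * |A| + |B|)]
        apply mul_le_mul_of_nonneg_left _ hK
        rw [← sq_abs (Real.log t)]
        have e1 : (-2 * A) * Real.log t ≤ 2 * |A| * |Real.log t| := by
          refine (le_abs_self _).trans ?_
          rw [abs_mul, abs_mul]; norm_num
        set L := |Real.log t|
        have hL : 0 ≤ L := abs_nonneg _
        have hA := abs_nonneg A
        have hB := abs_nonneg B
        have hB' := le_abs_self B
        nlinarith [mul_nonneg hA hL, mul_nonneg hB hL, mul_nonneg hA (mul_nonneg hL hL),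
          mul_nonneg hB (mul_nonneg hL hL)]

lemma triple_int (a b c : ℝ) (f : ℝ → ℂ) (hf : Measurable f) (hD : D0 f) :
    Integrable (fun p : (ℝ × ℝ) × ℝ =>
      (((a + b * Real.log p.2 + c * Real.log p.2 ^ 2) * Real.exp (-((p.1.1 + p.1.2) * p.2)) : ℝ) : ℂ)
        * (f p.1.2 * conj (f p.1.1))) ((nu.prod nu).prod nu) := by
  obtain ⟨C, n, hn, hC⟩ := hD
  obtain ⟨K, hK, hKb⟩ := kernel_bound a b c
  have hmeas : Measurable (fun p : (ℝ × ℝ) × ℝ =>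
      (((a + b * Real.log p.2 + c * Real.log p.2 ^ 2) * Real.exp (-((p.1.1 + p.1.2) * p.2)) : ℝ) : ℂ)
        * (f p.1.2 * conj (f p.1.1))) := by
    have h1 : Measurable (fun p : (ℝ × ℝ) × ℝ => f p.1.2) := hf.comp (by fun_prop)
    have h2 : Measurable (fun p : (ℝ × ℝ) × ℝ => conj (f p.1.1)) :=
      Complex.continuous_conj.measurable.comp (hf.comp (by fun_prop))
    fun_prop
  rw [integrable_prod_iff hmeas.aestronglyMeasurable]
  constructor
  · filter_upwards [ae_nu2] with z hz
    have h := (laplace_int a b c (z.1 + z.2) (by linarith [hz.1, hz.2])).1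
    exact (Integrable.ofReal h).mul_const _
  · have hV := int_V (n - 2) (by linarith)
    have hVV := (Integrable.mul_prod (μ := nu) (ν := nu) hV hV).const_mul (K * 4 * C ^ 2)
    refine hVV.mono' hmeas.aestronglyMeasurable.norm.integral_prod_right' ?_
    filter_upwards [ae_nu2] with z hz
    obtain ⟨ht, hs⟩ := hz
    set t := z.1
    set s := z.2
    simp only [norm_mul (Complex.ofReal _), Complex.norm_real, Real.norm_eq_abs,
      integral_mul_const]
    have h0 : 0 ≤ ∫ x, |(a + b * Real.log x + c * Real.log x ^ 2) * Real.exp (-((t + s) * x))| ∂nu :=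
      integral_nonneg fun x => abs_nonneg _
    rw [abs_of_nonneg (mul_nonneg h0 (by positivity)), norm_mul, RCLike.norm_conj]
    have hb := hKb (t + s) (by linarith)
    have hft := hC t ht
    have hfs := hC s hs
    set x := 1 + |Real.log t| with hx
    set y := 1 + |Real.log s| with hy
    have hx0 : 0 < x := by positivity
    have hy0 : 0 < y := by positivity
    have hC0 : 0 ≤ C := by
      have h1 : 0 ≤ C * (t ^ (-(1 : ℝ) / 2) * x ^ (-n)) := by
        rw [← mul_assoc]; exact (norm_nonneg _).trans hft
      exact nonneg_of_mul_nonneg_left h1 (by positivity)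
    have hlog : (1 + |Real.log (t + s)|) ^ 2 ≤ (2 * (x * y)) ^ 2 :=
      pow_le_pow_left₀ (by positivity) (log_add_bound t s ht hs) 2
    have hinv := inv_add_bound t s ht hs
    have hb2 : ∫ x, |(a + b * Real.log x + c * Real.log x ^ 2) * Real.exp (-((t + s) * x))| ∂nu
        ≤ K * (2 * (x * y)) ^ 2 * (t ^ (-(1 : ℝ) / 2) * s ^ (-(1 : ℝ) / 2)) := by
      refine hb.trans ?_
      rw [div_eq_mul_one_div]
      gcongr
    have ext : t ^ (-(1 : ℝ) / 2) * t ^ (-(1 : ℝ) / 2) = t⁻¹ := by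
      rw [← Real.rpow_add ht, ← Real.rpow_neg_one]; norm_num
    have exs : s ^ (-(1 : ℝ) / 2) * s ^ (-(1 : ℝ) / 2) = s⁻¹ := by
      rw [← Real.rpow_add hs, ← Real.rpow_neg_one]; norm_num
    have exx : x ^ 2 * x ^ (-n) = x ^ (-(n - 2)) := by
      rw [← Real.rpow_natCast, ← Real.rpow_add hx0]; congr 1; push_cast; ring
    have eyy : y ^ 2 * y ^ (-n) = y ^ (-(n - 2)) := by
      rw [← Real.rpow_natCast, ← Real.rpow_add hy0]; congr 1; push_cast; ring
    calc _ ≤ (K * (2 * (x * y)) ^ 2 * (t ^ (-(1 : ℝ) / 2) * s ^ (-(1 : ℝ) / 2)))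
          * ((C * s ^ (-(1 : ℝ) / 2) * y ^ (-n)) * (C * t ^ (-(1 : ℝ) / 2) * x ^ (-n))) := by
          gcongr
      _ = K * 4 * C ^ 2 * (((t ^ (-(1 : ℝ) / 2) * t ^ (-(1 : ℝ) / 2)) * (x ^ 2 * x ^ (-n)))
          * ((s ^ (-(1 : ℝ) / 2) * s ^ (-(1 : ℝ) / 2)) * (y ^ 2 * y ^ (-n)))) := by ring
      _ = _ := by rw [ext, exs, exx, eyy]

noncomputable def Lap (f : ℝ → ℂ) (x : ℝ) : ℂ := ∫ s in Ioi (0 : ℝ), Real.exp (-(s * x)) * f s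

lemma triple_inner (a b c : ℝ) (f : ℝ → ℂ) (x : ℝ) :
    ∫ z : ℝ × ℝ, (((a + b * Real.log x + c * Real.log x ^ 2)
        * Real.exp (-((z.1 + z.2) * x)) : ℝ) : ℂ)
        * (f z.2 * conj (f z.1)) ∂(nu.prod nu)
    = (((a + b * Real.log x + c * Real.log x ^ 2) * ‖Lap f x‖ ^ 2 : ℝ) : ℂ) := by
  have h : ∀ z : ℝ × ℝ, (((a + b * Real.log x + c * Real.log x ^ 2)
        * Real.exp (-((z.1 + z.2) * x)) : ℝ) : ℂ) * (f z.2 * conj (f z.1))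
      = ((a + b * Real.log x + c * Real.log x ^ 2 : ℝ) : ℂ) *
       (conj (Real.exp (-(z.1 * x)) * f z.1) * (Real.exp (-(z.2 * x)) * f z.2)) := by
    intro z
    rw [show -((z.1 + z.2) * x) = -(z.1 * x) + -(z.2 * x) by ring, Real.exp_add]
    rw [map_mul, Complex.conj_ofReal]
    push_cast
    ring
  simp_rw [h]
  rw [integral_const_mul, integral_prod_mul (μ := nu) (ν := nu)
    (fun t => conj (Real.exp (-(t * x)) * f t)) (fun s => Real.exp (-(s * x)) * f s),
    integral_conj]
  change _ * (conj (Lap f x) * Lap f x) = _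
  rw [Complex.conj_mul']
  push_cast
  ring

lemma lap_int (a b c : ℝ) (f : ℝ → ℂ) (hf : Measurable f) (hD : D0 f) :
    IntegrableOn (fun x => (a + b * Real.log x + c * Real.log x ^ 2) * ‖Lap f x‖ ^ 2) (Ioi 0) := by
  have h := (triple_int a b c f hf hD).integral_prod_right
  simp only [triple_inner] at h
  exact h.re

lemma form_eq (a b c : ℝ) (f : ℝ → ℂ) (hf : Measurable f) (hD : D0 f) :
    ∫ t in Ioi (0 : ℝ), ∫ s in Ioi (0 : ℝ),
      (((((a + b * A + c * B) + (- b - 2 * c * A) * Real.log (t + s) + c * Real.log (t + s) ^ 2)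
        / (t + s) : ℝ) : ℂ)) * f s * conj (f t)
    = ((∫ x in Ioi (0 : ℝ),
        (a + b * Real.log x + c * Real.log x ^ 2) * ‖Lap f x‖ ^ 2 : ℝ) : ℂ) := by
  have h3 := triple_int a b c f hf hD
  have e1 := integral_prod_symm _ h3
  have e2 := integral_prod _ h3
  have e3 := integral_prod _ h3.integral_prod_left
  simp only [triple_inner] at e1
  rw [integral_complex_ofReal] at e1
  change _ = ((∫ x, _ ∂nu : ℝ) : ℂ)
  rw [← e1, e2, e3]
  refine setIntegral_congr_fun measurableSet_Ioi fun t ht => ?_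
  refine setIntegral_congr_fun measurableSet_Ioi fun s hs => ?_
  have ht : 0 < t := ht
  have hs : 0 < s := hs
  simp only
  rw [integral_mul_const, integral_complex_ofReal]
  have := (laplace_int a b c (t + s) (by linarith)).2
  change ∫ x, _ ∂nu = _ at this
  rw [this]
  ring

lemma mono_lap (k : ℕ) (y : ℝ) (hy : 0 < y) :
    ∫ s in Ioi (0 : ℝ), s ^ k * Real.exp (-(y * s)) = k.factorial / y ^ (k + 1) := by
  have h := Real.integral_rpow_mul_exp_neg_mul_Ioi (a := k + 1) (by positivity) hy
  rw [Real.Gamma_nat_eq_factorial] at h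
  simp only [add_sub_cancel_right, Real.rpow_natCast] at h
  rw [h, show ((k : ℝ) + 1) = ((k + 1 : ℕ) : ℝ) by push_cast; ring, Real.rpow_natCast]
  rw [one_div, inv_pow]
  ring

lemma mono_int (k : ℕ) (y : ℝ) (hy : 0 < y) :
    IntegrableOn (fun s : ℝ => s ^ k * Real.exp (-(y * s))) (Ioi 0) := by
  by_contra h
  have h1 := mono_lap k y hy
  rw [integral_undef h] at h1
  have : 0 < (k.factorial : ℝ) / y ^ (k + 1) := by positivity
  linarith

noncomputable def tf (r : ℝ) (m : ℕ) (t : ℝ) : ℝ :=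
  ∑ i ∈ Finset.range (m + 1), ((-r) ^ (m - i) * (m.choose i) / (2 * m - i).factorial)
    * (t ^ (2 * m - i) * Real.exp (-(r * t)))

lemma tf_lap (r : ℝ) (hr : 0 < r) (m : ℕ) (x : ℝ) (hx : 0 < x) :
    Lap (fun t => (tf r m t : ℂ)) x = ((x ^ m / (x + r) ^ (2 * m + 1) : ℝ) : ℂ) := by
  unfold Lap
  have hxr : 0 < x + r := by linarith
  have h1 : ∀ s : ℝ, (Real.exp (-(s * x)) : ℂ) * (tf r m s : ℂ) =
      ((∑ i ∈ Finset.range (m + 1), ((-r) ^ (m - i) * (m.choose i) / (2 * m - i).factorial)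
    * (s ^ (2 * m - i) * Real.exp (-((x + r) * s))) : ℝ) : ℂ) := by
    intro s
    rw [← Complex.ofReal_mul, tf, Finset.mul_sum]
    congr 1
    refine Finset.sum_congr rfl fun i _ => ?_
    rw [show -((x + r) * s) = -(s * x) + -(r * s) by ring, Real.exp_add]
    ring
  simp_rw [h1]
  rw [integral_complex_ofReal, integral_finsetSum]
  · congr 1
    simp_rw [integral_const_mul]
    have h2 : ∀ i ∈ Finset.range (m + 1),
        ((-r) ^ (m - i) * (m.choose i) / (2 * m - i).factorial)
          * ∫ s in Ioi (0 : ℝ), s ^ (2 * m - i) * Real.exp (-((x + r) * s))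
        = ((x + r) ^ i * (-r) ^ (m - i) * (m.choose i)) / (x + r) ^ (2 * m + 1) := by
      intro i hi
      have hi : i ≤ m := by simpa [Nat.lt_succ_iff] using hi
      rw [mono_lap _ _ hxr]
      have e : (x + r) ^ (2 * m + 1) = (x + r) ^ (2 * m - i + 1) * (x + r) ^ i := by
        rw [← pow_add]; congr 1; omega
      rw [e]
      have : ((2 * m - i).factorial : ℝ) ≠ 0 := by positivity
      field_simp
    rw [Finset.sum_congr rfl h2, ← Finset.sum_div, ← add_pow]
    congr 2
    ring
  · intro i _
    exact (mono_int _ _ hxr).const_mul _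

lemma tf_meas (r : ℝ) (m : ℕ) : Measurable (fun t => (tf r m t : ℂ)) := by
  unfold tf
  fun_prop

lemma log_pow_bound (t : ℝ) (ht : 0 < t) :
    t ^ ((1 : ℝ) / 2) * (1 + |Real.log t|) ^ 4 ≤ 9 ^ 4 * 8 * (t + 1) := by
  set w := t ^ ((1 : ℝ) / 8) with hw
  have hw0 : 0 < w := by positivity
  have hlog : Real.log t = 8 * Real.log w := by
    rw [hw, Real.log_rpow ht]; ring
  have h1 : |Real.log w| ≤ w + w⁻¹ := by
    rw [abs_le]
    have a1 := Real.log_le_sub_one_of_pos hw0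
    have a2 := Real.log_le_sub_one_of_pos (inv_pos.mpr hw0)
    rw [Real.log_inv] at a2
    have : 0 < w⁻¹ := by positivity
    constructor <;> linarith
  have h2 : 1 ≤ w + w⁻¹ := by
    have : w * w⁻¹ = 1 := mul_inv_cancel₀ hw0.ne'
    have : 0 < w⁻¹ := by positivity
    nlinarith [sq_nonneg (w - w⁻¹)]
  have h3 : 1 + |Real.log t| ≤ 9 * (w + w⁻¹) := by
    rw [hlog, abs_mul, abs_of_pos (by norm_num : (0 : ℝ) < 8)]
    linarith
  have h4 : (1 + |Real.log t|) ^ 4 ≤ (9 * (w + w⁻¹)) ^ 4 :=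
    pow_le_pow_left₀ (by positivity) h3 4
  have h5 : (w + w⁻¹) ^ 4 ≤ 8 * (w ^ 4 + w⁻¹ ^ 4) := by
    have := add_pow_le hw0.le (inv_pos.mpr hw0).le 4
    norm_num at this ⊢
    exact this
  have h6 : t ^ ((1 : ℝ) / 2) = w ^ 4 := by
    rw [hw, ← Real.rpow_natCast, ← Real.rpow_mul ht.le]; norm_num
  have h7 : w ^ 4 * w ^ 4 = t := by
    rw [← h6, ← Real.rpow_add ht]; norm_num
  have h8 : w ^ 4 * w⁻¹ ^ 4 = 1 := by
    rw [← mul_pow, mul_inv_cancel₀ hw0.ne', one_pow]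
  rw [h6]
  calc w ^ 4 * (1 + |Real.log t|) ^ 4 ≤ w ^ 4 * (9 * (w + w⁻¹)) ^ 4 := by gcongr
    _ = 9 ^ 4 * (w ^ 4 * (w + w⁻¹) ^ 4) := by ring
    _ ≤ 9 ^ 4 * (w ^ 4 * (8 * (w ^ 4 + w⁻¹ ^ 4))) := by gcongr
    _ = 9 ^ 4 * 8 * (w ^ 4 * w ^ 4 + w ^ 4 * w⁻¹ ^ 4) := by ring
    _ = _ := by rw [h7, h8]

lemma mono_exp_bound (r : ℝ) (hr : 0 < r) (k : ℕ) (t : ℝ) (ht : 0 < t) :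
    t ^ k * Real.exp (-(r * t)) ≤ k.factorial / r ^ k := by
  have h := Real.pow_div_factorial_le_exp _ (mul_pos hr ht).le k
  rw [Real.exp_neg, ← div_eq_mul_inv, div_le_div_iff₀ (Real.exp_pos _) (by positivity)]
  rw [div_le_iff₀ (by positivity), mul_pow] at h
  linarith

lemma mono_D0 (r : ℝ) (hr : 0 < r) (k : ℕ) : ∃ C : ℝ, ∀ t ∈ Ioi (0 : ℝ),
    t ^ k * Real.exp (-(r * t)) ≤ C * (t ^ (-(1 : ℝ) / 2) * (1 + |Real.log t|) ^ (-(4 : ℝ))) := by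
  refine ⟨9 ^ 4 * 8 * ((k + 1).factorial / r ^ (k + 1) + k.factorial / r ^ k), fun t ht => ?_⟩
  have ht : 0 < t := ht
  have h1 := mono_exp_bound r hr k t ht
  have h2 := mono_exp_bound r hr (k + 1) t ht
  have h3 := log_pow_bound t ht
  set P := t ^ ((1 : ℝ) / 2) * (1 + |Real.log t|) ^ 4 with hP
  have hP0 : 0 < P := by positivity
  have e : t ^ (-(1 : ℝ) / 2) * (1 + |Real.log t|) ^ (-(4 : ℝ)) = P⁻¹ := by
    rw [hP, mul_inv, show (-(1 : ℝ) / 2) = -(1 / 2) by ring, Real.rpow_neg ht.le,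
      Real.rpow_neg (by positivity)]
    norm_cast
  rw [e, ← div_eq_mul_inv, le_div_iff₀ hP0]
  have hE := Real.exp_pos (-(r * t))
  calc t ^ k * Real.exp (-(r * t)) * P
      ≤ t ^ k * Real.exp (-(r * t)) * (9 ^ 4 * 8 * (t + 1)) := by gcongr
    _ = 9 ^ 4 * 8 * (t ^ (k + 1) * Real.exp (-(r * t)) + t ^ k * Real.exp (-(r * t))) := by ring
    _ ≤ _ := by gcongr

lemma tf_D0 (r : ℝ) (hr : 0 < r) (m : ℕ) : D0 (fun t => (tf r m t : ℂ)) := by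
  choose C hC using mono_D0 r hr
  refine ⟨∑ i ∈ Finset.range (m + 1),
    |(-r) ^ (m - i) * (m.choose i) / (2 * m - i).factorial| * C (2 * m - i), 4, by norm_num,
    fun t ht => ?_⟩
  have ht' : 0 < t := ht
  rw [Complex.norm_real, Real.norm_eq_abs, tf, mul_assoc, Finset.sum_mul]
  refine (Finset.abs_sum_le_sum_abs _ _).trans (Finset.sum_le_sum fun i _ => ?_)
  rw [abs_mul, mul_assoc]
  apply mul_le_mul_of_nonneg_left _ (abs_nonneg _)
  rw [abs_of_pos (by positivity)]
  exact hC _ t ht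

lemma log_sq_le (u : ℝ) (hu : 0 < u) : Real.log u ^ 2 ≤ (u - 1) ^ 2 / u := by
  set v := Real.log u / 2 with hv
  have hu' : u = Real.exp v * Real.exp v := by
    rw [← Real.exp_add, hv, add_halves, Real.exp_log hu]
  have h1 : (u - 1) ^ 2 / u = (2 * Real.sinh v) ^ 2 := by
    rw [Real.sinh_eq, Real.exp_neg, hu']
    have := Real.exp_pos v
    field_simp
  have h2 : Real.log u = 2 * v := by rw [hv]; ring
  rw [h1, h2, mul_pow, mul_pow]
  have h3 : |v| ≤ |Real.sinh v| := by
    rw [Real.abs_sinh]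
    exact Real.self_le_sinh_iff.mpr (abs_nonneg v)
  have := sq_le_sq.mpr h3
  linarith

lemma weight_int (r : ℝ) (hr : 0 < r) (m : ℕ) (hm : 1 ≤ m) :
    IntegrableOn (fun x : ℝ => (x - r) ^ 2 / (r * x) * (x ^ m / (x + r) ^ (2 * m + 1)) ^ 2) (Ioi 0)
    := by
  have h0 := (integrableOn_add_rpow_Ioi_of_lt (a := -2) (c := 0) (m := r)
    (by norm_num) (by linarith)).const_mul (r ^ (2 * m))⁻¹
  refine Integrable.mono' h0 (Measurable.aestronglyMeasurable (by fun_prop)) ?_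
  filter_upwards [ae_restrict_mem measurableSet_Ioi] with x hx
  have hx : 0 < x := hx
  rw [Real.norm_eq_abs, abs_of_nonneg (by positivity)]
  obtain ⟨k, rfl⟩ : ∃ k, m = k + 1 := ⟨m - 1, by omega⟩
  have e : (x - r) ^ 2 / (r * x) * (x ^ (k + 1) / (x + r) ^ (2 * (k + 1) + 1)) ^ 2
      = (x - r) ^ 2 * x ^ (2 * k + 1) / (r * ((x + r) ^ (4 * k + 6))) := by
    field_simp
    ring
  have e2 : (x + r) ^ (-2 : ℝ) = ((x + r) ^ 2)⁻¹ := by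
    rw [Real.rpow_neg (by positivity)]; norm_cast
  rw [e, e2, ← mul_inv, ← one_div, div_le_div_iff₀ (by positivity) (by positivity)]
  have b1 : (x - r) ^ 2 ≤ (x + r) ^ 2 := by nlinarith [mul_pos hx hr]
  have b2 : x ^ (2 * k + 1) ≤ (x + r) ^ (2 * k + 1) := pow_le_pow_left₀ hx.le (by linarith) _
  have b3 : r ^ (2 * k + 1) ≤ (x + r) ^ (2 * k + 1) := pow_le_pow_left₀ hr.le (by linarith) _
  calc (x - r) ^ 2 * x ^ (2 * k + 1) * (r ^ (2 * (k + 1)) * (x + r) ^ 2)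
      = (x - r) ^ 2 * x ^ (2 * k + 1) * (r ^ (2 * k + 1) * r * (x + r) ^ 2) := by ring
    _ ≤ (x + r) ^ 2 * (x + r) ^ (2 * k + 1) * ((x + r) ^ (2 * k + 1) * r * (x + r) ^ 2) := by
        gcongr
    _ = 1 * (r * (x + r) ^ (4 * k + 6)) := by ring

lemma weight_eq (r : ℝ) (hr : 0 < r) (m : ℕ) (hm : 1 ≤ m)
    (hF : IntegrableOn (fun x : ℝ => (x ^ m / (x + r) ^ (2 * m + 1)) ^ 2) (Ioi 0)) :
    m * ∫ x in Ioi (0 : ℝ), (x - r) ^ 2 / (r * x) * (x ^ m / (x + r) ^ (2 * m + 1)) ^ 2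
      = ∫ x in Ioi (0 : ℝ), (x ^ m / (x + r) ^ (2 * m + 1)) ^ 2 := by
  have hW := weight_int r hr m hm
  have hd : ∀ x ∈ Ioi (0 : ℝ), HasDerivAt (fun x : ℝ => x ^ (2 * m) * (x - r) / (x + r) ^ (4 * m + 1))
      (2 * r * (x ^ m / (x + r) ^ (2 * m + 1)) ^ 2 - 2 * r * m *
        ((x - r) ^ 2 / (r * x) * (x ^ m / (x + r) ^ (2 * m + 1)) ^ 2)) x := by
    intro x hx
    have hx : 0 < x := hx
    have hxr : 0 < x + r := by linarith
    have h := ((hasDerivAt_pow (2 * m) x).mul ((hasDerivAt_id x).sub_const r)).div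
      (((hasDerivAt_id x).add_const r).pow (4 * m + 1)) (by simp; positivity)
    convert! h using 1
    obtain ⟨k, rfl⟩ : ∃ k, m = k + 1 := ⟨m - 1, by omega⟩
    have e1 : 2 * (k + 1) - 1 = 2 * k + 1 := by omega
    have e2 : 4 * (k + 1) + 1 - 1 = 4 * k + 4 := by omega
    simp only [e1, e2, id, Pi.pow_apply, Pi.mul_apply, Pi.add_apply]
    push_cast
    field_simp
    ring
  have hint := (hF.const_mul (2 * r)).sub (hW.const_mul (2 * r * m))
  have hlim : Tendsto (fun x : ℝ => x ^ (2 * m) * (x - r) / (x + r) ^ (4 * m + 1)) atTop (𝓝 0) := by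
    have ht : Tendsto (fun x : ℝ => (x + r)⁻¹) atTop (𝓝 0) :=
      tendsto_inv_atTop_zero.comp (tendsto_atTop_add_const_right _ r tendsto_id)
    have ht2 : Tendsto (fun x : ℝ => ((x + r)⁻¹) ^ (2 * m)) atTop (𝓝 0) := by
      have := ht.pow (2 * m)
      rwa [zero_pow (by omega)] at this
    refine squeeze_zero_norm' ?_ ht2
    filter_upwards [eventually_gt_atTop 0] with x hx
    have hxr : 0 < x + r := by linarith
    rw [Real.norm_eq_abs, abs_div, abs_mul, abs_of_pos (pow_pos hx _), abs_of_pos (pow_pos hxr _),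
      inv_pow, ← one_div, div_le_div_iff₀ (by positivity) (by positivity)]
    have b1 : |x - r| ≤ x + r := by rw [abs_le]; constructor <;> linarith
    have b2 : x ^ (2 * m) ≤ (x + r) ^ (2 * m) := pow_le_pow_left₀ hx.le (by linarith) _
    calc x ^ (2 * m) * |x - r| * (x + r) ^ (2 * m)
        ≤ (x + r) ^ (2 * m) * (x + r) * (x + r) ^ (2 * m) := by gcongr
      _ = 1 * (x + r) ^ (4 * m + 1) := by ring
  have h := integral_Ioi_of_hasDerivAt_of_tendsto (a := 0) (m := 0)
    (by
      apply ContinuousAt.continuousWithinAt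
      apply ContinuousAt.div (by fun_prop) (by fun_prop)
      simp; positivity) hd hint hlim
  rw [integral_sub (hF.const_mul (2 * r)) (hW.const_mul (2 * r * m)), integral_const_mul,
    integral_const_mul] at h
  rw [zero_pow (by omega)] at h
  have h' : 2 * r * ((∫ x in Ioi (0 : ℝ), (x ^ m / (x + r) ^ (2 * m + 1)) ^ 2)
    - m * ∫ x in Ioi (0 : ℝ), (x - r) ^ 2 / (r * x) * (x ^ m / (x + r) ^ (2 * m + 1)) ^ 2) = 0 := by
    linear_combination h
  rcases mul_eq_zero.mp h' with h'' | h''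
  · linarith
  · linarith

lemma F_pos (r : ℝ) (hr : 0 < r) (m : ℕ)
    (hF : IntegrableOn (fun x : ℝ => (x ^ m / (x + r) ^ (2 * m + 1)) ^ 2) (Ioi 0)) :
    0 < ∫ x in Ioi (0 : ℝ), (x ^ m / (x + r) ^ (2 * m + 1)) ^ 2 := by
  rw [setIntegral_pos_iff_support_of_nonneg_ae _ hF]
  · have : (Function.support fun x : ℝ => (x ^ m / (x + r) ^ (2 * m + 1)) ^ 2) ∩ Ioi 0 = Ioi 0 := by
      rw [inter_eq_right]
      intro x hx
      have hx : 0 < x := hx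
      rw [Function.mem_support]
      positivity
    rw [this]; simp
  · exact Eventually.of_forall fun x => by positivity

end HankelAux

open HankelAux in
/-- The Hankel operator with kernel `h(t) = (p₀ + p₁ ln t + p₂ ln² t) t⁻¹`, `p₂ > 0`, is
positive on `𝒟₀` if and only if `p₁² + 2π²p₂²/3 ≤ 4 p₀ p₂`. -/
theorem hankel_quadratic_log_kernel_positive_iff
    (p₀ p₁ p₂ : ℝ) (hp₂ : 0 < p₂) :
    (∀ f : ℝ → ℂ, Measurable f →
        (∃ C n : ℝ, 3 < n ∧ ∀ t ∈ Ioi (0 : ℝ),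
          ‖f t‖ ≤ C * t ^ (-(1 : ℝ) / 2) * (1 + |Real.log t|) ^ (-n)) →
        0 ≤ ∫ t in Ioi (0 : ℝ), ∫ s in Ioi (0 : ℝ),
              (((p₀ + p₁ * Real.log (t + s) + p₂ * (Real.log (t + s)) ^ 2) / (t + s) : ℝ) : ℂ)
                * f s * conj (f t))
      ↔ p₁ ^ 2 + 2 * π ^ 2 * p₂ ^ 2 / 3 ≤ 4 * p₀ * p₂ := by
  have hBA := B_sub_A
  obtain ⟨b, hb⟩ : ∃ b : ℝ, b = -p₁ - 2 * p₂ * A := ⟨_, rfl⟩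
  obtain ⟨a, ha⟩ : ∃ a : ℝ, a = p₀ - b * A - p₂ * B := ⟨_, rfl⟩
  have hp0 : p₀ = a + b * A + p₂ * B := by rw [ha]; ring
  have hp1 : p₁ = -b - 2 * p₂ * A := by rw [hb]; ring
  have hdisc : p₁ ^ 2 + 2 * π ^ 2 * p₂ ^ 2 / 3 - 4 * p₀ * p₂ = b ^ 2 - 4 * a * p₂ := by
    have hpi : π ^ 2 = 6 * (B - A ^ 2) := by linarith
    rw [hpi, hp0, hp1]
    ring
  have hform := fun f hf hD => form_eq a b p₂ f hf hD
  rw [← hp0, ← hp1] at hform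
  constructor
  · intro H
    by_contra hcon
    have hneg : 0 < b ^ 2 - 4 * a * p₂ := by linarith
    set δ := (b ^ 2 - 4 * a * p₂) / (4 * p₂) with hδ
    have hδ0 : 0 < δ := by positivity
    set x₀ := -b / (2 * p₂) with hx₀
    have hq : ∀ x, a + b * x + p₂ * x ^ 2 = -δ + p₂ * (x - x₀) ^ 2 := by
      intro x
      rw [hδ, hx₀]
      field_simp
      ring
    obtain ⟨k, hk⟩ := exists_nat_gt (p₂ / δ)
    set m := k + 1 with hm
    have hmδ : p₂ < δ * m := by
      rw [div_lt_iff₀ hδ0] at hk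
      rw [hm]; push_cast
      nlinarith
    set r := Real.exp x₀ with hr
    have hr0 : 0 < r := Real.exp_pos _
    have hmeas := tf_meas r m
    have hD := tf_D0 r hr0 m
    have h := H _ hmeas hD
    rw [hform _ hmeas hD] at h
    have h : 0 ≤ ∫ x in Ioi (0 : ℝ), (a + b * Real.log x + p₂ * Real.log x ^ 2)
      * ‖Lap (fun t => (tf r m t : ℂ)) x‖ ^ 2 := by exact_mod_cast h
    have hnorm : ∀ x ∈ Ioi (0 : ℝ), ‖Lap (fun t => (tf r m t : ℂ)) x‖ ^ 2
        = (x ^ m / (x + r) ^ (2 * m + 1)) ^ 2 := by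
      intro x hx
      rw [tf_lap r hr0 m x hx, Complex.norm_real, Real.norm_eq_abs, sq_abs]
    have hF : IntegrableOn (fun x : ℝ => (x ^ m / (x + r) ^ (2 * m + 1)) ^ 2) (Ioi 0) := by
      refine (lap_int 1 0 0 _ hmeas hD).congr_fun (fun x hx => ?_) measurableSet_Ioi
      simp only [hnorm x hx]
      ring
    have hW := weight_int r hr0 m (by omega)
    have hWe := weight_eq r hr0 m (by omega) hF
    have hFp := F_pos r hr0 m hF
    have hle : ∫ x in Ioi (0 : ℝ), (a + b * Real.log x + p₂ * Real.log x ^ 2)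
      * ‖Lap (fun t => (tf r m t : ℂ)) x‖ ^ 2 ≤
      ∫ x in Ioi (0 : ℝ), (-δ * (x ^ m / (x + r) ^ (2 * m + 1)) ^ 2 +
        p₂ * ((x - r) ^ 2 / (r * x) * (x ^ m / (x + r) ^ (2 * m + 1)) ^ 2)) := by
      refine setIntegral_mono_on (lap_int a b p₂ _ hmeas hD)
        ((hF.const_mul _).add (hW.const_mul _)) measurableSet_Ioi fun x hx => ?_
      rw [hnorm x hx, hq]
      have hx : 0 < x := hx
      have h1 := log_sq_le (x / r) (by positivity)
      rw [Real.log_div hx.ne' hr0.ne', hr, Real.log_exp, ← hr] at h1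
      have h2 : (x / r - 1) ^ 2 / (x / r) = (x - r) ^ 2 / (r * x) := by
        field_simp
      rw [h2] at h1
      have h3 : 0 ≤ (x ^ m / (x + r) ^ (2 * m + 1)) ^ 2 := sq_nonneg _
      have h4 := mul_le_mul_of_nonneg_right (mul_le_mul_of_nonneg_left h1 hp₂.le) h3
      linarith
    rw [integral_add (hF.const_mul _) (hW.const_mul _), integral_const_mul,
      integral_const_mul] at hle
    set IF := ∫ x in Ioi (0 : ℝ), (x ^ m / (x + r) ^ (2 * m + 1)) ^ 2
    set IW := ∫ x in Ioi (0 : ℝ), (x - r) ^ 2 / (r * x) * (x ^ m / (x + r) ^ (2 * m + 1)) ^ 2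
    have hmpos : (0 : ℝ) < m := by rw [hm]; positivity
    have h5 : 0 ≤ -δ * IF + p₂ * IW := h.trans hle
    have h6 := mul_nonneg hmpos.le h5
    have h7 : (m : ℝ) * (-δ * IF + p₂ * IW) = (p₂ - δ * m) * IF := by
      rw [← hWe]; ring
    rw [h7] at h6
    nlinarith
  · intro hle f hf hD
    rw [hform f hf hD]
    have : 0 ≤ ∫ x in Ioi (0 : ℝ),
        (a + b * Real.log x + p₂ * Real.log x ^ 2) * ‖Lap f x‖ ^ 2 := by
      refine integral_nonneg fun x => mul_nonneg ?_ (sq_nonneg _)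
      have h1 : b ^ 2 ≤ 4 * a * p₂ := by linarith
      have h2 : 0 ≤ p₂ * (a + b * Real.log x + p₂ * Real.log x ^ 2) := by
        nlinarith [sq_nonneg (2 * p₂ * Real.log x + b)]
      exact nonneg_of_mul_nonneg_right h2 hp₂
    exact_mod_cast this
end
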